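/- Let Ω ⊆ ℂⁿ be a pseudoconvex open set and let φ: Ω → ℝ be a C² plurisubharmonic function satisfying i∂∂̄φ ≥ δβ with δ > 0. Let K ⊆ Ω be compact. Then there exists a constant C (depending on δ, K, Ω, φ and n) such that for every k ≥ 1 and every smooth ∂̄-closed (0,1)-form f on Ω with sup_Ω |f|² e^{−kφ} < ∞ and ∫_Ω |f|² e^{−kφ} dλ < ∞, the (smooth) L²(Ω, e^{−kφ})-minimal solution v of ∂̄v = f satisfies sup_K |v|² e^{−kφ} ≤ (C/k) sup_Ω |f|² e^{−kφ}. -/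

import Mathlib

open MeasureTheory Complex Metric Set
open scoped ComplexConjugate

noncomputable section

/-- `ℂⁿ` with the Euclidean norm. -/
abbrev Cn (n : ℕ) := EuclideanSpace ℂ (Fin n)

variable {n : ℕ}

instance : MeasurableSpace (Cn n) := borel _
instance : BorelSpace (Cn n) := ⟨rfl⟩

/-- The Levi form of `φ` at `z` applied to `w`:
`L_φ(z; w) = ¼ (D²φ(z)[w,w] + D²φ(z)[iw,iw])` where `D²φ` is the second real Fréchet
derivative. -/
def LeviForm (φ : Cn n → ℝ) (z w : Cn n) : ℝ :=
  (1 / 4) * (fderiv ℝ (fderiv ℝ φ) z w w +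
    fderiv ℝ (fderiv ℝ φ) z (Complex.I • w) (Complex.I • w))

/-- `Ω` is pseudoconvex: it admits a `C²` exhaustion function with nonnegative Levi form. -/
def Pseudoconvex (Ω : Set (Cn n)) : Prop :=
  ∃ ρ : Cn n → ℝ, ContDiffOn ℝ 2 ρ Ω ∧
    (∀ c : ℝ, IsCompact {z ∈ Ω | ρ z ≤ c}) ∧
    ∀ z ∈ Ω, ∀ w : Cn n, 0 ≤ LeviForm ρ z w

/-- The `j`-th standard basis vector of `ℂⁿ`. -/
def e (n : ℕ) (j : Fin n) : Cn n := EuclideanSpace.single j (1 : ℂ)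

/-- The components of `∂̄v`: `(∂̄v)_j = ½(∂v/∂x_j + i ∂v/∂y_j)`. -/
def dbar (v : Cn n → ℂ) (z : Cn n) (j : Fin n) : ℂ :=
  (1 / 2) * (fderiv ℝ v z (e n j) + Complex.I * fderiv ℝ v z (Complex.I • e n j))

/-- The pointwise squared norm `|f(z)|² = Σ_j |f_j(z)|²` of a `(0,1)`-form. -/
def formNormSq (f : Cn n → Fin n → ℂ) (z : Cn n) : ℝ := ∑ j, ‖f z j‖ ^ 2

/-- A `(0,1)`-form `f` is smooth on `Ω` if each component is. -/
def SmoothFormOn (Ω : Set (Cn n)) (f : Cn n → Fin n → ℂ) : Prop :=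
  ∀ j, ContDiffOn ℝ (⊤ : ℕ∞) (fun z => f z j) Ω

/-- A `(0,1)`-form `f` is `∂̄`-closed on `Ω` if `(∂̄f_j)_k = (∂̄f_k)_j` on `Ω`. -/
def DbarClosedOn (Ω : Set (Cn n)) (f : Cn n → Fin n → ℂ) : Prop :=
  ∀ z ∈ Ω, ∀ j k : Fin n, dbar (fun w => f w j) z k = dbar (fun w => f w k) z j

/-- `v` belongs to the weighted space `L²(Ω, e^{-w})`. -/
def MemL2 (Ω : Set (Cn n)) (w : Cn n → ℝ) (v : Cn n → ℂ) : Prop :=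
  AEStronglyMeasurable v (volume.restrict Ω) ∧
  IntegrableOn (fun z => ‖v z‖ ^ 2 * Real.exp (-w z)) Ω volume

/-- `v` is orthogonal to every holomorphic function in `L²(Ω, e^{-w})`. -/
def OrthToHolo (Ω : Set (Cn n)) (w : Cn n → ℝ) (v : Cn n → ℂ) : Prop :=
  ∀ h : Cn n → ℂ, DifferentiableOn ℂ h Ω → MemL2 Ω w h →
    ∫ z in Ω, v z * conj (h z) * (Real.exp (-w z) : ℂ) = 0

/-- `ψ` is a test function on `Ω`. -/
def IsTestOn (Ω : Set (Cn n)) (ψ : Cn n → ℂ) : Prop :=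
  ContDiff ℝ (⊤ : ℕ∞) ψ ∧ HasCompactSupport ψ ∧ tsupport ψ ⊆ Ω

/-- `∂̄v = f` on `Ω` in the sense of distributions. -/
def DbarEqOn (Ω : Set (Cn n)) (v : Cn n → ℂ) (f : Cn n → Fin n → ℂ) : Prop :=
  ∀ ψ : Cn n → ℂ, IsTestOn Ω ψ → ∀ j : Fin n,
    ∫ z in Ω, v z * dbar ψ z j = -∫ z in Ω, f z j * ψ z

/-- `v` is the `L²(Ω, e^{-w})`-minimal solution of `∂̄v = f`: it solves the equation in the
sense of distributions and is orthogonal to all holomorphic functions in `L²(Ω, e^{-w})`. -/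
def MinimalSolution (Ω : Set (Cn n)) (w : Cn n → ℝ) (f : Cn n → Fin n → ℂ) (v : Cn n → ℂ) :
    Prop :=
  MemL2 Ω w v ∧ DbarEqOn Ω v f ∧ OrthToHolo Ω w v

/-- The components of `∂v`: `(∂v)_j = ½(∂v/∂x_j - i ∂v/∂y_j)`. -/
def del (v : Cn n → ℂ) (z : Cn n) (j : Fin n) : ℂ :=
  (1 / 2) * (fderiv ℝ v z (e n j) - Complex.I * fderiv ℝ v z (Complex.I • e n j))

section Calculus

variable {u v : Cn n → ℂ} {z : Cn n} {j : Fin n}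

theorem dbar_congr (h : u =ᶠ[nhds z] v) : dbar u z j = dbar v z j := by
  simp only [dbar, h.fderiv_eq]

theorem del_congr (h : u =ᶠ[nhds z] v) : del u z j = del v z j := by
  simp only [del, h.fderiv_eq]

theorem dbar_mul (hu : DifferentiableAt ℝ u z) (hv : DifferentiableAt ℝ v z) :
    dbar (fun z => u z * v z) z j = dbar u z j * v z + u z * dbar v z j := by
  simp only [dbar, fderiv_fun_mul hu hv, add_apply, smul_apply, smul_eq_mul]
  ring

theorem del_mul (hu : DifferentiableAt ℝ u z) (hv : DifferentiableAt ℝ v z) :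
    del (fun z => u z * v z) z j = del u z j * v z + u z * del v z j := by
  simp only [del, fderiv_fun_mul hu hv, add_apply, smul_apply, smul_eq_mul]
  ring

theorem dbar_sub (hu : DifferentiableAt ℝ u z) (hv : DifferentiableAt ℝ v z) :
    dbar (fun z => u z - v z) z j = dbar u z j - dbar v z j := by
  simp only [dbar, fderiv_fun_sub hu hv, sub_apply]
  ring

theorem del_add (hu : DifferentiableAt ℝ u z) (hv : DifferentiableAt ℝ v z) :
    del (fun z => u z + v z) z j = del u z j + del v z j := by
  simp only [del, fderiv_fun_add hu hv, add_apply]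
  ring

theorem del_sub (hu : DifferentiableAt ℝ u z) (hv : DifferentiableAt ℝ v z) :
    del (fun z => u z - v z) z j = del u z j - del v z j := by
  simp only [del, fderiv_fun_sub hu hv, sub_apply]
  ring

theorem del_const_mul (hu : DifferentiableAt ℝ u z) (c : ℂ) :
    del (fun z => c * u z) z j = c * del u z j := by
  simp only [del, fderiv_const_mul hu c, smul_apply, smul_eq_mul]
  ring

theorem dbar_const_mul (hu : DifferentiableAt ℝ u z) (c : ℂ) :
    dbar (fun z => c * u z) z j = c * dbar u z j := by
  simp only [dbar, fderiv_const_mul hu c, smul_apply, smul_eq_mul]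
  ring

theorem fderiv_conj_apply (u : Cn n → ℂ) (z w : Cn n) :
    fderiv ℝ (fun z => conj (u z)) z w = conj (fderiv ℝ u z w) := by
  have := (Complex.conjCLE).comp_fderiv (f := u) (x := z)
  have h2 := congrArg (fun L => L w) this
  simpa [Function.comp_def] using h2

theorem dbar_conj (u : Cn n → ℂ) (z : Cn n) (j : Fin n) :
    dbar (fun z => conj (u z)) z j = conj (del u z j) := by
  have h2 : (starRingEnd ℂ) 2 = 2 := Complex.conj_ofNat 2
  simp [dbar, del, fderiv_conj_apply, h2]

theorem del_conj (u : Cn n → ℂ) (z : Cn n) (j : Fin n) :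
    del (fun z => conj (u z)) z j = conj (dbar u z j) := by
  have h2 : (starRingEnd ℂ) 2 = 2 := Complex.conj_ofNat 2
  simp [dbar, del, fderiv_conj_apply, h2]
  ring

theorem fderiv_ofReal_apply {φ : Cn n → ℝ} (h : DifferentiableAt ℝ φ z) (w : Cn n) :
    fderiv ℝ (fun z => (φ z : ℂ)) z w = (fderiv ℝ φ z w : ℝ) := by
  have := (Complex.ofRealCLM.hasFDerivAt.comp z h.hasFDerivAt).fderiv
  have h2 := congrArg (fun L => L w) this
  simpa [Function.comp_def] using h2

theorem del_ofReal (φ : Cn n → ℝ) (z : Cn n) (j : Fin n) :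
    del (fun z => (φ z : ℂ)) z j = conj (dbar (fun z => (φ z : ℂ)) z j) := by
  have := del_conj (fun z => (φ z : ℂ)) z j
  simpa using this

theorem dbar_real_comp {φ : Cn n → ℝ} {F : ℝ → ℝ} {F' : ℝ} (h : DifferentiableAt ℝ φ z)
    (hF : HasDerivAt F F' (φ z)) :
    dbar (fun z => (F (φ z) : ℂ)) z j = F' * dbar (fun z => (φ z : ℂ)) z j := by
  have h1 : HasFDerivAt (fun z => F (φ z)) (F' • fderiv ℝ φ z) z :=
    hF.comp_hasFDerivAt z h.hasFDerivAt
  simp only [dbar, fderiv_ofReal_apply h, fderiv_ofReal_apply h1.differentiableAt, h1.fderiv,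
    smul_apply, smul_eq_mul]
  push_cast
  ring

theorem sum_smul_e (w : Cn n) : w = ∑ j, w j • e n j := by
  ext i
  simp [e, Pi.single_apply]

/-- Decomposition of the real differential in the basis `dz_j`, `dz̄_j`. -/
theorem fderiv_eq_sum (v : Cn n → ℂ) (z w : Cn n) :
    fderiv ℝ v z w = ∑ j, (w j * del v z j + conj (w j) * dbar v z j) := by
  conv_lhs => rw [sum_smul_e w, map_sum]
  refine Finset.sum_congr rfl fun j _ => ?_
  have h : w j • e n j = (w j).re • e n j + (w j).im • (Complex.I • e n j) := by
    conv_lhs => rw [← Complex.re_add_im (w j)]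
    rw [add_smul, mul_smul]; rfl
  rw [h, map_add, map_smul, map_smul]
  have h2 : w j = (w j).re + (w j).im * I := (Complex.re_add_im _).symm
  have h3 : conj (w j) = (w j).re - (w j).im * I := by
    apply Complex.ext <;> simp
  generalize (w j).re = a at *
  generalize (w j).im = b at *
  rw [h3, h2]
  simp only [dbar, del, real_smul]
  linear_combination (b * (fderiv ℝ v z) (I • e n j)) * I_sq

theorem fderiv_add_I_fderiv (v : Cn n → ℂ) (z w : Cn n) :
    fderiv ℝ v z w + I * fderiv ℝ v z (I • w) = 2 * ∑ j, conj (w j) * dbar v z j := by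
  rw [fderiv_eq_sum, fderiv_eq_sum, Finset.mul_sum, Finset.mul_sum, ← Finset.sum_add_distrib]
  refine Finset.sum_congr rfl fun j _ => ?_
  simp
  linear_combination (w j * del v z j - conj (w j) * dbar v z j) * I_sq

theorem ContDiff.dbar {m : WithTop ℕ∞} (hv : ContDiff ℝ (m + 1) v) (j : Fin n) :
    ContDiff ℝ m (fun z => dbar v z j) := by
  have h := hv.fderiv_right (m := m) le_rfl
  unfold _root_.dbar
  exact contDiff_const.mul ((h.clm_apply contDiff_const).add
    (contDiff_const.mul (h.clm_apply contDiff_const)))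

theorem ContDiff.del {m : WithTop ℕ∞} (hv : ContDiff ℝ (m + 1) v) (j : Fin n) :
    ContDiff ℝ m (fun z => del v z j) := by
  have h := hv.fderiv_right (m := m) le_rfl
  unfold _root_.del
  exact contDiff_const.mul ((h.clm_apply contDiff_const).sub
    (contDiff_const.mul (h.clm_apply contDiff_const)))

theorem ContDiffOn.dbar {m : WithTop ℕ∞} {U : Set (Cn n)} (hU : IsOpen U)
    (hv : ContDiffOn ℝ (m + 1) v U) (j : Fin n) :
    ContDiffOn ℝ m (fun z => dbar v z j) U := by
  have h := hv.fderiv_of_isOpen hU (m := m) le_rfl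
  unfold _root_.dbar
  exact contDiffOn_const.mul ((h.clm_apply contDiffOn_const).add
    (contDiffOn_const.mul (h.clm_apply contDiffOn_const)))

theorem tsupport_dbar_subset (v : Cn n → ℂ) (j : Fin n) :
    tsupport (fun z => dbar v z j) ⊆ tsupport v := by
  refine closure_minimal (fun z hz => ?_) (isClosed_tsupport _)
  by_contra h
  apply hz
  have : fderiv ℝ v z = 0 := by
    by_contra h2
    exact h (tsupport_fderiv_subset ℝ (subset_tsupport _ h2))
  simp [dbar, this]

theorem tsupport_del_subset (v : Cn n → ℂ) (j : Fin n) :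
    tsupport (fun z => del v z j) ⊆ tsupport v := by
  refine closure_minimal (fun z hz => ?_) (isClosed_tsupport _)
  by_contra h
  apply hz
  have : fderiv ℝ v z = 0 := by
    by_contra h2
    exact h (tsupport_fderiv_subset ℝ (subset_tsupport _ h2))
  simp [del, this]

/-- A function that is `C^m` on an open set and supported in a closed subset of it is `C^m`. -/
theorem ContDiffOn.contDiff_of_support {E F : Type*} [NormedAddCommGroup E] [NormedSpace ℝ E]
    [NormedAddCommGroup F] [NormedSpace ℝ F] {m : WithTop ℕ∞} {f : E → F} {U : Set E}
    (hU : IsOpen U)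
    (hf : ContDiffOn ℝ m f U) (hs : tsupport f ⊆ U) : ContDiff ℝ m f := by
  rw [contDiff_iff_contDiffAt]
  intro x
  by_cases hx : x ∈ U
  · exact hf.contDiffAt (hU.mem_nhds hx)
  · have : f =ᶠ[nhds x] fun _ => 0 :=
      notMem_tsupport_iff_eventuallyEq.1 fun h => hx (hs h)
    exact contDiffAt_const.congr_of_eventuallyEq this

/-- Zero-extension of a product of a function smooth on `U` and a cutoff supported in `U`. -/
theorem ContDiffOn.contDiff_mul {m : WithTop ℕ∞} {U : Set (Cn n)} (hU : IsOpen U)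
    (hu : ContDiffOn ℝ m u U) (hv : ContDiff ℝ m v) (hs : tsupport v ⊆ U) :
    ContDiff ℝ m (fun z => u z * v z) :=
  (hu.mul hv.contDiffOn).contDiff_of_support hU
    ((closure_mono (Function.support_mul_subset_right u v)).trans hs)

theorem integral_fderiv_eq_zero' {F : Cn n → ℂ} (hF : ContDiff ℝ 1 F) (hc : HasCompactSupport F)
    (w : Cn n) : ∫ z, fderiv ℝ F z w = 0 := by
  have hcont : Continuous fun z => fderiv ℝ F z w :=
    (hF.continuous_fderiv one_ne_zero).clm_apply continuous_const
  have hsup : HasCompactSupport fun z => fderiv ℝ F z w := by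
    refine hc.fderiv (𝕜 := ℝ) |>.mono fun z hz => ?_
    intro h; apply hz; simp [h]
  have hi := hcont.integrable_of_hasCompactSupport hsup (μ := volume)
  have := integral_mul_fderiv_eq_neg_fderiv_mul_of_integrable (μ := (volume : Measure (Cn n)))
    (f := fun _ => (1 : ℂ)) (g := F) (v := w) (by simp) (by simpa using hi)
    (by simpa using hF.continuous.integrable_of_hasCompactSupport hc)
    (by simp) (fun x _ => hF.differentiable one_ne_zero x)
  simpa using this

theorem integral_dbar_eq_zero {F : Cn n → ℂ} (hF : ContDiff ℝ 1 F) (hc : HasCompactSupport F)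
    (j : Fin n) : ∫ z, dbar F z j = 0 := by
  have hi : ∀ w : Cn n, Integrable fun z => fderiv ℝ F z w := fun w => by
    have hcont : Continuous fun z => fderiv ℝ F z w :=
      (hF.continuous_fderiv one_ne_zero).clm_apply continuous_const
    refine hcont.integrable_of_hasCompactSupport ?_
    refine hc.fderiv (𝕜 := ℝ) |>.mono fun z hz => ?_
    intro h; apply hz; simp [h]
  simp only [dbar]
  rw [integral_const_mul, integral_add (hi _) ((hi _).const_mul _), integral_const_mul,
    integral_fderiv_eq_zero' hF hc, integral_fderiv_eq_zero' hF hc]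
  simp

/-- Integration by parts for `∂̄`, one factor being compactly supported in `U`. -/
theorem integral_mul_dbar {U : Set (Cn n)} (hU : IsOpen U) (hu : ContDiffOn ℝ 1 u U)
    (hv : ContDiff ℝ 1 v) (hc : HasCompactSupport v) (hs : tsupport v ⊆ U) (j : Fin n) :
    ∫ z, u z * dbar v z j = -∫ z, dbar u z j * v z := by
  have hF := hu.contDiff_mul hU hv hs
  have h0 := integral_dbar_eq_zero hF hc.mul_left j
  have hpt : ∀ z, dbar (fun z => u z * v z) z j = dbar u z j * v z + u z * dbar v z j := by
    intro z
    by_cases hz : z ∈ U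
    · exact dbar_mul ((hu.differentiableOn one_ne_zero).differentiableAt (hU.mem_nhds hz))
        (hv.differentiable one_ne_zero z)
    · have hz' : z ∉ tsupport v := fun h => hz (hs h)
      have h1 := notMem_tsupport_iff_eventuallyEq.1 hz'
      have h2 : dbar v z j = 0 := image_eq_zero_of_notMem_tsupport
        (f := fun z => dbar v z j) fun h => hz' (tsupport_dbar_subset v j h)
      have h3 : (fun z => u z * v z) =ᶠ[nhds z] fun _ => 0 := by
        filter_upwards [h1] with y hy
        simp [hy]
      rw [dbar_congr h3, h2, image_eq_zero_of_notMem_tsupport hz']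
      simp [dbar]
  have hdu : ContDiffOn ℝ 0 (fun z => dbar u z j) U := ContDiffOn.dbar hU (by simpa using hu) j
  have hdv : ContDiff ℝ 0 (fun z => dbar v z j) := ContDiff.dbar (by simpa using hv) j
  have hcv : HasCompactSupport (fun z => dbar v z j) :=
    hc.of_isClosed_subset (isClosed_tsupport _) (tsupport_dbar_subset v j)
  have i1 : Integrable fun z => dbar u z j * v z :=
    (hdu.contDiff_mul hU (hv.of_le zero_le_one) hs).continuous.integrable_of_hasCompactSupport
      hc.mul_left
  have i2 : Integrable fun z => u z * dbar v z j :=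
    ((hu.of_le zero_le_one).contDiff_mul hU hdv
      ((tsupport_dbar_subset v j).trans hs)).continuous.integrable_of_hasCompactSupport hcv.mul_left
  simp only [hpt] at h0
  rw [integral_add i1 i2] at h0
  linear_combination h0

theorem integral_mul_del {U : Set (Cn n)} (hU : IsOpen U) (hu : ContDiffOn ℝ 1 u U)
    (hv : ContDiff ℝ 1 v) (hc : HasCompactSupport v) (hs : tsupport v ⊆ U) (j : Fin n) :
    ∫ z, u z * del v z j = -∫ z, del u z j * v z := by
  have hs' : tsupport (fun z => conj (v z)) ⊆ U := by
    refine (closure_mono ?_).trans hs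
    intro z hz; simpa using hz
  have h := integral_mul_dbar (u := fun z => conj (u z)) (v := fun z => conj (v z)) hU
    (Complex.conjCLE.contDiff.comp_contDiffOn hu)
    (Complex.conjCLE.contDiff.comp hv) (hc.comp_left (g := fun x => conj x) (by simp)) hs' j
  simp only [dbar_conj, ← map_mul] at h
  rw [integral_conj, integral_conj, ← map_neg] at h
  exact (starRingEnd ℂ).injective h

end Calculus

section Cutoff

theorem exists_cutoff {K U : Set (Cn n)} (hK : IsCompact K) (hU : IsOpen U) (hKU : K ⊆ U) :
    ∃ χ : Cn n → ℝ, ContDiff ℝ (⊤ : ℕ∞) χ ∧ HasCompactSupport χ ∧ tsupport χ ⊆ U ∧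
      (∀ᶠ z in nhdsSet K, χ z = 1) ∧ ∀ z, χ z ∈ Icc (0 : ℝ) 1 := by
  obtain ⟨L, hL, hKL, hLU⟩ := exists_compact_between hK hU hKU
  obtain ⟨f, h1, h0, hf⟩ := exists_contMDiffMap_one_nhds_of_subset_interior
    (n := (⊤ : ℕ∞)) (modelWithCornersSelf ℝ (Cn n)) hK.isClosed hKL
  have hs : tsupport f ⊆ L := closure_minimal (fun z hz => by
    by_contra h; exact hz (h0 z h)) hL.isClosed
  exact ⟨f, f.contMDiff.contDiff, hL.of_isClosed_subset (isClosed_tsupport _) hs,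
    hs.trans hLU, h1, hf⟩

/-- A function smooth near a compact set agrees there with a compactly supported one. -/
theorem exists_contDiff_extension {F : Type*} [NormedAddCommGroup F] [NormedSpace ℝ F]
    {m : ℕ∞} {K U : Set (Cn n)} {u : Cn n → F} (hK : IsCompact K) (hU : IsOpen U)
    (hKU : K ⊆ U) (hu : ContDiffOn ℝ m u U) :
    ∃ v : Cn n → F, ContDiff ℝ m v ∧ HasCompactSupport v ∧ tsupport v ⊆ U ∧
      ∀ᶠ z in nhdsSet K, v z = u z := by
  obtain ⟨χ, h1, h2, h3, h4, -⟩ := exists_cutoff hK hU hKU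
  refine ⟨fun z => χ z • u z, ?_, h2.smul_right, ?_, ?_⟩
  · exact ((h1.contDiffOn.of_le (by exact_mod_cast le_top)).smul hu).contDiff_of_support hU
      ((closure_mono (Function.support_smul_subset_left χ u)).trans h3)
  · exact (closure_mono (Function.support_smul_subset_left χ u)).trans h3
  · filter_upwards [h4] with z hz
    simp [hz]

end Cutoff

section MeanValue

/-- Multiplication by a unit complex scalar as a real linear isometry. -/
def unitRotation (c : ℂ) (hc : ‖c‖ = 1) : Cn n ≃ₗᵢ[ℝ] Cn n where
  toFun w := c • w
  invFun w := c⁻¹ • w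
  map_add' := smul_add c
  map_smul' r w := smul_comm c r w
  left_inv w := by
    have : c ≠ 0 := by rintro rfl; simp at hc
    simp [smul_smul, this]
  right_inv w := by
    have : c ≠ 0 := by rintro rfl; simp at hc
    simp [smul_smul, this]
  norm_map' w := by
    change ‖c • w‖ = ‖w‖
    rw [norm_smul, hc, one_mul]

theorem integral_comp_rotation {F : Type*} [NormedAddCommGroup F] [NormedSpace ℝ F]
    (c : ℂ) (hc : ‖c‖ = 1) (f : Cn n → F) : ∫ w, f (c • w) = ∫ w, f w :=
  (unitRotation c hc).measurePreserving.integral_comp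
    (unitRotation c hc).toHomeomorph.measurableEmbedding f

theorem norm_sum_conj_mul_le (w : Cn n) (d : Fin n → ℂ) {B : ℝ} (hB : 0 ≤ B)
    (hd : ∑ j, ‖d j‖ ^ 2 ≤ B ^ 2) : ‖∑ j, conj (w j) * d j‖ ≤ ‖w‖ * B := by
  have h1 : ‖∑ j, conj (w j) * d j‖ ≤ ∑ j, ‖w j‖ * ‖d j‖ :=
    (norm_sum_le _ _).trans (le_of_eq (by simp))
  have h2 := Finset.sum_mul_sq_le_sq_mul_sq Finset.univ (fun j => ‖w j‖) (fun j => ‖d j‖)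
  rw [← EuclideanSpace.norm_sq_eq] at h2
  refine h1.trans (abs_le_of_sq_le_sq' ?_ (by positivity)).2
  calc _ ≤ _ := h2
    _ ≤ ‖w‖ ^ 2 * B ^ 2 := by gcongr
    _ = _ := by ring

/-- The mean of `u` over the circle through `x + w` differs from `u x` by at most
`2 ‖w‖ sup |∂̄u|`. -/
theorem norm_circle_mean_sub_le {u : Cn n → ℂ} (hu : ContDiff ℝ 1 u) {x w : Cn n} {B : ℝ}
    (hB : 0 ≤ B) (hd : ∀ z ∈ closedBall x ‖w‖, ∑ j, ‖dbar u z j‖ ^ 2 ≤ B ^ 2) :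
    ‖(∫ θ in (0 : ℝ)..(2 * Real.pi), u (x + cexp (θ * I) • w)) - (2 * Real.pi) * u x‖ ≤
      2 * Real.pi * (2 * (‖w‖ * B)) := by
  set W : ℝ → Cn n := fun θ => cexp (θ * I) • w with hW
  have hWn : ∀ θ, ‖W θ‖ = ‖w‖ := fun θ => by
    simp [hW, norm_smul, Complex.norm_exp_ofReal_mul_I]
  have hWc : Continuous W := by fun_prop
  have hWd : ∀ θ : ℝ, HasDerivAt W (I • W θ) θ := fun θ => by
    have h1 : HasDerivAt (fun θ : ℝ => cexp (θ * I)) (cexp (θ * I) * I) θ := by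
      have := ((Complex.ofRealCLM.hasDerivAt (x := θ)).mul_const I).cexp
      simpa using this
    have h2 := h1.smul_const w
    have h3 : I • W θ = (cexp (θ * I) * I) • w := by simp only [hW, smul_smul, mul_comm]
    rw [h3]
    exact h2
  have hpos : (0 : ℝ) ≤ 2 * Real.pi := by positivity
  have hfc : Continuous fun p : (Cn n) × (Cn n) => fderiv ℝ u p.1 p.2 :=
    ((hu.continuous_fderiv one_ne_zero).comp continuous_fst).clm_apply continuous_snd
  have hda : ∀ z, HasFDerivAt u (fderiv ℝ u z) z := fun z =>
    (hu.differentiable one_ne_zero z).hasFDerivAt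
  -- radial derivative
  set P : ℝ → ℝ → ℂ := fun t θ => fderiv ℝ u (x + t • W θ) (W θ)
  set Q : ℝ → ℝ → ℂ := fun t θ => fderiv ℝ u (x + t • W θ) (I • W θ)
  have hPc : Continuous (Function.uncurry P) :=
    hfc.comp ((continuous_const.add (continuous_fst.smul (hWc.comp continuous_snd))).prodMk
      (hWc.comp continuous_snd))
  have hQc : Continuous (Function.uncurry Q) :=
    hfc.comp ((continuous_const.add (continuous_fst.smul (hWc.comp continuous_snd))).prodMk
      ((hWc.comp continuous_snd).const_smul I))
  have hrad : ∀ θ, u (x + W θ) - u x = ∫ t in (0 : ℝ)..1, P t θ := fun θ => by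
    have hd : ∀ t ∈ uIcc (0 : ℝ) 1, HasDerivAt (fun t : ℝ => u (x + t • W θ)) (P t θ) t :=
      fun t _ => (hda _).comp_hasDerivAt t
        (by simpa using ((hasDerivAt_id t).smul_const (W θ)).const_add x)
    rw [intervalIntegral.integral_eq_sub_of_hasDerivAt hd
      ((hPc.comp (continuous_id.prodMk continuous_const)).intervalIntegrable 0 1)]
    simp
  have htan : ∀ t ∈ uIoc (0 : ℝ) 1, ∫ θ in (0 : ℝ)..(2 * Real.pi), Q t θ = 0 := fun t ht => by
    have ht0 : t ≠ 0 := by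
      rw [uIoc_of_le zero_le_one] at ht; exact ht.1.ne'
    have hd : ∀ θ ∈ uIcc (0 : ℝ) (2 * Real.pi),
        HasDerivAt (fun θ : ℝ => u (x + t • W θ)) (t * Q t θ) θ := fun θ _ => by
      have := (hda _).comp_hasDerivAt θ (((hWd θ).const_smul t).const_add x)
      have h3 : (t : ℂ) * Q t θ = fderiv ℝ u (x + t • W θ) (t • I • W θ) := by simp [Q]
      rw [h3]
      exact this
    have h := intervalIntegral.integral_eq_sub_of_hasDerivAt hd
      (((hQc.comp (continuous_const.prodMk continuous_id)).const_smul (t : ℂ)).intervalIntegrable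
        0 (2 * Real.pi))
    rw [intervalIntegral.integral_const_mul] at h
    have h2 : W (2 * Real.pi) = W 0 := by simp [hW]
    rw [h2, sub_self] at h
    exact (mul_eq_zero.1 h).resolve_left (by exact_mod_cast ht0)
  have hswap : ∀ F : ℝ → ℝ → ℂ, Continuous (Function.uncurry F) →
      ∫ t in (0 : ℝ)..1, ∫ θ in (0 : ℝ)..(2 * Real.pi), F t θ =
        ∫ θ in (0 : ℝ)..(2 * Real.pi), ∫ t in (0 : ℝ)..1, F t θ := fun F hF => by
    simp only [intervalIntegral.integral_of_le hpos]
    refine intervalIntegral_integral_swap ?_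
    rw [uIoc_of_le zero_le_one, Measure.prod_restrict]
    exact (hF.continuousOn.integrableOn_compact (isCompact_Icc.prod isCompact_Icc)).mono_set
      (prod_mono Ioc_subset_Icc_self Ioc_subset_Icc_self)
  have hcθ : ∀ F : ℝ → ℝ → ℂ, Continuous (Function.uncurry F) →
      Continuous fun θ => ∫ t in (0 : ℝ)..1, F t θ := fun F hF =>
    intervalIntegral.continuous_parametric_intervalIntegral_of_continuous' (f := fun θ t => F t θ)
      (hF.comp continuous_swap) 0 1
  have hQ0 : ∫ θ in (0 : ℝ)..(2 * Real.pi), ∫ t in (0 : ℝ)..1, I * Q t θ = 0 := by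
    have h : ∫ t in (0 : ℝ)..1, ∫ θ in (0 : ℝ)..(2 * Real.pi), Q t θ = ∫ t in (0 : ℝ)..1, 0 :=
      intervalIntegral.integral_congr_ae (Filter.Eventually.of_forall htan)
    rw [hswap Q hQc] at h
    simp only [intervalIntegral.integral_const_mul]
    rw [h]; simp
  have huc : Continuous fun θ => u (x + W θ) := hu.continuous.comp (continuous_const.add hWc)
  have hkey : (∫ θ in (0 : ℝ)..(2 * Real.pi), u (x + W θ)) - (2 * Real.pi) * u x =
      ∫ θ in (0 : ℝ)..(2 * Real.pi), ∫ t in (0 : ℝ)..1, (P t θ + I * Q t θ) := by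
    have h1 : ∀ θ, ∫ t in (0 : ℝ)..1, (P t θ + I * Q t θ) =
        (u (x + W θ) - u x) + ∫ t in (0 : ℝ)..1, I * Q t θ := fun θ => by
      rw [hrad, intervalIntegral.integral_add]
      · exact (hPc.comp (continuous_id.prodMk continuous_const)).intervalIntegrable _ _
      · exact (continuous_const.mul
          (hQc.comp (continuous_id.prodMk continuous_const))).intervalIntegrable _ _
    simp only [h1]
    rw [intervalIntegral.integral_add, hQ0, intervalIntegral.integral_sub,
      intervalIntegral.integral_const]
    · simp
    · exact huc.intervalIntegrable _ _
    · exact continuous_const.intervalIntegrable _ _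
    · exact (huc.sub continuous_const).intervalIntegrable _ _
    · exact (hcθ (fun t θ => I * Q t θ) (continuous_const.mul hQc)).intervalIntegrable _ _
  rw [hkey]
  have hb : ∀ θ ∈ uIoc (0 : ℝ) (2 * Real.pi),
      ‖∫ t in (0 : ℝ)..1, (P t θ + I * Q t θ)‖ ≤ 2 * (‖w‖ * B) := fun θ _ => by
    have := intervalIntegral.norm_integral_le_of_norm_le_const (a := (0 : ℝ)) (b := 1)
      (f := fun t => P t θ + I * Q t θ) (C := 2 * (‖w‖ * B)) fun t ht => by
        rw [uIoc_of_le zero_le_one] at ht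
        simp only [P, Q]
        rw [fderiv_add_I_fderiv, norm_mul]
        have h3 : x + t • W θ ∈ closedBall x ‖w‖ := by
          rw [mem_closedBall, dist_eq_norm, add_sub_cancel_left, norm_smul, hWn, Real.norm_eq_abs,
            abs_of_pos ht.1]
          exact mul_le_of_le_one_left (norm_nonneg _) ht.2
        have := norm_sum_conj_mul_le (W θ) (dbar u (x + t • W θ)) hB (hd _ h3)
        rw [hWn] at this
        simpa using this
    simpa using this
  have := intervalIntegral.norm_integral_le_of_norm_le_const hb
  rw [sub_zero, abs_of_nonneg hpos] at this
  linarith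

/-- Rotation invariant averages of `u` around `x` differ from `u x` by at most
`2 s sup |∂̄u|`. -/
theorem norm_average_sub_le {u : Cn n → ℂ} {U : Set (Cn n)} (hU : IsOpen U)
    (hu : ContDiffOn ℝ 1 u U) {x : Cn n} {s B : ℝ} (hxU : closedBall x s ⊆ U)
    (hB : 0 ≤ B) (hd : ∀ z ∈ closedBall x s, ∑ j, ‖dbar u z j‖ ^ 2 ≤ B ^ 2)
    {ρ : Cn n → ℝ} (hρ0 : ∀ w, 0 ≤ ρ w) (hρ : Integrable ρ) (hρs : ∀ w, ρ w ≠ 0 → ‖w‖ ≤ s)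
    (hrot : ∀ c : ℂ, ‖c‖ = 1 → ∀ w, ρ (c • w) = ρ w) :
    ‖(∫ w, ρ w * u (x + w)) - (∫ w, ρ w : ℝ) * u x‖ ≤ 2 * s * B * ∫ w, ρ w := by
  obtain ⟨v, hv, hvc, -, hvu⟩ := exists_contDiff_extension (m := 1)
    (isCompact_closedBall x s) hU hxU hu
  replace hv : ContDiff ℝ 1 v := hv
  have hev : ∀ z ∈ closedBall x s, v =ᶠ[nhds z] u := fun z hz =>
    (eventually_nhdsSet_iff_forall.1 hvu) z hz
  by_cases hs : 0 ≤ s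
  swap
  · have : ρ = 0 := by
      ext w; by_contra h
      exact hs ((norm_nonneg w).trans (hρs w h))
    simp [this]
  have hx : v x = u x := (hev x (mem_closedBall_self hs)).eq_of_nhds
  have heq : ∀ w, (ρ w : ℂ) * u (x + w) = ρ w * v (x + w) := fun w => by
    by_cases h : ρ w = 0
    · simp [h]
    · rw [(hev (x + w) (by simpa using hρs w h)).eq_of_nhds]
  simp only [heq]
  rw [← hx]
  obtain ⟨C, hC⟩ := hvc.exists_bound_of_continuous hv.continuous
  have hpos : (0 : ℝ) ≤ 2 * Real.pi := by positivity
  have h1 : ∀ θ : ℝ, ∫ w, (ρ w : ℂ) * v (x + cexp (θ * I) • w) = ∫ w, ρ w * v (x + w) :=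
    fun θ => by
      rw [← integral_comp_rotation (cexp (θ * I)) (Complex.norm_exp_ofReal_mul_I θ)
        (fun w => (ρ w : ℂ) * v (x + w))]
      simp only [hrot _ (Complex.norm_exp_ofReal_mul_I θ)]
  have hint : Integrable (Function.uncurry fun (θ : ℝ) (w : Cn n) =>
      (ρ w : ℂ) * v (x + cexp (θ * I) • w))
      ((volume.restrict (uIoc 0 (2 * Real.pi))).prod volume) := by
    have hc : Continuous fun p : ℝ × Cn n => v (x + cexp (p.1 * I) • p.2) :=
      hv.continuous.comp (by fun_prop)
    have : IsFiniteMeasure (volume.restrict (uIoc 0 (2 * Real.pi))) :=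
      ⟨by rw [Measure.restrict_apply_univ, uIoc_of_le hpos]; exact measure_Ioc_lt_top⟩
    have hρ' : Integrable (fun p : ℝ × Cn n => (ρ p.2 : ℂ))
        ((volume.restrict (uIoc 0 (2 * Real.pi))).prod volume) :=
      (hρ.ofReal (𝕜 := ℂ)).comp_snd _
    exact hρ'.mul_bdd hc.aestronglyMeasurable (Filter.Eventually.of_forall fun p => hC _)
  have h2 : (2 * Real.pi : ℂ) * ∫ w, ρ w * v (x + w) =
      ∫ w, ρ w * ∫ θ in (0 : ℝ)..(2 * Real.pi), v (x + cexp (θ * I) • w) := by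
    have := intervalIntegral_integral_swap hint
    simp only [h1, intervalIntegral.integral_const, intervalIntegral.integral_const_mul] at this
    rw [← this]
    simp
  have hi1 : Integrable fun w => (ρ w : ℂ) * ∫ θ in (0 : ℝ)..(2 * Real.pi),
      v (x + cexp (θ * I) • w) := by
    have := hint.integral_prod_right
    rw [uIoc_of_le hpos] at this
    simpa [Function.uncurry, intervalIntegral.integral_of_le hpos, integral_const_mul] using this
  have h3 : (2 * Real.pi : ℂ) * ((∫ w, ρ w * v (x + w)) - (∫ w, ρ w : ℝ) * v x) =
      ∫ w, (ρ w : ℂ) * ((∫ θ in (0 : ℝ)..(2 * Real.pi), v (x + cexp (θ * I) • w)) -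
        2 * Real.pi * v x) := by
    have hi2 : Integrable fun w => (ρ w : ℂ) * (2 * Real.pi * v x) :=
      (hρ.ofReal (𝕜 := ℂ)).mul_const _
    simp only [mul_sub]
    rw [integral_sub hi1 hi2, h2, integral_mul_const, integral_complex_ofReal]
    ring
  have h4 : ‖(2 * Real.pi : ℂ) * ((∫ w, ρ w * v (x + w)) - (∫ w, ρ w : ℝ) * v x)‖ ≤
      ∫ w, ρ w * (2 * Real.pi * (2 * (s * B))) := by
    rw [h3]
    refine norm_integral_le_of_norm_le (hρ.mul_const _) (Filter.Eventually.of_forall fun w => ?_)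
    rw [norm_mul, Complex.norm_real, Real.norm_of_nonneg (hρ0 w)]
    by_cases h : ρ w = 0
    · simp [h]
    have hw := hρs w h
    refine mul_le_mul_of_nonneg_left ((norm_circle_mean_sub_le hv hB fun z hz => ?_).trans ?_)
      (hρ0 w)
    · have hz' := closedBall_subset_closedBall hw hz
      simp only [fun j => dbar_congr (j := j) (hev z hz')]
      exact hd z hz'
    · gcongr
  rw [norm_mul, integral_mul_const] at h4
  have h5 : ‖(2 * Real.pi : ℂ)‖ = 2 * Real.pi := by
    simp [abs_of_pos Real.pi_pos]
  rw [h5] at h4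
  have h6 : (0 : ℝ) < 2 * Real.pi := by positivity
  refine le_of_mul_le_mul_left (h4.trans (le_of_eq ?_)) h6
  ring

end MeanValue

section SecondOrder

theorem fderiv_sub_I_fderiv (v : Cn n → ℂ) (z w : Cn n) :
    fderiv ℝ v z w - I * fderiv ℝ v z (I • w) = 2 * ∑ j, w j * del v z j := by
  rw [fderiv_eq_sum, fderiv_eq_sum, Finset.mul_sum, Finset.mul_sum, ← Finset.sum_sub_distrib]
  refine Finset.sum_congr rfl fun j _ => ?_
  simp
  linear_combination (-w j * del v z j + conj (w j) * dbar v z j) * I_sq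

theorem fderiv_fderiv_apply {F : Type*} [NormedAddCommGroup F] [NormedSpace ℝ F]
    {v : Cn n → F} {z : Cn n} (hv : ContDiffAt ℝ 2 v z) (a b : Cn n) :
    fderiv ℝ (fun z => fderiv ℝ v z b) z a = fderiv ℝ (fderiv ℝ v) z a b := by
  have h : DifferentiableAt ℝ (fderiv ℝ v) z :=
    (hv.fderiv_right (m := 1) (by norm_num)).differentiableAt one_ne_zero
  rw [fderiv_clm_apply h (differentiableAt_const b)]
  simp

theorem fderiv_fderiv_symm {F : Type*} [NormedAddCommGroup F] [NormedSpace ℝ F]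
    {v : Cn n → F} {z : Cn n} (hv : ContDiffAt ℝ 2 v z) (a b : Cn n) :
    fderiv ℝ (fderiv ℝ v) z a b = fderiv ℝ (fderiv ℝ v) z b a :=
  (hv.isSymmSndFDerivAt (by simp)).eq a b

theorem differentiableAt_fderiv_apply {F : Type*} [NormedAddCommGroup F] [NormedSpace ℝ F]
    {v : Cn n → F} {z : Cn n} (hv : ContDiffAt ℝ 2 v z) (b : Cn n) :
    DifferentiableAt ℝ (fun z => fderiv ℝ v z b) z :=
  ((hv.fderiv_right (m := 1) (by norm_num)).differentiableAt one_ne_zero).clm_apply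
    (differentiableAt_const b)

theorem dbar_del_comm {v : Cn n → ℂ} {z : Cn n} (hv : ContDiffAt ℝ 2 v z) (j k : Fin n) :
    dbar (fun z => del v z j) z k = del (fun z => dbar v z k) z j := by
  have h1 := fun b => differentiableAt_fderiv_apply hv b
  have e1 : ∀ a, fderiv ℝ (fun z => del v z j) z a =
      (1 / 2) * (fderiv ℝ (fderiv ℝ v) z a (e n j) -
        I * fderiv ℝ (fderiv ℝ v) z a (I • e n j)) := fun a => by
    unfold del
    rw [fderiv_const_mul ((h1 _).fun_sub ((h1 _).const_mul _)), fderiv_fun_sub (h1 _)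
      ((h1 _).const_mul _), fderiv_const_mul (h1 _)]
    simp [fderiv_fderiv_apply hv]
  have e2 : ∀ a, fderiv ℝ (fun z => dbar v z k) z a =
      (1 / 2) * (fderiv ℝ (fderiv ℝ v) z a (e n k) +
        I * fderiv ℝ (fderiv ℝ v) z a (I • e n k)) := fun a => by
    unfold dbar
    rw [fderiv_const_mul ((h1 _).fun_add ((h1 _).const_mul _)), fderiv_fun_add (h1 _)
      ((h1 _).const_mul _), fderiv_const_mul (h1 _)]
    simp [fderiv_fderiv_apply hv, mul_add]
  rw [dbar, del, e1, e1, e2, e2, fderiv_fderiv_symm hv (e n j), fderiv_fderiv_symm hv (e n j),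
    fderiv_fderiv_symm hv (I • e n j), fderiv_fderiv_symm hv (I • e n j)]
  ring

/-- The complex Hessian `∂²Φ/∂z_j∂z̄_k`. -/
def complexHessian (Φ : Cn n → ℝ) (z : Cn n) (j k : Fin n) : ℂ :=
  dbar (fun z => del (fun z => (Φ z : ℂ)) z j) z k

theorem contDiffAt_ofReal {m : WithTop ℕ∞} {Φ : Cn n → ℝ} {z : Cn n} (h : ContDiffAt ℝ m Φ z) :
    ContDiffAt ℝ m (fun z => (Φ z : ℂ)) z :=
  Complex.ofRealCLM.contDiff.contDiffAt.comp z h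

theorem differentiableAt_del {v : Cn n → ℂ} {z : Cn n} (hv : ContDiffAt ℝ 2 v z) (j : Fin n) :
    DifferentiableAt ℝ (fun z => del v z j) z := by
  have h1 := fun b => differentiableAt_fderiv_apply hv b
  exact ((h1 _).sub ((h1 _).const_mul _)).const_mul _

theorem dbar_finset_sum {ι : Type*} (s : Finset ι) {u : ι → Cn n → ℂ} {z : Cn n}
    (h : ∀ i, DifferentiableAt ℝ (u i) z) (k : Fin n) :
    dbar (fun z => ∑ i ∈ s, u i z) z k = ∑ i ∈ s, dbar (u i) z k := by
  simp only [dbar, fderiv_fun_sum (fun i _ => h i), sum_apply, Finset.mul_sum,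
    ← Finset.sum_add_distrib, mul_add]

theorem levi_eq_sum {Φ : Cn n → ℝ} {z : Cn n} (h : ContDiffAt ℝ 2 Φ z) (w : Cn n) :
    ∑ j, ∑ k, complexHessian Φ z j k * (w j * conj (w k)) = (LeviForm Φ z w : ℂ) := by
  have hc := contDiffAt_ofReal h
  set v : Cn n → ℂ := fun z => (Φ z : ℂ)
  have hd := fun j => differentiableAt_del hc j
  have h1 := fun b => differentiableAt_fderiv_apply hc b
  have hH : ∀ a b, fderiv ℝ (fderiv ℝ v) z a b = (fderiv ℝ (fderiv ℝ Φ) z a b : ℝ) := by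
    intro a b
    rw [← fderiv_fderiv_apply hc, ← fderiv_fderiv_apply h,
      ← fderiv_ofReal_apply (differentiableAt_fderiv_apply h b)]
    have hev : (fun z => fderiv ℝ v z b) =ᶠ[nhds z] fun z => ((fderiv ℝ Φ z b : ℝ) : ℂ) := by
      have := h.eventually (by simp)
      filter_upwards [this] with y hy
      exact fderiv_ofReal_apply (hy.differentiableAt two_ne_zero) b
    rw [hev.fderiv_eq]
  set V : Cn n → ℂ := fun z => ∑ j, w j * del v z j with hV
  have hV2 : V = fun z => (1 / 2) * (fderiv ℝ v z w - I * fderiv ℝ v z (I • w)) := by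
    ext y; rw [fderiv_sub_I_fderiv]; ring
  have hVd : ∀ a, fderiv ℝ V z a = (1 / 2) * (fderiv ℝ (fderiv ℝ v) z a w -
        I * fderiv ℝ (fderiv ℝ v) z a (I • w)) := fun a => by
    rw [hV2, fderiv_const_mul ((h1 _).fun_sub ((h1 _).const_mul _)), fderiv_fun_sub (h1 _)
      ((h1 _).const_mul _), fderiv_const_mul (h1 _)]
    simp [fderiv_fderiv_apply hc]
  have h2 := fderiv_add_I_fderiv V z w
  rw [hVd, hVd, hH, hH, hH, hH, fderiv_fderiv_symm h (I • w) w] at h2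
  have h3 : ∀ k, dbar V z k = ∑ j, w j * complexHessian Φ z j k := fun k => by
    rw [hV, dbar_finset_sum _ (fun j => (hd j).const_mul (w j))]
    exact Finset.sum_congr rfl fun j _ => dbar_const_mul (hd j) _
  rw [Finset.sum_comm]
  have h4 : ∑ k, ∑ j, complexHessian Φ z j k * (w j * conj (w k)) =
      ∑ k, conj (w k) * dbar V z k := by
    refine Finset.sum_congr rfl fun k _ => ?_
    rw [h3, Finset.mul_sum]
    exact Finset.sum_congr rfl fun j _ => by ring
  rw [h4]
  have h5 : ∑ k, conj (w k) * dbar V z k = (1 / 2) * (2 * ∑ k, conj (w k) * dbar V z k) := by ring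
  rw [h5, ← h2, LeviForm]
  push_cast
  linear_combination (-1 / 4) * (fderiv ℝ (fderiv ℝ Φ) z (I • w) (I • w) : ℂ) * I_sq

end SecondOrder

section MorreyKohnHormander

variable {Φ : Cn n → ℝ}

/-- The twisted derivative `e^Φ ∂_j (e^{-Φ} a)`. -/
def twistedDel (Φ : Cn n → ℝ) (a : Cn n → ℂ) (z : Cn n) (j : Fin n) : ℂ :=
  del a z j - del (fun z => (Φ z : ℂ)) z j * a z

theorem contDiff_weight {m : WithTop ℕ∞} (hΦ : ContDiff ℝ m Φ) :
    ContDiff ℝ m fun z => (Real.exp (-Φ z) : ℂ) :=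
  Complex.ofRealCLM.contDiff.comp hΦ.neg.exp

theorem dbar_weight {z : Cn n} (hΦ : DifferentiableAt ℝ Φ z) (j : Fin n) :
    dbar (fun z => (Real.exp (-Φ z) : ℂ)) z j =
      -(Real.exp (-Φ z) : ℂ) * dbar (fun z => (Φ z : ℂ)) z j := by
  have h : HasDerivAt (fun t : ℝ => Real.exp (-t)) (-Real.exp (-Φ z)) (Φ z) := by
    simpa using (hasDerivAt_neg (Φ z)).exp
  rw [dbar_real_comp (F := fun t : ℝ => Real.exp (-t)) hΦ h]
  push_cast
  ring

theorem del_weight {z : Cn n} (hΦ : DifferentiableAt ℝ Φ z) (j : Fin n) :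
    del (fun z => (Real.exp (-Φ z) : ℂ)) z j =
      -(Real.exp (-Φ z) : ℂ) * del (fun z => (Φ z : ℂ)) z j := by
  rw [del_ofReal, dbar_weight hΦ, map_mul, map_neg, conj_ofReal, ← del_ofReal]

theorem weight_mul_twistedDel {a : Cn n → ℂ} {z : Cn n} (hΦ : DifferentiableAt ℝ Φ z)
    (ha : DifferentiableAt ℝ a z) (j : Fin n) :
    del (fun z => (Real.exp (-Φ z) : ℂ) * a z) z j = Real.exp (-Φ z) * twistedDel Φ a z j := by
  have hw : DifferentiableAt ℝ (fun z => (Real.exp (-Φ z) : ℂ)) z :=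
    Complex.ofRealCLM.differentiableAt.comp z hΦ.neg.exp
  rw [del_mul hw ha, del_weight hΦ, twistedDel]
  ring

theorem contDiff_conj {m : WithTop ℕ∞} {a : Cn n → ℂ} (ha : ContDiff ℝ m a) :
    ContDiff ℝ m fun z => conj (a z) :=
  Complex.conjCLE.contDiff.comp ha

theorem hasCompactSupport_conj {a : Cn n → ℂ} (ha : HasCompactSupport a) :
    HasCompactSupport fun z => conj (a z) :=
  ha.comp_left (g := fun x => conj x) (by simp)

theorem contDiff_twistedDel (hΦ : ContDiff ℝ 2 Φ) {a : Cn n → ℂ} (ha : ContDiff ℝ 2 a)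
    (j : Fin n) : ContDiff ℝ 1 fun z => twistedDel Φ a z j := by
  have h1 : ContDiff ℝ 1 fun z => del a z j := ContDiff.del (m := 1) (by norm_num; exact ha) j
  have h2 : ContDiff ℝ 1 fun z => del (fun z => (Φ z : ℂ)) z j :=
    ContDiff.del (m := 1) (by norm_num; exact Complex.ofRealCLM.contDiff.comp hΦ) j
  exact h1.sub (h2.mul (ha.of_le (by norm_num)))

/-- The commutator identity behind the Morrey-Kohn-Hörmander formula. -/
theorem integral_twistedDel_mul_conj (hΦ : ContDiff ℝ 2 Φ) {a b : Cn n → ℂ}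
    (ha : ContDiff ℝ 2 a) (hb : ContDiff ℝ 2 b) (hbc : HasCompactSupport b) (j k : Fin n) :
    ∫ z, twistedDel Φ a z j * conj (twistedDel Φ b z k) * Real.exp (-Φ z) =
      (∫ z, dbar a z k * conj (dbar b z j) * Real.exp (-Φ z)) +
        ∫ z, complexHessian Φ z j k * (a z * conj (b z)) * Real.exp (-Φ z) := by
  have hΦd : Differentiable ℝ Φ := hΦ.differentiable two_ne_zero
  have had : Differentiable ℝ a := ha.differentiable two_ne_zero
  have hbd : Differentiable ℝ b := hb.differentiable two_ne_zero
  have hE := contDiff_weight hΦ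
  have hEd : Differentiable ℝ fun z => (Real.exp (-Φ z) : ℂ) := hE.differentiable two_ne_zero
  have hΦc : ContDiff ℝ 2 fun z => (Φ z : ℂ) := Complex.ofRealCLM.contDiff.comp hΦ
  have hta := contDiff_twistedDel hΦ ha j
  have hdk : ContDiff ℝ 1 fun z => dbar a z k := ContDiff.dbar (m := 1) (by norm_num; exact ha) k
  have hdj : ContDiff ℝ 1 fun z => del a z j := ContDiff.del (m := 1) (by norm_num; exact ha) j
  have hdΦ : ContDiff ℝ 1 fun z => del (fun z => (Φ z : ℂ)) z j :=
    ContDiff.del (m := 1) (by norm_num; exact hΦc) j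
  have hEb : ContDiff ℝ 2 fun z => conj ((Real.exp (-Φ z) : ℂ) * b z) := contDiff_conj (hE.mul hb)
  have hEbc : HasCompactSupport fun z => conj ((Real.exp (-Φ z) : ℂ) * b z) :=
    hasCompactSupport_conj hbc.mul_left
  have e1 : ∫ z, twistedDel Φ a z j * conj (twistedDel Φ b z k) * Real.exp (-Φ z) =
      -∫ z, dbar (fun z => twistedDel Φ a z j) z k * conj ((Real.exp (-Φ z) : ℂ) * b z) := by
    rw [← integral_mul_dbar isOpen_univ hta.contDiffOn (hEb.of_le (by norm_num)) hEbc
      (subset_univ _)]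
    refine integral_congr_ae (Filter.Eventually.of_forall fun z => ?_)
    beta_reduce
    rw [dbar_conj, weight_mul_twistedDel (hΦd z) (hbd z), map_mul, conj_ofReal]
    ring
  have e2 : ∫ z, dbar a z k * conj (dbar b z j) * Real.exp (-Φ z) =
      -∫ z, (Real.exp (-Φ z) : ℂ) * twistedDel Φ (fun z => dbar a z k) z j * conj (b z) := by
    have := integral_mul_del isOpen_univ (((hE.of_le (by norm_num)).mul hdk).contDiffOn
      (s := univ)) ((contDiff_conj hb).of_le (by norm_num)) (hasCompactSupport_conj hbc)
      (subset_univ _) j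
    simp only [weight_mul_twistedDel (hΦd _) (hdk.differentiable one_ne_zero _), del_conj] at this
    rw [← this]
    refine integral_congr_ae (Filter.Eventually.of_forall fun z => ?_)
    ring
  rw [e1, e2, ← sub_eq_iff_eq_add', neg_sub_neg, ← integral_sub]
  · refine integral_congr_ae (Filter.Eventually.of_forall fun z => ?_)
    have h1 : dbar (fun z => twistedDel Φ a z j) z k = dbar (fun z => del a z j) z k -
        (complexHessian Φ z j k * a z + del (fun z => (Φ z : ℂ)) z j * dbar a z k) := by
      have hx := hdΦ.differentiable one_ne_zero z
      unfold twistedDel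
      rw [dbar_sub (hdj.differentiable one_ne_zero z) (hx.fun_mul (had z)),
        dbar_mul hx (had z)]
      rfl
    beta_reduce
    rw [h1, dbar_del_comm ha.contDiffAt, map_mul, conj_ofReal, twistedDel]
    ring
  · refine Continuous.integrable_of_hasCompactSupport ?_ ?_
    · exact ((contDiff_weight hΦ).continuous.mul (by
        exact (ContDiff.del (m := 0) hdk j).continuous.sub
          (hdΦ.continuous.mul hdk.continuous))).mul (contDiff_conj hb).continuous
    · exact (hasCompactSupport_conj hbc).mul_left
  · refine Continuous.integrable_of_hasCompactSupport ?_ ?_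
    · exact (ContDiff.dbar (m := 0) hta k).continuous.mul hEb.continuous
    · exact hEbc.mul_left

theorem integral_finset_sum₂ {α ι κ : Type*} [MeasurableSpace α] {μ : Measure α} [Fintype ι]
    [Fintype κ] {f : ι → κ → α → ℂ} (h : ∀ i j, Integrable (f i j) μ) :
    ∫ a, ∑ i, ∑ j, f i j a ∂μ = ∑ i, ∑ j, ∫ a, f i j a ∂μ := by
  rw [integral_finsetSum _ fun i _ => integrable_finsetSum _ fun j _ => h i j]
  exact Finset.sum_congr rfl fun i _ => integral_finsetSum _ fun j _ => h i j

/-- Morrey-Kohn-Hörmander inequality for compactly supported `(0,1)`-forms. -/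
theorem integral_levi_le (hΦ : ContDiff ℝ 2 Φ) {β : Cn n → Fin n → ℂ}
    (hβ : ∀ j, ContDiff ℝ 2 fun z => β z j) (hc : ∀ j, HasCompactSupport fun z => β z j) :
    ∫ z, LeviForm Φ z (WithLp.toLp 2 (β z)) * Real.exp (-Φ z) ≤
      (∫ z, ‖∑ j, twistedDel Φ (fun z => β z j) z j‖ ^ 2 * Real.exp (-Φ z)) +
      (1 / 2) * ∑ j, ∑ k, ∫ z, ‖dbar (fun z => β z j) z k - dbar (fun z => β z k) z j‖ ^ 2 *
        Real.exp (-Φ z) := by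
  have hE := (contDiff_weight hΦ).continuous
  have hΦc : ContDiff ℝ 2 fun z => (Φ z : ℂ) := Complex.ofRealCLM.contDiff.comp hΦ
  have hdk : ∀ j k, Continuous fun z => dbar (fun z => β z j) z k := fun j k =>
    (ContDiff.dbar (m := 1) (by norm_num; exact hβ j) k).continuous
  have hdc : ∀ j k, HasCompactSupport fun z => dbar (fun z => β z j) z k := fun j k =>
    (hc j).of_isClosed_subset (isClosed_tsupport _) (tsupport_dbar_subset _ _)
  have htk : ∀ j k, Continuous fun z => twistedDel Φ (fun z => β z j) z k := fun j k =>
    (contDiff_twistedDel hΦ (hβ j) k).continuous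
  have htc : ∀ j k, HasCompactSupport fun z => twistedDel Φ (fun z => β z j) z k := fun j k =>
    (hc j).mono' fun z hz => by
      by_contra h
      apply hz
      change twistedDel _ _ _ _ = 0
      rw [twistedDel, image_eq_zero_of_notMem_tsupport h,
        image_eq_zero_of_notMem_tsupport fun h' => h (tsupport_del_subset _ k h')]
      simp
  have hHk : ∀ j k, Continuous fun z => complexHessian Φ z j k := fun j k =>
    (ContDiff.dbar (m := 0) (ContDiff.del (m := 1) (by norm_num; exact hΦc) j) k).continuous
  have iT : ∀ j k, Integrable fun z => twistedDel Φ (fun z => β z j) z j *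
      conj (twistedDel Φ (fun z => β z k) z k) * Real.exp (-Φ z) := fun j k =>
    Continuous.integrable_of_hasCompactSupport
      (((htk j j).mul (continuous_conj.comp (htk k k))).mul hE) ((htc j j).mul_right.mul_right)
  have iD : ∀ j k l m, Integrable fun z => dbar (fun z => β z j) z k *
      conj (dbar (fun z => β z l) z m) * Real.exp (-Φ z) := fun j k l m =>
    Continuous.integrable_of_hasCompactSupport
      (((hdk j k).mul (continuous_conj.comp (hdk l m))).mul hE) ((hdc j k).mul_right.mul_right)
  have iS : ∀ j k l m p q, Integrable fun z => dbar (fun z => β z j) z k *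
      conj (dbar (fun z => β z l) z m) * Real.exp (-Φ z) - dbar (fun z => β z j) z k *
      conj (dbar (fun z => β z p) z q) * Real.exp (-Φ z) := fun j k l m p q =>
    (iD j k l m).sub (iD j k p q)
  have iH : ∀ j k, Integrable fun z => complexHessian Φ z j k * (β z j * conj (β z k)) *
      Real.exp (-Φ z) := fun j k =>
    Continuous.integrable_of_hasCompactSupport
      (((hHk j k).mul ((hβ j).continuous.mul (continuous_conj.comp (hβ k).continuous))).mul hE)
      (((hc j).mul_right).mul_left.mul_right)
  have key := fun j k => integral_twistedDel_mul_conj hΦ (hβ j) (hβ k) (hc k) j k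
  have h1 : ((∫ z, ‖∑ j, twistedDel Φ (fun z => β z j) z j‖ ^ 2 * Real.exp (-Φ z) : ℝ) : ℂ) =
      ∑ j, ∑ k, ∫ z, twistedDel Φ (fun z => β z j) z j *
        conj (twistedDel Φ (fun z => β z k) z k) * Real.exp (-Φ z) := by
    rw [← integral_complex_ofReal, ← integral_finset_sum₂ iT]
    refine integral_congr_ae (Filter.Eventually.of_forall fun z => ?_)
    push_cast
    rw [← Complex.mul_conj', map_sum, Finset.sum_mul_sum]
    simp only [Finset.sum_mul]
  have h2 : ((∫ z, LeviForm Φ z (WithLp.toLp 2 (β z)) * Real.exp (-Φ z) : ℝ) : ℂ) =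
      ∑ j, ∑ k, ∫ z, complexHessian Φ z j k * (β z j * conj (β z k)) * Real.exp (-Φ z) := by
    rw [← integral_complex_ofReal, ← integral_finset_sum₂ iH]
    refine integral_congr_ae (Filter.Eventually.of_forall fun z => ?_)
    push_cast
    rw [← levi_eq_sum hΦ.contDiffAt]
    simp only [Finset.sum_mul]
  have h3 : ∀ j k, ((∫ z, ‖dbar (fun z => β z j) z k - dbar (fun z => β z k) z j‖ ^ 2 *
        Real.exp (-Φ z) : ℝ) : ℂ) =
      (∫ z, dbar (fun z => β z j) z k * conj (dbar (fun z => β z j) z k) * Real.exp (-Φ z)) -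
      (∫ z, dbar (fun z => β z j) z k * conj (dbar (fun z => β z k) z j) * Real.exp (-Φ z)) -
      ((∫ z, dbar (fun z => β z k) z j * conj (dbar (fun z => β z j) z k) * Real.exp (-Φ z)) -
      (∫ z, dbar (fun z => β z k) z j * conj (dbar (fun z => β z k) z j) * Real.exp (-Φ z))) := by
    intro j k
    rw [← integral_complex_ofReal, ← integral_sub (iD _ _ _ _) (iD _ _ _ _),
      ← integral_sub (iD _ _ _ _) (iD _ _ _ _), ← integral_sub
        (iS _ _ _ _ _ _) (iS _ _ _ _ _ _)]
    refine integral_congr_ae (Filter.Eventually.of_forall fun z => ?_)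
    push_cast
    rw [← Complex.mul_conj', map_sub]
    ring
  have h4 : ∀ j k, ((∫ z, ‖dbar (fun z => β z j) z k‖ ^ 2 * Real.exp (-Φ z) : ℝ) : ℂ) =
      ∫ z, dbar (fun z => β z j) z k * conj (dbar (fun z => β z j) z k) * Real.exp (-Φ z) := by
    intro j k
    rw [← integral_complex_ofReal]
    refine integral_congr_ae (Filter.Eventually.of_forall fun z => ?_)
    push_cast
    rw [← Complex.mul_conj']
  have h5 : 0 ≤ ∑ j, ∑ k, ∫ z, ‖dbar (fun z => β z j) z k‖ ^ 2 * Real.exp (-Φ z) :=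
    Finset.sum_nonneg fun j _ => Finset.sum_nonneg fun k _ =>
      integral_nonneg fun z => by positivity
  suffices h : (∫ z, LeviForm Φ z (WithLp.toLp 2 (β z)) * Real.exp (-Φ z)) +
      ∑ j, ∑ k, ∫ z, ‖dbar (fun z => β z j) z k‖ ^ 2 * Real.exp (-Φ z) =
      (∫ z, ‖∑ j, twistedDel Φ (fun z => β z j) z j‖ ^ 2 * Real.exp (-Φ z)) +
      (1 / 2) * ∑ j, ∑ k, ∫ z, ‖dbar (fun z => β z j) z k - dbar (fun z => β z k) z j‖ ^ 2 *
        Real.exp (-Φ z) by linarith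
  rw [← Complex.ofReal_inj]
  push_cast [-Complex.ofReal_exp]
  simp only [h1, h2, h3, h4, key, Finset.sum_add_distrib, Finset.sum_sub_distrib]
  rw [Finset.sum_comm (f := fun j k => ∫ z, dbar (fun z => β z k) z j *
    conj (dbar (fun z => β z k) z j) * Real.exp (-Φ z)), Finset.sum_comm (f := fun j k =>
    ∫ z, dbar (fun z => β z k) z j * conj (dbar (fun z => β z j) z k) * Real.exp (-Φ z))]
  ring

end MorreyKohnHormander

section Mollifier

/-- A smooth radial bump supported in the ball of radius `s`. -/
def radialBump (s : ℝ) (w : Cn n) : ℝ := Real.smoothTransition (1 - ‖w‖ ^ 2 / s ^ 2)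

theorem radialBump_nonneg (s : ℝ) (w : Cn n) : 0 ≤ radialBump s w :=
  Real.smoothTransition.nonneg _

theorem contDiff_radialBump {m : ℕ∞} (s : ℝ) : ContDiff ℝ m (radialBump (n := n) s) :=
  Real.smoothTransition.contDiff.comp
    (contDiff_const.sub ((contDiff_norm_sq ℝ).div_const _))

theorem norm_lt_of_radialBump_ne_zero {s : ℝ} (hs : 0 < s) {w : Cn n} (h : radialBump s w ≠ 0) :
    ‖w‖ < s := by
  by_contra! h2
  apply h
  refine Real.smoothTransition.zero_of_nonpos ?_
  rw [sub_nonpos, one_le_div (by positivity)]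
  gcongr

theorem hasCompactSupport_radialBump {s : ℝ} (hs : 0 < s) :
    HasCompactSupport (radialBump (n := n) s) :=
  HasCompactSupport.intro (isCompact_closedBall 0 s) fun w hw => by
    by_contra h
    exact hw (by simpa using (norm_lt_of_radialBump_ne_zero hs h).le)

theorem integrable_radialBump {s : ℝ} (hs : 0 < s) : Integrable (radialBump (n := n) s) :=
  (contDiff_radialBump (m := 0) s).continuous.integrable_of_hasCompactSupport
    (hasCompactSupport_radialBump hs)

theorem integral_radialBump_pos {s : ℝ} (hs : 0 < s) : 0 < ∫ w : Cn n, radialBump s w := by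
  refine (contDiff_radialBump (m := 0) s).continuous.integral_pos_of_hasCompactSupport_nonneg_nonzero
    (hasCompactSupport_radialBump hs) (radialBump_nonneg s) (x := 0) ?_
  simp [radialBump]

/-- The normalised radial mollifier at scale `s`. -/
def moll (s : ℝ) (w : Cn n) : ℝ := (∫ y : Cn n, radialBump s y)⁻¹ * radialBump s w

theorem moll_nonneg (s : ℝ) (w : Cn n) : 0 ≤ moll s w :=
  mul_nonneg (inv_nonneg.2 (integral_nonneg (radialBump_nonneg s))) (radialBump_nonneg s w)

theorem contDiff_moll {m : ℕ∞} (s : ℝ) : ContDiff ℝ m (moll (n := n) s) :=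
  contDiff_const.mul (contDiff_radialBump s)

theorem contDiff_moll_complex {m : ℕ∞} (s : ℝ) : ContDiff ℝ m fun w : Cn n => (moll s w : ℂ) :=
  Complex.ofRealCLM.contDiff.comp (contDiff_moll s)

theorem norm_le_of_moll_ne_zero {s : ℝ} (hs : 0 < s) {w : Cn n} (h : moll s w ≠ 0) : ‖w‖ ≤ s :=
  (norm_lt_of_radialBump_ne_zero hs (right_ne_zero_of_mul h)).le

theorem hasCompactSupport_moll {s : ℝ} (hs : 0 < s) : HasCompactSupport (moll (n := n) s) :=
  (hasCompactSupport_radialBump hs).mul_left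

theorem hasCompactSupport_moll_complex {s : ℝ} (hs : 0 < s) :
    HasCompactSupport fun w : Cn n => (moll s w : ℂ) :=
  (hasCompactSupport_moll hs).comp_left (g := fun x : ℝ => (x : ℂ)) (by simp)

theorem integrable_moll {s : ℝ} (hs : 0 < s) : Integrable (moll (n := n) s) :=
  (integrable_radialBump hs).const_mul _

theorem integral_moll {s : ℝ} (hs : 0 < s) : ∫ w : Cn n, moll s w = 1 := by
  simp only [moll, integral_const_mul]
  exact inv_mul_cancel₀ (integral_radialBump_pos hs).ne'

theorem moll_smul (s : ℝ) (c : ℂ) (hc : ‖c‖ = 1) (w : Cn n) : moll s (c • w) = moll s w := by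
  simp [moll, radialBump, norm_smul, hc]

theorem moll_neg (s : ℝ) (w : Cn n) : moll s (-w) = moll s w := by
  simp [moll, radialBump]

/-- The mollification of `f` at scale `s`. -/
def mollify (s : ℝ) (f : Cn n → ℂ) (x : Cn n) : ℂ := ∫ t, f t * (moll s (x - t) : ℂ)

theorem mollify_eq_translate (s : ℝ) (f : Cn n → ℂ) (x : Cn n) :
    mollify s f x = ∫ w, (moll s w : ℂ) * f (x + w) := by
  rw [mollify, ← integral_add_left_eq_self _ x]
  refine integral_congr_ae (Filter.Eventually.of_forall fun w => ?_)
  simp [moll_neg, mul_comm]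

theorem mollify_congr {s : ℝ} {f g : Cn n → ℂ} (h : f =ᵐ[volume] g) :
    mollify s f = mollify s g := by
  ext x
  refine integral_congr_ae ?_
  filter_upwards [h] with t ht
  rw [ht]

theorem contDiff_mollify {m : ℕ∞} {s : ℝ} (hs : 0 < s) {f : Cn n → ℂ}
    (hf : LocallyIntegrable f) : ContDiff ℝ m (mollify s f) :=
  (hasCompactSupport_moll_complex hs).contDiff_convolution_right (ContinuousLinearMap.mul ℝ ℂ) hf
    (contDiff_moll_complex s)

theorem fderiv_mollify {s : ℝ} (hs : 0 < s) {f : Cn n → ℂ}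
    (hf : LocallyIntegrable f) (x w : Cn n) : fderiv ℝ (mollify s f) x w =
      -∫ t, f t * fderiv ℝ (fun t => (moll s (x - t) : ℂ)) t w := by
  have h := (hasCompactSupport_moll_complex hs).hasFDerivAt_convolution_right
    (ContinuousLinearMap.mul ℝ ℂ) hf (contDiff_moll_complex (m := 1) s) x
  have h1 : fderiv ℝ (mollify s f) x = _ := h.fderiv
  rw [h1, convolution_precompR_apply _ hf ((hasCompactSupport_moll_complex hs).fderiv ℝ)
    ((contDiff_moll_complex (m := 1) s).continuous_fderiv one_ne_zero), ← integral_neg]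
  refine integral_congr_ae (Filter.Eventually.of_forall fun t => ?_)
  have h2 : fderiv ℝ (fun t => (moll s (x - t) : ℂ)) t =
      -fderiv ℝ (fun w : Cn n => (moll s w : ℂ)) (x - t) := by
    have h3 := ((contDiff_moll_complex (n := n) (m := 1) s).differentiable one_ne_zero
      (x - t)).hasFDerivAt.comp t ((hasFDerivAt_id t).const_sub x)
    have := h3.fderiv
    rw [ContinuousLinearMap.comp_neg, ContinuousLinearMap.comp_id] at this
    exact this
  simp [h2]

theorem integrable_mul_fderiv_moll {s : ℝ} (hs : 0 < s) {f : Cn n → ℂ}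
    (hf : LocallyIntegrable f) (x w : Cn n) :
    Integrable fun t => f t * fderiv ℝ (fun t => (moll s (x - t) : ℂ)) t w := by
  have h1 : ContDiff ℝ 1 fun t : Cn n => (moll s (x - t) : ℂ) :=
    (contDiff_moll_complex (m := 1) s).comp (contDiff_const.sub contDiff_id)
  have h2 : HasCompactSupport fun t : Cn n => (moll s (x - t) : ℂ) :=
    (hasCompactSupport_moll_complex hs).comp_homeomorph (Homeomorph.subLeft x)
  have h3 : HasCompactSupport fun t => fderiv ℝ (fun t => (moll s (x - t) : ℂ)) t w :=
    (h2.fderiv (𝕜 := ℝ)).comp_left (g := fun L : Cn n →L[ℝ] ℂ => L w) (by simp)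
  have h4 := hf.integrable_smul_right_of_hasCompactSupport
    ((h1.continuous_fderiv one_ne_zero).clm_apply (continuous_const (y := w))) h3
  exact h4

theorem dbar_mollify {s : ℝ} (hs : 0 < s) {f : Cn n → ℂ}
    (hf : LocallyIntegrable f) (x : Cn n) (j : Fin n) : dbar (mollify s f) x j =
      -∫ t, f t * dbar (fun t => (moll s (x - t) : ℂ)) t j := by
  have e1 := integrable_mul_fderiv_moll hs hf x (e n j)
  have e2 := integrable_mul_fderiv_moll hs hf x (I • e n j)
  have : ∀ t, f t * dbar (fun t => (moll s (x - t) : ℂ)) t j =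
      (1 / 2) * (f t * fderiv ℝ (fun t => (moll s (x - t) : ℂ)) t (e n j) +
        I * (f t * fderiv ℝ (fun t => (moll s (x - t) : ℂ)) t (I • e n j))) := fun t => by
    rw [dbar]; ring
  simp only [this]
  rw [integral_const_mul, integral_add e1 (e2.const_mul I), integral_const_mul, dbar,
    fderiv_mollify hs hf, fderiv_mollify hs hf]
  ring

theorem del_mollify {s : ℝ} (hs : 0 < s) {f : Cn n → ℂ}
    (hf : LocallyIntegrable f) (x : Cn n) (j : Fin n) : del (mollify s f) x j =
      -∫ t, f t * del (fun t => (moll s (x - t) : ℂ)) t j := by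
  have e1 := integrable_mul_fderiv_moll hs hf x (e n j)
  have e2 := integrable_mul_fderiv_moll hs hf x (I • e n j)
  have : ∀ t, f t * del (fun t => (moll s (x - t) : ℂ)) t j =
      (1 / 2) * (f t * fderiv ℝ (fun t => (moll s (x - t) : ℂ)) t (e n j) -
        I * (f t * fderiv ℝ (fun t => (moll s (x - t) : ℂ)) t (I • e n j))) := fun t => by
    rw [del]; ring
  simp only [this]
  rw [integral_const_mul, integral_sub e1 (e2.const_mul I), integral_const_mul, del,
    fderiv_mollify hs hf, fderiv_mollify hs hf]
  ring

theorem hasCompactSupport_mollify {s : ℝ} (hs : 0 < s) {f : Cn n → ℂ} {L : Set (Cn n)}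
    (hL : IsCompact L) (hf : ∀ z ∉ L, f z = 0) : HasCompactSupport (mollify s f) := by
  refine HasCompactSupport.intro (hL.add (isCompact_closedBall 0 s)) fun x hx => ?_
  rw [mollify]
  convert integral_zero (Cn n) ℂ with t
  by_cases ht : t ∈ L
  · have : moll s (x - t) = 0 := by
      by_contra h
      exact hx ⟨t, ht, x - t, by simpa using norm_le_of_moll_ne_zero hs h, by simp⟩
    simp [this]
  · simp [hf t ht]

end Mollifier

section MollifierConvergence

theorem eLpNorm_two_sq {α E : Type*} [MeasurableSpace α] [NormedAddCommGroup E] (f : α → E)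
    (μ : Measure α) : eLpNorm f 2 μ ^ 2 = ∫⁻ x, ‖f x‖ₑ ^ 2 ∂μ := by
  have h := eLpNorm_nnreal_pow_eq_lintegral (f := f) (μ := μ) (p := 2) two_ne_zero
  simpa using h

theorem tendsto_eLpNorm_translate_sub {f : Cn n → ℂ} (hf : MemLp f 2 volume) :
    Filter.Tendsto (fun w : Cn n => eLpNorm (fun x => f (x + w) - f x) 2 volume) (nhds 0)
      (nhds 0) := by
  let g : Cn n → C(Cn n, Cn n) := fun w => ⟨fun x => x + w, by fun_prop⟩
  have hg : Continuous g := ContinuousMap.continuous_of_continuous_uncurry _ (by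
    show Continuous fun p : Cn n × Cn n => p.2 + p.1
    fun_prop)
  have hm : ∀ w, MeasurePreserving (g w) volume volume := fun w =>
    measurePreserving_add_right volume w
  have h := (tendsto_const_nhds (x := hf.toLp f) (f := nhds (0 : Cn n))).compMeasurePreservingLp
    hg.continuousAt hm (hm 0) (by simp)
  simp only [Lp.toLp_compMeasurePreserving] at h
  have h2 := (Lp.tendsto_Lp_iff_tendsto_eLpNorm'' _ _ _ _).1 h
  convert h2 using 3 with w
  ext x
  simp [g]

theorem lintegral_moll {s : ℝ} (hs : 0 < s) : ∫⁻ w : Cn n, ENNReal.ofReal (moll s w) = 1 := by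
  rw [← ofReal_integral_eq_lintegral_ofReal (integrable_moll hs)
    (Filter.Eventually.of_forall (moll_nonneg s)), integral_moll hs, ENNReal.ofReal_one]

/-- The normalised mollifier, as a probability measure. -/
def mollMeasure (n : ℕ) (s : ℝ) : Measure (Cn n) :=
  volume.withDensity fun w => ENNReal.ofReal (moll s w)

theorem measurable_ofReal_moll (s : ℝ) : Measurable fun w : Cn n => ENNReal.ofReal (moll s w) :=
  (contDiff_moll (m := 0) s).continuous.measurable.ennreal_ofReal

theorem isProbabilityMeasure_mollMeasure {s : ℝ} (hs : 0 < s) :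
    IsProbabilityMeasure (mollMeasure n s) :=
  ⟨by rw [mollMeasure, withDensity_apply _ MeasurableSet.univ, Measure.restrict_univ,
    lintegral_moll hs]⟩

theorem enorm_mollify_sub_le {s : ℝ} (hs : 0 < s) {f : Cn n → ℂ} (hf : StronglyMeasurable f)
    (hfl : LocallyIntegrable f) (x : Cn n) :
    ‖mollify s f x - f x‖ₑ ^ 2 ≤ ∫⁻ w, ‖f (x + w) - f x‖ₑ ^ 2 ∂(mollMeasure n s) := by
  have := isProbabilityMeasure_mollMeasure (n := n) hs
  have hm : StronglyMeasurable fun w => f (x + w) - f x :=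
    (hf.comp_measurable (measurable_const_add x)).sub stronglyMeasurable_const
  have hfl' : LocallyIntegrable fun w => f (x + w) := by
    intro y
    obtain ⟨u, hu, hi⟩ := hfl (x + y)
    refine ⟨(fun w => x + w) ⁻¹' u, (continuous_const.add continuous_id).continuousAt hu, ?_⟩
    exact ((measurePreserving_add_left volume x).integrableOn_comp_preimage
      (Homeomorph.addLeft x).measurableEmbedding).2 hi
  have h1 : mollify s f x - f x = ∫ w, (moll s w : ℂ) * (f (x + w) - f x) := by
    have i1 : Integrable fun w => (moll s w : ℂ) * f (x + w) := by
      have := hfl'.integrable_smul_left_of_hasCompactSupport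
        (contDiff_moll_complex (m := 0) s).continuous (hasCompactSupport_moll_complex hs)
      exact this
    have i2 : Integrable fun w : Cn n => (moll s w : ℂ) * f x := (integrable_moll hs).ofReal.mul_const _
    simp only [mul_sub]
    rw [integral_sub i1 i2, mollify_eq_translate, integral_mul_const, integral_complex_ofReal,
      integral_moll hs]
    simp
  have h2 : ‖mollify s f x - f x‖ₑ ≤ ∫⁻ w, ‖f (x + w) - f x‖ₑ ∂(mollMeasure n s) := by
    rw [h1]
    refine (enorm_integral_le_lintegral_enorm _).trans_eq ?_
    rw [mollMeasure, lintegral_withDensity_eq_lintegral_mul _ (measurable_ofReal_moll s)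
      hm.enorm]
    refine lintegral_congr fun w => ?_
    rw [enorm_mul, Pi.mul_apply]
    congr 1
    rw [← ofReal_norm, Complex.norm_real, Real.norm_of_nonneg (moll_nonneg s w)]
  have h3 := eLpNorm_le_eLpNorm_of_exponent_le (p := 1) (q := 2) (μ := mollMeasure n s) (by norm_num)
    hm.aestronglyMeasurable
  rw [eLpNorm_one_eq_lintegral_enorm] at h3
  rw [← eLpNorm_two_sq]
  gcongr
  exact h2.trans h3

theorem locallyIntegrable_of_memLp_two {f : Cn n → ℂ} (hf : MemLp f 2 volume) :
    LocallyIntegrable f := hf.locallyIntegrable (by norm_num)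

theorem tendsto_eLpNorm_mollify_sub {f : Cn n → ℂ} (hf : MemLp f 2 volume) {s : ℕ → ℝ}
    (hs : ∀ m, 0 < s m) (hs0 : Filter.Tendsto s Filter.atTop (nhds 0)) :
    Filter.Tendsto (fun m => eLpNorm (fun x => mollify (s m) f x - f x) 2 volume) Filter.atTop
      (nhds 0) := by
  wlog hfm : StronglyMeasurable f generalizing f
  · have hg := this (hf.ae_eq hf.1.ae_eq_mk) hf.1.stronglyMeasurable_mk
    refine hg.congr fun m => ?_
    rw [mollify_congr hf.1.ae_eq_mk]
    refine eLpNorm_congr_ae ?_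
    filter_upwards [hf.1.ae_eq_mk] with x hx
    rw [hx]
  rw [ENNReal.tendsto_nhds_zero]
  intro ε hε
  have h1 := ENNReal.tendsto_nhds_zero.1 (tendsto_eLpNorm_translate_sub hf) ε hε
  obtain ⟨r, hr, hball⟩ := Metric.eventually_nhds_iff.1 h1
  filter_upwards [hs0.eventually (gt_mem_nhds hr)] with m hm
  have := isProbabilityMeasure_mollMeasure (n := n) (hs m)
  have key : eLpNorm (fun x => mollify (s m) f x - f x) 2 volume ^ 2 ≤ ε ^ 2 := by
    rw [eLpNorm_two_sq]
    calc ∫⁻ x, ‖mollify (s m) f x - f x‖ₑ ^ 2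
        ≤ ∫⁻ x, ∫⁻ w, ‖f (x + w) - f x‖ₑ ^ 2 ∂(mollMeasure n (s m)) :=
          lintegral_mono fun x => enorm_mollify_sub_le (hs m) hfm
            (locallyIntegrable_of_memLp_two hf) x
      _ = ∫⁻ w, ∫⁻ x, ‖f (x + w) - f x‖ₑ ^ 2 ∂volume ∂(mollMeasure n (s m)) := by
          refine lintegral_lintegral_swap ?_
          refine (Measurable.pow_const ?_ 2).aemeasurable
          exact ((hfm.comp_measurable (measurable_fst.add measurable_snd)).sub
            (hfm.comp_measurable measurable_fst)).enorm
      _ ≤ ∫⁻ w, ε ^ 2 ∂(mollMeasure n (s m)) := by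
          refine lintegral_mono_ae ?_
          have : ∀ᵐ w ∂(mollMeasure n (s m)), ‖w‖ ≤ s m := by
            rw [mollMeasure, ae_withDensity_iff (measurable_ofReal_moll _)]
            refine Filter.Eventually.of_forall fun w hw => norm_le_of_moll_ne_zero (hs m) ?_
            intro h; simp [h] at hw
          filter_upwards [this] with w hw
          rw [← eLpNorm_two_sq]
          gcongr
          exact hball (by simpa using hw.trans_lt hm)
      _ = ε ^ 2 := by simp
  exact (ENNReal.pow_le_pow_left_iff two_ne_zero).1 key

/-- Convergence in `L²(ℂⁿ)` of a sequence of representatives. -/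
structure L2Tendsto (F : ℕ → Cn n → ℂ) (f : Cn n → ℂ) : Prop where
  mem : ∀ m, MemLp (F m) 2 volume
  memLim : MemLp f 2 volume
  lim : Filter.Tendsto (fun m => eLpNorm (F m - f) 2 volume) Filter.atTop (nhds 0)

theorem L2Tendsto.sub {F G : ℕ → Cn n → ℂ} {f g : Cn n → ℂ} (hF : L2Tendsto F f)
    (hG : L2Tendsto G g) : L2Tendsto (fun m z => F m z - G m z) fun z => f z - g z := by
  refine ⟨fun m => (hF.mem m).sub (hG.mem m), hF.memLim.sub hG.memLim, ?_⟩
  have h := hF.lim.add hG.lim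
  rw [add_zero] at h
  refine tendsto_of_tendsto_of_tendsto_of_le_of_le tendsto_const_nhds h (fun _ => zero_le)
    fun m => ?_
  have : (fun z => F m z - G m z) - (fun z => f z - g z) = (F m - f) - (G m - g) := by
    ext z; simp only [Pi.sub_apply]; ring
  beta_reduce
  rw [this]
  exact eLpNorm_sub_le ((hF.mem m).sub hF.memLim).1 ((hG.mem m).sub hG.memLim).1 (by norm_num)

theorem L2Tendsto.mul_bdd {F : ℕ → Cn n → ℂ} {f : Cn n → ℂ} (hF : L2Tendsto F f) {b : Cn n → ℂ}
    (hb : AEStronglyMeasurable b volume) {c : ℝ} (hc : ∀ z, ‖b z‖ ≤ c) :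
    L2Tendsto (fun m z => b z * F m z) fun z => b z * f z := by
  have hbL : MemLp b ⊤ volume := memLp_top_of_bound hb c (Filter.Eventually.of_forall hc)
  refine ⟨fun m => (hF.mem m).mul hbL, hF.memLim.mul hbL, ?_⟩
  have h := ENNReal.Tendsto.const_mul (a := ENNReal.ofReal c) hF.lim (Or.inr ENNReal.ofReal_ne_top)
  rw [mul_zero] at h
  refine tendsto_of_tendsto_of_tendsto_of_le_of_le tendsto_const_nhds h (fun _ => zero_le)
    fun m => ?_
  refine eLpNorm_le_mul_eLpNorm_of_ae_le_mul (Filter.Eventually.of_forall fun z => ?_) 2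
  have : b z * F m z - b z * f z = b z * (F m z - f z) := by ring
  simp only [Pi.sub_apply, this, norm_mul]
  gcongr
  exact hc z

theorem L2Tendsto.integral_mul_conj {F G : ℕ → Cn n → ℂ} {f g : Cn n → ℂ} (hF : L2Tendsto F f)
    (hG : L2Tendsto G g) : Filter.Tendsto (fun m => ∫ z, F m z * conj (G m z)) Filter.atTop
      (nhds (∫ z, f z * conj (g z))) := by
  have h1 := (Lp.tendsto_Lp_iff_tendsto_eLpNorm'' F hF.mem f hF.memLim).2 hF.lim
  have h2 := (Lp.tendsto_Lp_iff_tendsto_eLpNorm'' G hG.mem g hG.memLim).2 hG.lim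
  have h := h2.inner (𝕜 := ℂ) h1
  have key : ∀ {u v : Cn n → ℂ} (hu : MemLp u 2 volume) (hv : MemLp v 2 volume),
      inner ℂ (hv.toLp v) (hu.toLp u) = ∫ z, u z * conj (v z) := fun hu hv => by
    rw [L2.inner_def]
    refine integral_congr_ae ?_
    filter_upwards [hu.coeFn_toLp, hv.coeFn_toLp] with z h1 h2
    rw [h1, h2, RCLike.inner_apply]
  simpa only [key] using h

theorem l2Tendsto_mollify {f : Cn n → ℂ} (hf : MemLp f 2 volume) {L : Set (Cn n)}
    (hL : IsCompact L) (hfL : ∀ z ∉ L, f z = 0) {s : ℕ → ℝ}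
    (hs : ∀ m, 0 < s m) (hs0 : Filter.Tendsto s Filter.atTop (nhds 0)) :
    L2Tendsto (fun m => mollify (s m) f) f :=
  ⟨fun m => (contDiff_mollify (m := 0) (hs m)
    (locallyIntegrable_of_memLp_two hf)).continuous.memLp_of_hasCompactSupport
      (hasCompactSupport_mollify (hs m) hL hfL), hf, tendsto_eLpNorm_mollify_sub hf hs hs0⟩

theorem L2Tendsto.sum {ι : Type*} (t : Finset ι) {F : ι → ℕ → Cn n → ℂ} {f : ι → Cn n → ℂ}
    (hF : ∀ i ∈ t, L2Tendsto (F i) (f i)) :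
    L2Tendsto (fun m z => ∑ i ∈ t, F i m z) fun z => ∑ i ∈ t, f i z := by
  refine ⟨fun m => memLp_finsetSum t fun i hi => (hF i hi).mem m,
    memLp_finsetSum t fun i hi => (hF i hi).memLim, ?_⟩
  have h := tendsto_finsetSum t fun i hi => (hF i hi).lim
  rw [Finset.sum_const_zero] at h
  refine tendsto_of_tendsto_of_tendsto_of_le_of_le tendsto_const_nhds h (fun _ => zero_le)
    fun m => ?_
  have : (fun z => ∑ i ∈ t, F i m z) - (fun z => ∑ i ∈ t, f i z) =
      ∑ i ∈ t, (F i m - f i) := by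
    ext z; simp
  beta_reduce
  rw [this]
  exact eLpNorm_sum_le (fun i hi => ((hF i hi).mem m |>.sub (hF i hi).memLim).1) (by norm_num)

end MollifierConvergence

section WeakInequality

theorem continuous_complexHessian {Φ : Cn n → ℝ} (hΦ : ContDiff ℝ 2 Φ) (j k : Fin n) :
    Continuous fun z => complexHessian Φ z j k := by
  have h1 : ContDiff ℝ 2 fun z => (Φ z : ℂ) := Complex.ofRealCLM.contDiff.comp hΦ
  have h2 := ContDiff.del (m := 1) (by norm_num; exact h1) j
  have h3 := ContDiff.dbar (m := 0) (by norm_num; exact h2) k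
  exact h3.continuous

theorem hasCompactSupport_del {v : Cn n → ℂ} (h : HasCompactSupport v) (j : Fin n) :
    HasCompactSupport fun z => del v z j :=
  IsCompact.of_isClosed_subset h (isClosed_tsupport _) (tsupport_del_subset v j)

theorem hasCompactSupport_dbar {v : Cn n → ℂ} (h : HasCompactSupport v) (j : Fin n) :
    HasCompactSupport fun z => dbar v z j :=
  IsCompact.of_isClosed_subset h (isClosed_tsupport _) (tsupport_dbar_subset v j)

theorem hasCompactSupport_ofReal {Φ : Cn n → ℝ} (h : HasCompactSupport Φ) :
    HasCompactSupport fun z => (Φ z : ℂ) :=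
  h.comp_left (g := fun x : ℝ => (x : ℂ)) (by simp)

theorem exists_weight_bound {Φ : Cn n → ℝ} (hΦ : Continuous Φ) (hΦc : HasCompactSupport Φ) :
    ∃ c, ∀ z, ‖(Real.exp (-Φ z) : ℂ)‖ ≤ c := by
  obtain ⟨c, hc⟩ := hΦc.exists_bound_of_continuous hΦ
  refine ⟨Real.exp c, fun z => ?_⟩
  rw [Complex.norm_real, Real.norm_of_nonneg (Real.exp_pos _).le]
  exact Real.exp_le_exp.2 ((neg_le_abs _).trans (hc z))

theorem exists_hessian_weight_bound {Φ : Cn n → ℝ} (hΦ : ContDiff ℝ 2 Φ)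
    (hΦc : HasCompactSupport Φ) (j k : Fin n) :
    ∃ c, ∀ z, ‖complexHessian Φ z j k * (Real.exp (-Φ z) : ℂ)‖ ≤ c := by
  have h1 : HasCompactSupport fun z => complexHessian Φ z j k :=
    hasCompactSupport_dbar (hasCompactSupport_del (hasCompactSupport_ofReal hΦc) j) k
  exact HasCompactSupport.exists_bound_of_continuous (h1.mul_right)
    ((continuous_complexHessian hΦ j k).mul (contDiff_weight hΦ).continuous)

section LeviIntegral

variable {Φ : Cn n → ℝ} (hΦ : ContDiff ℝ 2 Φ) (hΦc : HasCompactSupport Φ)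
  {β : Cn n → Fin n → ℂ} (hβ : ∀ j, MemLp (fun z => β z j) 2 volume)

include hΦ hΦc hβ

theorem integrable_hessian_mul (j k : Fin n) : Integrable fun z =>
    (complexHessian Φ z j k * (Real.exp (-Φ z) : ℂ)) * β z j * conj (β z k) := by
  obtain ⟨c, hc⟩ := exists_hessian_weight_bound hΦ hΦc j k
  have h1 : Integrable fun z => β z j * conj (β z k) := (hβ j).integrable_mul (hβ k).star
  have h2 := h1.mul_bdd (g := fun z => complexHessian Φ z j k * (Real.exp (-Φ z) : ℂ))
    ((continuous_complexHessian hΦ j k).mul (contDiff_weight hΦ).continuous).aestronglyMeasurable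
    (Filter.Eventually.of_forall hc)
  refine h2.congr (Filter.Eventually.of_forall fun z => ?_)
  beta_reduce
  ring

omit hΦc hβ in
theorem levi_weight_eq_sum (z : Cn n) :
    ((LeviForm Φ z (WithLp.toLp 2 (β z)) * Real.exp (-Φ z) : ℝ) : ℂ) =
      ∑ j, ∑ k, (complexHessian Φ z j k * (Real.exp (-Φ z) : ℂ)) * β z j * conj (β z k) := by
  rw [Complex.ofReal_mul, ← levi_eq_sum hΦ.contDiffAt, Finset.sum_mul]
  refine Finset.sum_congr rfl fun j _ => ?_
  rw [Finset.sum_mul]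
  refine Finset.sum_congr rfl fun k _ => ?_
  ring

theorem integrable_levi :
    Integrable fun z => LeviForm Φ z (WithLp.toLp 2 (β z)) * Real.exp (-Φ z) := by
  have h := (integrable_finsetSum Finset.univ fun j _ => integrable_finsetSum Finset.univ
    fun k _ => integrable_hessian_mul hΦ hΦc hβ j k).re
  refine h.congr (Filter.Eventually.of_forall fun z => ?_)
  beta_reduce
  rw [← levi_weight_eq_sum hΦ]
  exact Complex.ofReal_re _

theorem integral_levi_eq :
    ((∫ z, LeviForm Φ z (WithLp.toLp 2 (β z)) * Real.exp (-Φ z) : ℝ) : ℂ) =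
      ∑ j, ∑ k, ∫ z, (complexHessian Φ z j k * (Real.exp (-Φ z) : ℂ)) * β z j * conj (β z k) := by
  rw [← integral_finset_sum₂ (integrable_hessian_mul hΦ hΦc hβ), ← integral_complex_ofReal]
  exact integral_congr_ae (Filter.Eventually.of_forall fun z => levi_weight_eq_sum hΦ z)

end LeviIntegral

theorem integral_norm_sq_weight_eq (Φ : Cn n → ℝ) (f : Cn n → ℂ) :
    ((∫ z, ‖f z‖ ^ 2 * Real.exp (-Φ z) : ℝ) : ℂ) =
      ∫ z, (Real.exp (-Φ z) : ℂ) * f z * conj (f z) := by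
  rw [← integral_complex_ofReal]
  refine integral_congr_ae (Filter.Eventually.of_forall fun z => ?_)
  beta_reduce
  rw [mul_assoc, Complex.mul_conj, Complex.normSq_eq_norm_sq]
  push_cast [-Complex.ofReal_exp]
  ring

/-- The Morrey–Kohn–Hörmander inequality for compactly supported square-integrable forms whose
divergence and `∂̄` are square-integrable in the sense of distributions. -/
theorem integral_levi_le_of_weak {Φ : Cn n → ℝ} (hΦ : ContDiff ℝ 2 Φ) (hΦc : HasCompactSupport Φ)
    {β : Cn n → Fin n → ℂ} {τ : Cn n → ℂ} {κ : Fin n → Fin n → Cn n → ℂ} {L : Set (Cn n)}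
    (hL : IsCompact L) (hβ : ∀ j, MemLp (fun z => β z j) 2 volume)
    (hτ : MemLp τ 2 volume) (hκ : ∀ j k, MemLp (κ j k) 2 volume)
    (hβL : ∀ z ∉ L, ∀ j, β z j = 0) (hτL : ∀ z ∉ L, τ z = 0) (hκL : ∀ j k, ∀ z ∉ L, κ j k z = 0)
    (hdiv : ∀ ψ : Cn n → ℂ, ContDiff ℝ 2 ψ → HasCompactSupport ψ →
      ∑ j, ∫ z, β z j * del ψ z j = -∫ z, τ z * ψ z)
    (hdbar : ∀ ψ : Cn n → ℂ, ContDiff ℝ 2 ψ → HasCompactSupport ψ → ∀ j k,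
      (∫ z, β z j * dbar ψ z k) - ∫ z, β z k * dbar ψ z j = -∫ z, κ j k z * ψ z) :
    ∫ z, LeviForm Φ z (WithLp.toLp 2 (β z)) * Real.exp (-Φ z) ≤
      (∫ z, ‖τ z - ∑ j, del (fun z => (Φ z : ℂ)) z j * β z j‖ ^ 2 * Real.exp (-Φ z)) +
      (1 / 2) * ∑ j, ∑ k, ∫ z, ‖κ j k z‖ ^ 2 * Real.exp (-Φ z) := by
  set s : ℕ → ℝ := fun m => 1 / ((m : ℝ) + 1)
  have hs : ∀ m, 0 < s m := fun m => by positivity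
  have hs0 : Filter.Tendsto s Filter.atTop (nhds 0) := tendsto_one_div_add_atTop_nhds_zero_nat
  have hψ : ∀ m (x : Cn n), ContDiff ℝ 2 (fun t : Cn n => (moll (s m) (x - t) : ℂ)) ∧
      HasCompactSupport fun t : Cn n => (moll (s m) (x - t) : ℂ) := fun m x =>
    ⟨(contDiff_moll_complex (m := 2) (s m)).comp (contDiff_const.sub contDiff_id),
      (hasCompactSupport_moll_complex (hs m)).comp_homeomorph (Homeomorph.subLeft x)⟩
  have hβm : ∀ j, L2Tendsto (fun m => mollify (s m) fun z => β z j) fun z => β z j := fun j =>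
    l2Tendsto_mollify (hβ j) hL (fun z hz => hβL z hz j) hs hs0
  have hτm := l2Tendsto_mollify hτ hL hτL hs hs0
  have hκm := fun j k => l2Tendsto_mollify (hκ j k) hL (hκL j k) hs hs0
  have hloc := fun j => locallyIntegrable_of_memLp_two (hβ j)
  have hsm : ∀ m j, ContDiff ℝ 2 (mollify (s m) fun z => β z j) := fun m j =>
    contDiff_mollify (m := 2) (hs m) (hloc j)
  have hineq := fun m => integral_levi_le hΦ (β := fun z j => mollify (s m) (fun z => β z j) z)
    (hsm m) fun j => hasCompactSupport_mollify (hs m) hL fun z hz => hβL z hz j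
  have e1 : ∀ m z, ∑ j, twistedDel Φ (mollify (s m) fun z => β z j) z j =
      mollify (s m) τ z - ∑ j, del (fun z => (Φ z : ℂ)) z j * mollify (s m) (fun z => β z j) z := by
    intro m z
    simp only [twistedDel, Finset.sum_sub_distrib]
    congr 1
    simp only [del_mollify (hs m) (hloc _), Finset.sum_neg_distrib]
    rw [hdiv _ (hψ m z).1 (hψ m z).2, neg_neg, mollify]
  have e2 : ∀ m z j k, dbar (mollify (s m) fun z => β z j) z k -
      dbar (mollify (s m) fun z => β z k) z j = mollify (s m) (κ j k) z := by
    intro m z j k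
    rw [dbar_mollify (hs m) (hloc j), dbar_mollify (hs m) (hloc k)]
    have := hdbar _ (hψ m z).1 (hψ m z).2 j k
    rw [mollify]
    linear_combination -this
  simp only [e1, e2] at hineq
  obtain ⟨cw, hcw⟩ := exists_weight_bound hΦ.continuous hΦc
  have hwm : AEStronglyMeasurable (fun z => (Real.exp (-Φ z) : ℂ)) volume :=
    (contDiff_weight hΦ).continuous.aestronglyMeasurable
  have hsq : ∀ {F : ℕ → Cn n → ℂ} {f}, L2Tendsto F f → Filter.Tendsto
      (fun m => ∫ z, ‖F m z‖ ^ 2 * Real.exp (-Φ z)) Filter.atTop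
      (nhds (∫ z, ‖f z‖ ^ 2 * Real.exp (-Φ z))) := fun {F f} hF => by
    have h := (hF.mul_bdd hwm hcw).integral_mul_conj hF
    simp only [← integral_norm_sq_weight_eq] at h
    exact_mod_cast (Complex.continuous_re.tendsto _).comp h
  have hdel : ∀ j, L2Tendsto
      (fun m z => del (fun z => (Φ z : ℂ)) z j * mollify (s m) (fun z => β z j) z)
      fun z => del (fun z => (Φ z : ℂ)) z j * β z j := fun j => by
    have hcont : Continuous fun z => del (fun z => (Φ z : ℂ)) z j :=
      (ContDiff.del (m := 1) (by norm_num; exact Complex.ofRealCLM.contDiff.comp hΦ) j).continuous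
    obtain ⟨c, hc⟩ := (hasCompactSupport_del (hasCompactSupport_ofReal hΦc)
      j).exists_bound_of_continuous hcont
    exact (hβm j).mul_bdd hcont.aestronglyMeasurable hc
  have t1 := hsq (hτm.sub (L2Tendsto.sum Finset.univ fun j _ => hdel j))
  have t2 := tendsto_finsetSum Finset.univ fun j _ => tendsto_finsetSum Finset.univ fun k _ =>
    hsq (hκm j k)
  refine le_of_tendsto_of_tendsto' ?_ (t1.add (t2.const_mul (1 / 2))) hineq
  have t3 := tendsto_finsetSum Finset.univ fun j _ => tendsto_finsetSum Finset.univ fun k _ => by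
    obtain ⟨c, hc⟩ := exists_hessian_weight_bound hΦ hΦc j k
    exact ((hβm j).mul_bdd ((continuous_complexHessian hΦ j k).mul
      (contDiff_weight hΦ).continuous).aestronglyMeasurable hc).integral_mul_conj (hβm k)
  simp only [Pi.mul_apply] at t3
  rw [← integral_levi_eq hΦ hΦc hβ] at t3
  have e3 := fun m => integral_levi_eq hΦ hΦc
    (β := fun z j => mollify (s m) (fun z => β z j) z) fun j => (hβm j).mem m
  simp only [← e3] at t3
  exact_mod_cast (Complex.continuous_re.tendsto _).comp t3

end WeakInequality

section ThreeWeights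

/-- Test functions of class `C²` with compact support in `U`. -/
structure TestC2 (U : Set (Cn n)) (ψ : Cn n → ℂ) : Prop where
  contDiff : ContDiff ℝ 2 ψ
  hasCompactSupport : HasCompactSupport ψ
  tsupport_subset : tsupport ψ ⊆ U

/-- A weakly `∂̄`-closed form `γ ∈ L²(U, e^{-p})` with weighted divergence `w`. -/
structure WeakClosedDiv (U : Set (Cn n)) (p : Cn n → ℝ) (γ : Cn n → Fin n → ℂ) (w : Cn n → ℂ) :
    Prop where
  meas : ∀ j, AEStronglyMeasurable (fun z => γ z j) volume
  int : ∀ j, Integrable fun z => ‖γ z j‖ ^ 2 * Real.exp (-p z)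
  zero : ∀ z ∉ U, ∀ j, γ z j = 0
  closed : ∀ ψ, TestC2 U ψ → ∀ j k, ∫ z, γ z j * dbar ψ z k = ∫ z, γ z k * dbar ψ z j
  div : ∀ ψ, TestC2 U ψ → ∑ j, ∫ z, γ z j * (Real.exp (-p z) : ℂ) * del ψ z j = -∫ z, w z * ψ z

variable {U : Set (Cn n)} {p : Cn n → ℝ}

theorem continuousOn_ofReal_exp {q : Cn n → ℝ} (hq : ContinuousOn q U) :
    ContinuousOn (fun z => (Real.exp (q z) : ℂ)) U :=
  Complex.continuous_ofReal.comp_continuousOn (Real.continuous_exp.comp_continuousOn hq)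

theorem ContinuousOn.continuous_mul {u v : Cn n → ℂ} (hU : IsOpen U) (hu : ContinuousOn u U)
    (hv : Continuous v) (hs : tsupport v ⊆ U) : Continuous fun z => u z * v z :=
  contDiff_zero.1 (ContDiffOn.contDiff_mul hU (contDiffOn_zero.2 hu) (contDiff_zero.2 hv) hs)

theorem memLp_mul_of_weighted (hU : IsOpen U) (hp : ContinuousOn p U) {g b : Cn n → ℂ}
    (hg : AEStronglyMeasurable g volume) (hi : Integrable fun z => ‖g z‖ ^ 2 * Real.exp (-p z))
    (hb : Continuous b) (hbc : HasCompactSupport b) (hbU : tsupport b ⊆ U) :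
    MemLp (fun z => b z * g z) 2 volume := by
  have hm : AEStronglyMeasurable (fun z => b z * g z) volume := hb.aestronglyMeasurable.mul hg
  rw [memLp_two_iff_integrable_sq_norm hm]
  have hc : Continuous fun z => (Real.exp (p z) : ℂ) * b z :=
    (continuousOn_ofReal_exp hp).continuous_mul hU hb hbU
  have hb2 : Continuous fun z => (Real.exp (p z) : ℂ) * b z * conj (b z) :=
    hc.mul (Complex.continuous_conj.comp hb)
  obtain ⟨c, hc⟩ := (hbc.mul_left.mul_right :
    HasCompactSupport fun z => (Real.exp (p z) : ℂ) * b z * conj (b z)).exists_bound_of_continuous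
      hb2
  have h1 := hi.mul_bdd (g := fun z => ‖(Real.exp (p z) : ℂ) * b z * conj (b z)‖)
    hb2.norm.aestronglyMeasurable (Filter.Eventually.of_forall fun z => by simpa using hc z)
  refine h1.congr (Filter.Eventually.of_forall fun z => ?_)
  simp only [norm_mul, Complex.norm_real, Real.norm_of_nonneg (Real.exp_pos _).le, RCLike.norm_conj]
  have : Real.exp (-p z) * Real.exp (p z) = 1 := by rw [← Real.exp_add]; simp
  linear_combination ‖g z‖ ^ 2 * ‖b z‖ ^ 2 * this

theorem integrable_mul_of_memLp {g ψ : Cn n → ℂ} (hg : MemLp g 2 volume) (hψ : Continuous ψ)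
    (hc : HasCompactSupport ψ) : Integrable fun z => g z * ψ z :=
  hg.integrable_mul (hψ.memLp_of_hasCompactSupport (p := 2) hc)

theorem contDiff_ofReal_comp {m : WithTop ℕ∞} {χ : Cn n → ℝ} (h : ContDiff ℝ m χ) :
    ContDiff ℝ m fun z => (χ z : ℂ) := Complex.ofRealCLM.contDiff.comp h

theorem tsupport_ofReal (χ : Cn n → ℝ) : tsupport (fun z => (χ z : ℂ)) = tsupport χ := by
  simp only [tsupport]
  congr 1
  ext z
  simp

/-- The weak equation for `∂̄(χγ)`. -/
theorem WeakClosedDiv.dbar_cutoff (hU : IsOpen U) (hp : ContDiffOn ℝ 2 p U)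
    {γ : Cn n → Fin n → ℂ} {w : Cn n → ℂ} (h : WeakClosedDiv U p γ w) {χ : Cn n → ℝ}
    (hχ : ContDiff ℝ 2 χ) (hχc : HasCompactSupport χ) (hχU : tsupport χ ⊆ U) {ψ : Cn n → ℂ}
    (hψ : ContDiff ℝ 2 ψ) (hψc : HasCompactSupport ψ) (j k : Fin n) :
    (∫ z, χ z * γ z j * dbar ψ z k) - ∫ z, χ z * γ z k * dbar ψ z j =
      -∫ z, (dbar (fun z => (χ z : ℂ)) z k * γ z j - dbar (fun z => (χ z : ℂ)) z j * γ z k) *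
        ψ z := by
  set X : Cn n → ℂ := fun z => (χ z : ℂ) with hX
  have hXd : ContDiff ℝ 2 X := contDiff_ofReal_comp hχ
  have hXc : HasCompactSupport X := hasCompactSupport_ofReal hχc
  have hXU : tsupport X ⊆ U := by rwa [tsupport_ofReal]
  have hdX : ∀ k, Continuous fun z => dbar X z k := fun k =>
    (ContDiff.dbar (m := 1) (by norm_num; exact hXd) k).continuous
  have hdψ : ∀ k, Continuous fun z => dbar ψ z k := fun k =>
    (ContDiff.dbar (m := 1) (by norm_num; exact hψ) k).continuous
  have i1 : ∀ j k, Integrable fun z => X z * γ z j * dbar ψ z k := fun j k =>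
    integrable_mul_of_memLp (memLp_mul_of_weighted hU hp.continuousOn (h.meas j) (h.int j)
      hXd.continuous hXc hXU) (hdψ k) (hasCompactSupport_dbar hψc k)
  have i2 : ∀ j k, Integrable fun z => dbar X z k * γ z j * ψ z := fun j k =>
    integrable_mul_of_memLp (memLp_mul_of_weighted hU hp.continuousOn (h.meas j) (h.int j)
      (hdX k) (hasCompactSupport_dbar hXc k) ((tsupport_dbar_subset X k).trans hXU))
      hψ.continuous hψc
  have hT : TestC2 U fun z => X z * ψ z := ⟨hXd.mul hψ, hXc.mul_right,
    (closure_mono (Function.support_mul_subset_left X ψ)).trans hXU⟩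
  have e1 : ∀ j k, ∫ z, γ z j * dbar (fun z => X z * ψ z) z k =
      (∫ z, dbar X z k * γ z j * ψ z) + ∫ z, X z * γ z j * dbar ψ z k := fun j k => by
    rw [← integral_add (i2 j k) (i1 j k)]
    refine integral_congr_ae (Filter.Eventually.of_forall fun z => ?_)
    beta_reduce
    rw [dbar_mul (hXd.differentiable two_ne_zero z) (hψ.differentiable two_ne_zero z)]
    ring
  have e2 := h.closed _ hT j k
  rw [e1, e1] at e2
  have e3 : ∫ z, (dbar X z k * γ z j - dbar X z j * γ z k) * ψ z =
      (∫ z, dbar X z k * γ z j * ψ z) - ∫ z, dbar X z j * γ z k * ψ z := by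
    rw [← integral_sub (i2 j k) (i2 k j)]
    simp only [sub_mul]
  rw [e3]
  linear_combination e2

/-- The divergence of `χγ` in the sense of distributions. -/
def cutoffDiv (p : Cn n → ℝ) (χ : Cn n → ℝ) (γ : Cn n → Fin n → ℂ) (w : Cn n → ℂ) (z : Cn n) : ℂ :=
  Real.exp (p z) * χ z * w z + ∑ j, del (fun z => (χ z : ℂ)) z j * γ z j +
    ∑ j, (del (fun z => (p z : ℂ)) z j * χ z) * γ z j

theorem continuous_del_mul_cutoff (hU : IsOpen U) (hp : ContDiffOn ℝ 2 p U) {χ : Cn n → ℝ}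
    (hχ : ContDiff ℝ 2 χ) (hχU : tsupport χ ⊆ U) (j : Fin n) :
    Continuous fun z => del (fun z => (p z : ℂ)) z j * χ z := by
  refine ContinuousOn.continuous_mul hU ?_ (contDiff_ofReal_comp hχ).continuous
    (by rwa [tsupport_ofReal])
  simp only [del_ofReal]
  refine Complex.continuous_conj.comp_continuousOn (ContDiffOn.dbar (m := 1) hU ?_ j).continuousOn
  norm_num
  exact Complex.ofRealCLM.contDiff.comp_contDiffOn hp

theorem WeakClosedDiv.div_cutoff (hU : IsOpen U) (hp : ContDiffOn ℝ 2 p U)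
    {γ : Cn n → Fin n → ℂ} {w : Cn n → ℂ} (h : WeakClosedDiv U p γ w)
    (hw : Continuous w) {χ : Cn n → ℝ}
    (hχ : ContDiff ℝ 2 χ) (hχc : HasCompactSupport χ) (hχU : tsupport χ ⊆ U) {ψ : Cn n → ℂ}
    (hψ : ContDiff ℝ 2 ψ) (hψc : HasCompactSupport ψ) :
    ∑ j, ∫ z, χ z * γ z j * del ψ z j = -∫ z, cutoffDiv p χ γ w z * ψ z := by
  set X : Cn n → ℂ := fun z => (χ z : ℂ) with hX
  set P : Cn n → ℂ := fun z => (p z : ℂ) with hP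
  set E : Cn n → ℂ := fun z => (Real.exp (p z) : ℂ) with hE
  have hXd : ContDiff ℝ 2 X := contDiff_ofReal_comp hχ
  have hXc : HasCompactSupport X := hasCompactSupport_ofReal hχc
  have hXU : tsupport X ⊆ U := by rwa [tsupport_ofReal]
  have hEd : ContDiffOn ℝ 2 E U := Complex.ofRealCLM.contDiff.comp_contDiffOn hp.exp
  have hdX : ∀ k, Continuous fun z => del X z k := fun k =>
    (ContDiff.del (m := 1) (by norm_num; exact hXd) k).continuous
  have hdψ : ∀ k, Continuous fun z => del ψ z k := fun k =>
    (ContDiff.del (m := 1) (by norm_num; exact hψ) k).continuous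
  have i1 : ∀ j, Integrable fun z => X z * γ z j * del ψ z j := fun j =>
    integrable_mul_of_memLp (memLp_mul_of_weighted hU hp.continuousOn (h.meas j) (h.int j)
      hXd.continuous hXc hXU) (hdψ j) (hasCompactSupport_del hψc j)
  have i2 : ∀ j, Integrable fun z => del X z j * γ z j * ψ z := fun j =>
    integrable_mul_of_memLp (memLp_mul_of_weighted hU hp.continuousOn (h.meas j) (h.int j)
      (hdX j) (hasCompactSupport_del hXc j) ((tsupport_del_subset X j).trans hXU))
      hψ.continuous hψc
  have i3 : ∀ j, Integrable fun z => (del P z j * X z) * γ z j * ψ z := fun j =>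
    integrable_mul_of_memLp (memLp_mul_of_weighted hU hp.continuousOn (h.meas j) (h.int j)
      (continuous_del_mul_cutoff hU hp hχ hχU j) hXc.mul_left
        ((closure_mono (Function.support_mul_subset_right _ X)).trans hXU))
      hψ.continuous hψc
  have hEX : ContDiff ℝ 2 fun z => E z * X z := ContDiffOn.contDiff_mul hU hEd hXd hXU
  have i4 : Integrable fun z => E z * X z * w z * ψ z :=
    ((hEX.continuous.mul hw).mul hψ.continuous).integrable_of_hasCompactSupport hψc.mul_left
  have hT : TestC2 U fun z => E z * X z * ψ z := ⟨hEX.mul hψ, hψc.mul_left,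
    (closure_mono ((Function.support_mul_subset_left _ ψ).trans
      (Function.support_mul_subset_right E X))).trans hXU⟩
  have e1 : ∀ j, ∫ z, γ z j * (Real.exp (-p z) : ℂ) * del (fun z => E z * X z * ψ z) z j =
      (∫ z, X z * γ z j * del ψ z j) + ((∫ z, del X z j * γ z j * ψ z) +
        ∫ z, (del P z j * X z) * γ z j * ψ z) := fun j => by
    have i5 : Integrable fun z => del X z j * γ z j * ψ z + (del P z j * X z) * γ z j * ψ z :=
      (i2 j).add (i3 j)
    rw [← integral_add (i2 j) (i3 j), ← integral_add (i1 j) i5]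
    refine integral_congr_ae (Filter.Eventually.of_forall fun z => ?_)
    beta_reduce
    by_cases hz : z ∈ U
    · have hEz : DifferentiableAt ℝ E z :=
        (hEd.differentiableOn two_ne_zero).differentiableAt (hU.mem_nhds hz)
      have hpz : DifferentiableAt ℝ p z :=
        (hp.differentiableOn two_ne_zero).differentiableAt (hU.mem_nhds hz)
      have hdE : del E z j = E z * del P z j := by
        have : dbar E z j = _ := dbar_real_comp (j := j) hpz (Real.hasDerivAt_exp (p z))
        rw [hE, hP, del_ofReal, del_ofReal]
        rw [hE] at this
        rw [this, map_mul, Complex.conj_ofReal]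
      have hXz := hXd.differentiable two_ne_zero z
      rw [del_mul (hEz.fun_mul hXz) (hψ.differentiable two_ne_zero z), del_mul hEz hXz, hdE]
      have hEE : (Real.exp (-p z) : ℂ) * E z = 1 := by
        rw [hE, ← Complex.ofReal_mul, ← Real.exp_add]; simp
      linear_combination (γ z j * (del P z j * X z * ψ z + del X z j * ψ z + X z * del ψ z j)) * hEE
    · simp [h.zero z hz j]
  have e2 := h.div _ hT
  simp only [e1, Finset.sum_add_distrib] at e2
  have e3 : ∫ z, cutoffDiv p χ γ w z * ψ z = (∫ z, w z * (E z * X z * ψ z)) +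
      (∑ j, (∫ z, del X z j * γ z j * ψ z) + ∑ j, ∫ z, (del P z j * X z) * γ z j * ψ z) := by
    have i6 := integrable_finsetSum Finset.univ fun j _ => i2 j
    have i7 := integrable_finsetSum Finset.univ fun j _ => i3 j
    have i4' : Integrable fun z => w z * (E z * X z * ψ z) :=
      i4.congr (Filter.Eventually.of_forall fun z => by ring)
    have i8 : Integrable fun z => (∑ j, del X z j * γ z j * ψ z) +
      ∑ j, (del P z j * X z) * γ z j * ψ z := i6.add i7
    rw [← integral_finsetSum _ fun j _ => i2 j, ← integral_finsetSum _ fun j _ => i3 j,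
      ← integral_add i6 i7, ← integral_add i4' i8]
    refine integral_congr_ae (Filter.Eventually.of_forall fun z => ?_)
    simp only [cutoffDiv, add_mul, Finset.sum_mul]
    ring
  rw [e3]
  linear_combination e2

theorem norm_sum_mul_sq_le (a b : Fin n → ℂ) :
    ‖∑ j, a j * b j‖ ^ 2 ≤ (∑ j, ‖a j‖ ^ 2) * ∑ j, ‖b j‖ ^ 2 := by
  have h1 : ‖∑ j, a j * b j‖ ≤ ∑ j, ‖a j‖ * ‖b j‖ :=
    (norm_sum_le _ _).trans (le_of_eq (by simp))
  exact (pow_le_pow_left₀ (norm_nonneg _) h1 2).trans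
    (Finset.sum_mul_sq_le_sq_mul_sq Finset.univ (fun j => ‖a j‖) fun j => ‖b j‖)

theorem norm_add_sub_sq_le (a b c : ℂ) :
    ‖a + b - c‖ ^ 2 ≤ 3 * (‖a‖ ^ 2 + ‖b‖ ^ 2 + ‖c‖ ^ 2) := by
  have h : ‖a + b - c‖ ≤ ‖a‖ + ‖b‖ + ‖c‖ :=
    (norm_sub_le _ _).trans (by gcongr; exact norm_add_le _ _)
  refine (pow_le_pow_left₀ (norm_nonneg _) h 2).trans ?_
  nlinarith [sq_nonneg (‖a‖ - ‖b‖), sq_nonneg (‖a‖ - ‖c‖), sq_nonneg (‖b‖ - ‖c‖)]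

theorem half_sum_norm_sub_sq_le (x g : Fin n → ℂ) :
    (1 / 2) * ∑ j, ∑ k, ‖x k * g j - x j * g k‖ ^ 2 ≤ 2 * ((∑ j, ‖x j‖ ^ 2) * ∑ j, ‖g j‖ ^ 2) := by
  have h : ∀ j k, ‖x k * g j - x j * g k‖ ^ 2 ≤
      2 * (‖x k‖ ^ 2 * ‖g j‖ ^ 2) + 2 * (‖x j‖ ^ 2 * ‖g k‖ ^ 2) := fun j k => by
    refine (pow_le_pow_left₀ (norm_nonneg _) (norm_sub_le _ _) 2).trans ?_
    rw [norm_mul, norm_mul]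
    nlinarith [sq_nonneg (‖x k‖ * ‖g j‖ - ‖x j‖ * ‖g k‖)]
  have h2 := Finset.sum_le_sum fun j (_ : j ∈ Finset.univ) =>
    Finset.sum_le_sum fun k (_ : k ∈ Finset.univ) => h j k
  have h3 : ∑ j, ∑ k, (2 * (‖x k‖ ^ 2 * ‖g j‖ ^ 2) + 2 * (‖x j‖ ^ 2 * ‖g k‖ ^ 2)) =
      4 * ((∑ j, ‖x j‖ ^ 2) * ∑ j, ‖g j‖ ^ 2) := by
    simp only [Finset.sum_add_distrib, ← Finset.mul_sum, ← Finset.sum_mul]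
    ring
  linarith

/-- The pointwise inequality behind the three weights estimate. -/
theorem pointwise_three_weights {Levi Φ θ c χ : ℝ} {dX dθ g : Fin n → ℂ} {w τ : ℂ}
    (hL : (3 * ∑ j, ‖dθ j‖ ^ 2 + c * Real.exp θ) * ∑ j, ‖χ * g j‖ ^ 2 ≤ Levi)
    (hτ : τ = Real.exp (Φ - θ) * χ * w + ∑ j, conj (dX j) * g j - ∑ j, conj (dθ j) * (χ * g j)) :
    c * (χ ^ 2 * ∑ j, ‖g j‖ ^ 2 * Real.exp (-(Φ - θ))) ≤
      Levi * Real.exp (-Φ) - ‖τ‖ ^ 2 * Real.exp (-Φ) -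
        (1 / 2) * ∑ j, ∑ k, ‖dX k * g j - dX j * g k‖ ^ 2 * Real.exp (-Φ) +
        3 * (χ ^ 2 * (‖w‖ ^ 2 * Real.exp (Φ - 2 * θ))) +
        5 * ((∑ j, ‖dX j‖ ^ 2) * (∑ j, ‖g j‖ ^ 2) * Real.exp (-Φ)) := by
  have h1 := half_sum_norm_sub_sq_le dX g
  have h2 := norm_add_sub_sq_le (Real.exp (Φ - θ) * χ * w) (∑ j, conj (dX j) * g j)
    (∑ j, conj (dθ j) * (χ * g j))
  rw [← hτ] at h2
  have h3 := norm_sum_mul_sq_le (fun j => conj (dX j)) g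
  have h4 := norm_sum_mul_sq_le (fun j => conj (dθ j)) fun j => χ * g j
  simp only [RCLike.norm_conj] at h3 h4
  have h5 : ‖(Real.exp (Φ - θ) * χ * w : ℂ)‖ ^ 2 = Real.exp (Φ - θ) ^ 2 * χ ^ 2 * ‖w‖ ^ 2 := by
    rw [norm_mul, norm_mul, Complex.norm_real, Complex.norm_real, mul_pow, mul_pow]
    simp
  rw [h5] at h2
  have h6 : ∑ j, ‖χ * g j‖ ^ 2 = χ ^ 2 * ∑ j, ‖g j‖ ^ 2 := by
    simp [mul_pow, Finset.mul_sum]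
  rw [h6] at hL h4
  simp only [← Finset.sum_mul]
  set G := ∑ j, ‖g j‖ ^ 2
  set S := ∑ j, ‖dX j‖ ^ 2
  set T := ∑ j, ‖dθ j‖ ^ 2
  set N := ∑ j, ∑ k, ‖dX k * g j - dX j * g k‖ ^ 2
  have e1 : Real.exp (-(Φ - θ)) = Real.exp θ * Real.exp (-Φ) := by rw [← Real.exp_add]; ring_nf
  have e2 : Real.exp (Φ - 2 * θ) = Real.exp (Φ - θ) ^ 2 * Real.exp (-Φ) := by
    rw [sq, ← Real.exp_add, ← Real.exp_add]; ring_nf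
  rw [e1, e2]
  have key : c * (χ ^ 2 * G * Real.exp θ) ≤ Levi - ‖τ‖ ^ 2 - (1 / 2) * N +
      3 * (χ ^ 2 * (‖w‖ ^ 2 * Real.exp (Φ - θ) ^ 2)) + 5 * (S * G) := by
    linarith
  have := mul_le_mul_of_nonneg_right key (Real.exp_pos (-Φ)).le
  linarith

theorem cutoffDiv_sub_eq {Φ θ : Cn n → ℝ} {z : Cn n} (hΦ : DifferentiableAt ℝ Φ z)
    (hθ : DifferentiableAt ℝ θ z) (χ : Cn n → ℝ) (γ : Cn n → Fin n → ℂ) (w : Cn n → ℂ) :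
    cutoffDiv (fun z => Φ z - θ z) χ γ w z - ∑ j, del (fun z => (Φ z : ℂ)) z j * (χ z * γ z j) =
      Real.exp (Φ z - θ z) * χ z * w z + ∑ j, conj (dbar (fun z => (χ z : ℂ)) z j) * γ z j -
        ∑ j, conj (dbar (fun z => (θ z : ℂ)) z j) * (χ z * γ z j) := by
  have h1 : DifferentiableAt ℝ (fun z => (Φ z : ℂ)) z :=
    Complex.ofRealCLM.differentiableAt.comp z hΦ
  have h2 : DifferentiableAt ℝ (fun z => (θ z : ℂ)) z :=
    Complex.ofRealCLM.differentiableAt.comp z hθ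
  have h3 : ∀ j, del (fun z => ((Φ z - θ z : ℝ) : ℂ)) z j =
      del (fun z => (Φ z : ℂ)) z j - del (fun z => (θ z : ℂ)) z j := fun j => by
    rw [← del_sub h1 h2]; simp
  simp only [cutoffDiv, h3, ← del_ofReal]
  have h4 : ∑ j, (del (fun z => (Φ z : ℂ)) z j - del (fun z => (θ z : ℂ)) z j) * χ z * γ z j =
      ∑ j, del (fun z => (Φ z : ℂ)) z j * (χ z * γ z j) -
        ∑ j, del (fun z => (θ z : ℂ)) z j * (χ z * γ z j) := by
    rw [← Finset.sum_sub_distrib]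
    exact Finset.sum_congr rfl fun j _ => by ring
  rw [h4]
  ring

theorem eventuallyEq_of_nhdsSet {F : Type*} {L : Set (Cn n)} {f g : Cn n → F}
    (h : ∀ᶠ z in nhdsSet L, f z = g z) {z : Cn n} (hz : z ∈ L) : f =ᶠ[nhds z] g :=
  eventually_nhdsSet_iff_forall.1 h z hz

theorem leviForm_congr {f g : Cn n → ℝ} {z : Cn n} (h : f =ᶠ[nhds z] g) (w : Cn n) :
    LeviForm f z w = LeviForm g z w := by
  simp only [LeviForm, h.fderiv.fderiv_eq]

theorem memLp_cutoffDiv (hU : IsOpen U) (hp : ContDiffOn ℝ 2 p U)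
    {γ : Cn n → Fin n → ℂ} {w : Cn n → ℂ} (h : WeakClosedDiv U p γ w)
    (hw : Continuous w) {χ : Cn n → ℝ}
    (hχ : ContDiff ℝ 2 χ) (hχc : HasCompactSupport χ) (hχU : tsupport χ ⊆ U) :
    MemLp (cutoffDiv p χ γ w) 2 volume := by
  have hXd := contDiff_ofReal_comp hχ
  have hXc := hasCompactSupport_ofReal hχc
  have hXU : tsupport (fun z => (χ z : ℂ)) ⊆ U := by rwa [tsupport_ofReal]
  have h1 : Continuous fun z => (Real.exp (p z) : ℂ) * χ z :=
    (continuousOn_ofReal_exp hp.continuousOn).continuous_mul hU hXd.continuous hXU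
  have m1 : MemLp (fun z => (Real.exp (p z) : ℂ) * χ z * w z) 2 volume :=
    (h1.mul hw).memLp_of_hasCompactSupport hXc.mul_left.mul_right
  have m2 : MemLp (fun z => ∑ j, del (fun z => (χ z : ℂ)) z j * γ z j) 2 volume :=
    memLp_finsetSum _ fun j _ => memLp_mul_of_weighted hU hp.continuousOn (h.meas j) (h.int j)
      (ContDiff.del (m := 1) (by norm_num; exact hXd) j).continuous (hasCompactSupport_del hXc j)
      ((tsupport_del_subset _ j).trans hXU)
  have m3 : MemLp (fun z => ∑ j, (del (fun z => (p z : ℂ)) z j * χ z) * γ z j) 2 volume :=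
    memLp_finsetSum _ fun j _ => memLp_mul_of_weighted hU hp.continuousOn (h.meas j) (h.int j)
      (continuous_del_mul_cutoff hU hp hχ hχU j) hXc.mul_left
        ((closure_mono (Function.support_mul_subset_right _ _)).trans hXU)
  exact (m1.add m2).add m3

theorem integrable_norm_sq_mul_weight {Φ : Cn n → ℝ} (hΦ : Continuous Φ)
    (hΦc : HasCompactSupport Φ) {f : Cn n → ℂ} (hf : MemLp f 2 volume) :
    Integrable fun z => ‖f z‖ ^ 2 * Real.exp (-Φ z) := by
  obtain ⟨c, hc⟩ := exists_weight_bound hΦ hΦc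
  refine ((memLp_two_iff_integrable_sq_norm hf.1).1 hf).mul_bdd (c := c)
    (Real.continuous_exp.comp hΦ.neg).aestronglyMeasurable (Filter.Eventually.of_forall fun z => ?_)
  have := hc z
  rwa [Complex.norm_real] at this

/-- The a priori estimate for `χγ` with a fixed cutoff `χ`. -/
theorem WeakClosedDiv.cutoff_estimate (hU : IsOpen U) {Φ θ : Cn n → ℝ} (hΦ : ContDiffOn ℝ 2 Φ U)
    (hθ : ContDiffOn ℝ 2 θ U) {c : ℝ}
    (hL : ∀ z ∈ U, ∀ w : Cn n, (3 * ∑ j, ‖dbar (fun z => (θ z : ℂ)) z j‖ ^ 2 +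
      c * Real.exp (θ z)) * ‖w‖ ^ 2 ≤ LeviForm Φ z w)
    {γ : Cn n → Fin n → ℂ} {w : Cn n → ℂ} (h : WeakClosedDiv U (fun z => Φ z - θ z) γ w)
    (hw : Continuous w) {χ : Cn n → ℝ}
    (hχ : ContDiff ℝ 2 χ) (hχc : HasCompactSupport χ) (hχU : tsupport χ ⊆ U) :
    Integrable (fun z => (∑ j, ‖dbar (fun z => (χ z : ℂ)) z j‖ ^ 2) * (∑ j, ‖γ z j‖ ^ 2) *
      Real.exp (-Φ z)) ∧
    c * ∫ z, χ z ^ 2 * ∑ j, ‖γ z j‖ ^ 2 * Real.exp (-(Φ z - θ z)) ≤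
      3 * (∫ z, χ z ^ 2 * (‖w z‖ ^ 2 * Real.exp (Φ z - 2 * θ z))) +
      5 * ∫ z, (∑ j, ‖dbar (fun z => (χ z : ℂ)) z j‖ ^ 2) * (∑ j, ‖γ z j‖ ^ 2) *
        Real.exp (-Φ z) := by
  set X : Cn n → ℂ := fun z => (χ z : ℂ) with hX
  have hXd : ContDiff ℝ 2 X := contDiff_ofReal_comp hχ
  have hXc : HasCompactSupport X := hasCompactSupport_ofReal hχc
  have hXs : tsupport X = tsupport χ := tsupport_ofReal χ
  have hXU : tsupport X ⊆ U := by rwa [tsupport_ofReal]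
  have hp : ContDiffOn ℝ 2 (fun z => Φ z - θ z) U := hΦ.sub hθ
  obtain ⟨Φ', hΦ', hΦ'c, -, hev⟩ := exists_contDiff_extension (m := 2) hχc hU hχU
    (by exact_mod_cast hΦ)
  replace hΦ' : ContDiff ℝ 2 Φ' := by exact_mod_cast hΦ'
  have hX0 : ∀ z ∉ tsupport χ, χ z = 0 := fun z hz => image_eq_zero_of_notMem_tsupport hz
  have hdX0 : ∀ z ∉ tsupport χ, ∀ j, dbar X z j = 0 := fun z hz j =>
    image_eq_zero_of_notMem_tsupport (f := fun z => dbar X z j)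
      fun h => hz (hXs ▸ tsupport_dbar_subset X j h)
  have mβ : ∀ j, MemLp (fun z => X z * γ z j) 2 volume := fun j =>
    memLp_mul_of_weighted hU hp.continuousOn (h.meas j) (h.int j) hXd.continuous hXc hXU
  have mdX : ∀ j k, MemLp (fun z => dbar X z k * γ z j) 2 volume := fun j k =>
    memLp_mul_of_weighted hU hp.continuousOn (h.meas j) (h.int j)
      (ContDiff.dbar (m := 1) (by norm_num; exact hXd) k).continuous (hasCompactSupport_dbar hXc k)
      ((tsupport_dbar_subset X k).trans hXU)
  have mτ := memLp_cutoffDiv hU hp h hw hχ hχc hχU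
  have mκ : ∀ j k, MemLp (fun z => dbar X z k * γ z j - dbar X z j * γ z k) 2 volume :=
    fun j k => (mdX j k).sub (mdX k j)
  have hcut0 : ∀ z ∉ tsupport χ, cutoffDiv (fun z => Φ z - θ z) χ γ w z = 0 := fun z hz => by
    have : ∀ j, del X z j = 0 := fun j => by rw [hX, del_ofReal, ← hX, hdX0 z hz, map_zero]
    simp only [cutoffDiv, hX0 z hz, Complex.ofReal_zero, mul_zero, zero_mul,
      Finset.sum_const_zero, zero_add, add_zero]
    exact Finset.sum_eq_zero fun j _ => by
      rw [show del (fun z => (χ z : ℂ)) z j = 0 from this j, zero_mul]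
  have hmain := integral_levi_le_of_weak hΦ' hΦ'c hχc mβ mτ mκ
    (fun z hz j => by simp [hX, hX0 z hz]) hcut0
    (fun j k z hz => by simp [hdX0 z hz])
    (fun ψ h1 h2 => h.div_cutoff hU hp hw hχ hχc hχU h1 h2)
    (fun ψ h1 h2 j k => h.dbar_cutoff hU hp hχ hχc hχU h1 h2 j k)
  have hcontdel : ∀ j, Continuous fun z => del (fun z => (Φ' z : ℂ)) z j := fun j =>
    (ContDiff.del (m := 1) (by norm_num; exact contDiff_ofReal_comp hΦ') j).continuous
  have mΦβ : MemLp (fun z => ∑ j, del (fun z => (Φ' z : ℂ)) z j * (X z * γ z j)) 2 volume := by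
    refine memLp_finsetSum _ fun j _ => ?_
    obtain ⟨b, hb⟩ := (hasCompactSupport_del (hasCompactSupport_ofReal hΦ'c)
      j).exists_bound_of_continuous (hcontdel j)
    exact (mβ j).mul (memLp_top_of_bound (hcontdel j).aestronglyMeasurable b
      (Filter.Eventually.of_forall hb))
  have iA := integrable_levi hΦ' hΦ'c mβ
  have iB := integrable_norm_sq_mul_weight hΦ'.continuous hΦ'c (mτ.sub mΦβ)
  have iK := fun j k => integrable_norm_sq_mul_weight hΦ'.continuous hΦ'c (mκ j k)
  have iS : Integrable fun z => (∑ j, ‖dbar X z j‖ ^ 2) * (∑ j, ‖γ z j‖ ^ 2) * Real.exp (-Φ z) := by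
    refine (integrable_finsetSum Finset.univ fun j _ => integrable_finsetSum Finset.univ fun k _ =>
      integrable_norm_sq_mul_weight hΦ'.continuous hΦ'c (mdX k j)).congr
      (Filter.Eventually.of_forall fun z => ?_)
    beta_reduce
    by_cases hz : z ∈ tsupport χ
    · rw [(eventuallyEq_of_nhdsSet hev hz).eq_of_nhds, Finset.sum_mul_sum]
      simp only [Finset.sum_mul, norm_mul, mul_pow]
    · simp [hdX0 z hz]
  refine ⟨iS, ?_⟩
  have hw2 : Integrable fun z => χ z ^ 2 * (‖w z‖ ^ 2 * Real.exp (Φ z - 2 * θ z)) := by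
    have h1 : Continuous fun z => (Real.exp (Φ z - 2 * θ z) : ℂ) * X z :=
      (continuousOn_ofReal_exp (hΦ.continuousOn.sub (hθ.continuousOn.const_mul
        2))).continuous_mul hU hXd.continuous hXU
    have h2 : Integrable fun z => (Real.exp (Φ z - 2 * θ z) : ℂ) * X z * X z * w z * conj (w z) :=
      ((((h1.mul hXd.continuous).mul hw).mul
        (Complex.continuous_conj.comp hw))).integrable_of_hasCompactSupport
        hXc.mul_left.mul_right.mul_right
    refine h2.re.congr (Filter.Eventually.of_forall fun z => ?_)
    have : (Real.exp (Φ z - 2 * θ z) : ℂ) * X z * X z * w z * conj (w z) =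
        ((χ z ^ 2 * (‖w z‖ ^ 2 * Real.exp (Φ z - 2 * θ z)) : ℝ) : ℂ) := by
      rw [mul_assoc, Complex.mul_conj, Complex.normSq_eq_norm_sq, hX]
      push_cast [-Complex.ofReal_exp]
      ring
    beta_reduce
    rw [this]
    exact Complex.ofReal_re _
  have iG : Integrable fun z => χ z ^ 2 * ∑ j, ‖γ z j‖ ^ 2 * Real.exp (-(Φ z - θ z)) := by
    have h1 := integrable_finsetSum Finset.univ fun j _ => h.int j
    obtain ⟨b, hb⟩ := (hχc.comp_left (g := fun x : ℝ => x ^ 2) (by simp) :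
      HasCompactSupport fun z => χ z ^ 2).exists_bound_of_continuous (hχ.continuous.pow 2)
    refine (h1.mul_bdd (hχ.continuous.pow 2).aestronglyMeasurable
      (Filter.Eventually.of_forall hb)).congr (Filter.Eventually.of_forall fun z => ?_)
    exact mul_comm _ _
  have iKs : Integrable fun z => ∑ j, ∑ k, ‖dbar X z k * γ z j - dbar X z j * γ z k‖ ^ 2 *
      Real.exp (-Φ' z) :=
    integrable_finsetSum _ fun j _ => integrable_finsetSum _ fun k _ => iK j k
  have hKs : ∫ z, ∑ j, ∑ k, ‖dbar X z k * γ z j - dbar X z j * γ z k‖ ^ 2 * Real.exp (-Φ' z) =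
      ∑ j, ∑ k, ∫ z, ‖dbar X z k * γ z j - dbar X z j * γ z k‖ ^ 2 * Real.exp (-Φ' z) := by
    rw [integral_finsetSum _ fun j _ => integrable_finsetSum _ fun k _ => iK j k]
    exact Finset.sum_congr rfl fun j _ => integral_finsetSum _ fun k _ => iK j k
  have hpt : ∀ z, c * (χ z ^ 2 * ∑ j, ‖γ z j‖ ^ 2 * Real.exp (-(Φ z - θ z))) ≤
      LeviForm Φ' z (WithLp.toLp 2 fun j => X z * γ z j) * Real.exp (-Φ' z) -
      ‖cutoffDiv (fun z => Φ z - θ z) χ γ w z -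
        ∑ j, del (fun z => (Φ' z : ℂ)) z j * (X z * γ z j)‖ ^ 2 * Real.exp (-Φ' z) -
      (1 / 2) * (∑ j, ∑ k, ‖dbar X z k * γ z j - dbar X z j * γ z k‖ ^ 2 * Real.exp (-Φ' z)) +
      3 * (χ z ^ 2 * (‖w z‖ ^ 2 * Real.exp (Φ z - 2 * θ z))) +
      5 * ((∑ j, ‖dbar X z j‖ ^ 2) * (∑ j, ‖γ z j‖ ^ 2) * Real.exp (-Φ z)) := fun z => by
    by_cases hz : z ∈ tsupport χ
    · have he := eventuallyEq_of_nhdsSet hev hz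
      have hzU := hU.mem_nhds (hχU hz)
      have hd : ∀ j, del (fun z => (Φ' z : ℂ)) z j = del (fun z => (Φ z : ℂ)) z j := fun j =>
        del_congr (he.fun_comp Complex.ofReal)
      simp only [hd, leviForm_congr he, he.eq_of_nhds]
      refine pointwise_three_weights (dθ := fun j => dbar (fun z => (θ z : ℂ)) z j) ?_
        (cutoffDiv_sub_eq ((hΦ.contDiffAt hzU).differentiableAt (by norm_num))
          ((hθ.contDiffAt hzU).differentiableAt (by norm_num)) χ γ w)
      have := hL z (hχU hz) (WithLp.toLp 2 fun j => X z * γ z j)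
      rwa [EuclideanSpace.norm_sq_eq] at this
    · have hτ0 : cutoffDiv (fun z => Φ z - θ z) χ γ w z = 0 := hcut0 z hz
      have h0 : (WithLp.toLp 2 (fun _ : Fin n => (0 : ℂ)) : Cn n) = 0 := rfl
      have hXz : X z = 0 := by simp [hX, hX0 z hz]
      simp [hτ0, hX0 z hz, hdX0 z hz, hXz, LeviForm, h0]
  have iB' : Integrable fun z => ‖cutoffDiv (fun z => Φ z - θ z) χ γ w z -
        ∑ j, del (fun z => (Φ' z : ℂ)) z j * (X z * γ z j)‖ ^ 2 * Real.exp (-Φ' z) := iB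
  have i1 := iA.sub iB'
  have i2 := i1.sub (iKs.const_mul (1 / 2))
  have i3 := i2.add (hw2.const_mul 3)
  have i4 := i3.add (iS.const_mul 5)
  have hfin := integral_mono (iG.const_mul c) i4 hpt
  rw [integral_add' i3 (iS.const_mul 5), integral_add' i2 (hw2.const_mul 3),
    integral_sub' i1 (iKs.const_mul (1 / 2)), integral_sub' iA iB'] at hfin
  simp only [integral_const_mul] at hfin
  rw [hKs] at hfin
  linarith

/-- Hörmander's three weights estimate. -/
theorem WeakClosedDiv.estimate (hU : IsOpen U) {Φ θ : Cn n → ℝ} (hΦ : ContDiffOn ℝ 2 Φ U)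
    (hθ : ContDiffOn ℝ 2 θ U) {c A : ℝ}
    (hL : ∀ z ∈ U, ∀ w : Cn n, (3 * ∑ j, ‖dbar (fun z => (θ z : ℂ)) z j‖ ^ 2 +
      c * Real.exp (θ z)) * ‖w‖ ^ 2 ≤ LeviForm Φ z w)
    {γ : Cn n → Fin n → ℂ} {w : Cn n → ℂ} (h : WeakClosedDiv U (fun z => Φ z - θ z) γ w)
    (hw : Continuous w) (hwi : Integrable fun z => ‖w z‖ ^ 2 * Real.exp (Φ z - 2 * θ z))
    {χ : ℕ → Cn n → ℝ} (hχ : ∀ m, ContDiff ℝ 2 (χ m)) (hχc : ∀ m, HasCompactSupport (χ m))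
    (hχU : ∀ m, tsupport (χ m) ⊆ U) (hχI : ∀ m z, χ m z ∈ Icc (0 : ℝ) 1)
    (hχA : ∀ m, ∀ z ∈ U, ∑ j, ‖dbar (fun z => (χ m z : ℂ)) z j‖ ^ 2 ≤ A * Real.exp (θ z))
    (hχ1 : ∀ z ∈ U, ∀ᶠ m in Filter.atTop, χ m z = 1 ∧ ∀ j, dbar (fun z => (χ m z : ℂ)) z j = 0) :
    c * ∫ z, ∑ j, ‖γ z j‖ ^ 2 * Real.exp (-(Φ z - θ z)) ≤
      3 * ∫ z, ‖w z‖ ^ 2 * Real.exp (Φ z - 2 * θ z) := by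
  have hest := fun m => h.cutoff_estimate hU hΦ hθ hL hw (hχ m) (hχc m) (hχU m)
  have iG := integrable_finsetSum Finset.univ fun j _ => h.int j
  have hχ2 : ∀ m z, χ m z ^ 2 ∈ Icc (0 : ℝ) 1 := fun m z =>
    ⟨sq_nonneg _, pow_le_one₀ (hχI m z).1 (hχI m z).2⟩
  have hG0 : ∀ z, 0 ≤ ∑ j, ‖γ z j‖ ^ 2 * Real.exp (-(Φ z - θ z)) := fun z =>
    Finset.sum_nonneg fun j _ => by positivity
  have t1 : Filter.Tendsto
      (fun m => ∫ z, χ m z ^ 2 * ∑ j, ‖γ z j‖ ^ 2 * Real.exp (-(Φ z - θ z))) Filter.atTop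
      (nhds (∫ z, ∑ j, ‖γ z j‖ ^ 2 * Real.exp (-(Φ z - θ z)))) := by
    refine tendsto_integral_of_dominated_convergence
      (fun z => ∑ j, ‖γ z j‖ ^ 2 * Real.exp (-(Φ z - θ z)))
      (fun m => ((hχ m).continuous.pow 2).aestronglyMeasurable.mul iG.aestronglyMeasurable) iG
      (fun m => Filter.Eventually.of_forall fun z => ?_)
      (Filter.Eventually.of_forall fun z => ?_)
    · rw [Real.norm_of_nonneg (mul_nonneg (hχ2 m z).1 (hG0 z))]
      exact mul_le_of_le_one_left (hG0 z) (hχ2 m z).2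
    · by_cases hz : z ∈ U
      · exact tendsto_const_nhds.congr' ((hχ1 z hz).mono fun m hm => by simp [hm.1])
      · simp [h.zero z hz]
  have t2 : Filter.Tendsto
      (fun m => ∫ z, (∑ j, ‖dbar (fun z => (χ m z : ℂ)) z j‖ ^ 2) * (∑ j, ‖γ z j‖ ^ 2) *
        Real.exp (-Φ z)) Filter.atTop (nhds (∫ _ : Cn n, (0 : ℝ))) := by
    refine tendsto_integral_of_dominated_convergence
      (fun z => A * ∑ j, ‖γ z j‖ ^ 2 * Real.exp (-(Φ z - θ z)))
      (fun m => (hest m).1.aestronglyMeasurable) (iG.const_mul A)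
      (fun m => Filter.Eventually.of_forall fun z => ?_)
      (Filter.Eventually.of_forall fun z => ?_)
    · rw [Real.norm_of_nonneg (by positivity)]
      by_cases hz : z ∈ U
      · have e1 : Real.exp (-(Φ z - θ z)) = Real.exp (θ z) * Real.exp (-Φ z) := by
          rw [← Real.exp_add]; ring_nf
        rw [e1, ← Finset.sum_mul]
        calc _ ≤ A * Real.exp (θ z) * (∑ j, ‖γ z j‖ ^ 2) * Real.exp (-Φ z) := by
              gcongr
              exact hχA m z hz
          _ = _ := by ring
      · simp [h.zero z hz]
    · by_cases hz : z ∈ U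
      · exact tendsto_const_nhds.congr' ((hχ1 z hz).mono fun m hm => by simp [hm.2])
      · simp [h.zero z hz]
  rw [integral_zero] at t2
  have t3 := (t2.const_mul 5).const_add (3 * ∫ z, ‖w z‖ ^ 2 * Real.exp (Φ z - 2 * θ z))
  rw [mul_zero, add_zero] at t3
  refine le_of_tendsto_of_tendsto (t1.const_mul c) t3 (Filter.Eventually.of_forall fun m => ?_)
  refine (hest m).2.trans ?_
  refine add_le_add_left (mul_le_mul_of_nonneg_left ?_ (by norm_num)) _
  refine integral_mono_of_nonneg (Filter.Eventually.of_forall fun z => by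
    have := (hχ2 m z).1
    positivity) hwi (Filter.Eventually.of_forall fun z => ?_)
  exact mul_le_of_le_one_left (by positivity) (hχ2 m z).2

end ThreeWeights

section Duality

theorem dbar_dbar_comm {v : Cn n → ℂ} {z : Cn n} (hv : ContDiffAt ℝ 2 v z) (j k : Fin n) :
    dbar (fun z => dbar v z j) z k = dbar (fun z => dbar v z k) z j := by
  have h1 := fun b => differentiableAt_fderiv_apply hv b
  have e2 : ∀ k a, fderiv ℝ (fun z => dbar v z k) z a =
      (1 / 2) * (fderiv ℝ (fderiv ℝ v) z a (e n k) +
        I * fderiv ℝ (fderiv ℝ v) z a (I • e n k)) := fun k a => by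
    unfold dbar
    rw [fderiv_const_mul ((h1 _).fun_add ((h1 _).const_mul _)), fderiv_fun_add (h1 _)
      ((h1 _).const_mul _), fderiv_const_mul (h1 _)]
    simp only [fderiv_fderiv_apply hv, add_apply, smul_apply, smul_eq_mul]
  rw [dbar, dbar]
  simp only [e2]
  rw [fderiv_fderiv_symm hv (e n k) (e n j), fderiv_fderiv_symm hv (I • e n k) (e n j),
    fderiv_fderiv_symm hv (e n k) (I • e n j), fderiv_fderiv_symm hv (I • e n k) (I • e n j)]
  ring

theorem inner_toLp_toLp {μ : Measure (Cn n)} {f g : Cn n → ℂ} (hf : MemLp f 2 μ)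
    (hg : MemLp g 2 μ) : inner ℂ (hf.toLp f) (hg.toLp g) = ∫ z, conj (f z) * g z ∂μ := by
  rw [L2.inner_def]
  refine integral_congr_ae ?_
  filter_upwards [hf.coeFn_toLp, hg.coeFn_toLp] with z h1 h2
  rw [h1, h2]
  simp [mul_comm]

theorem inner_toLp_left {μ : Measure (Cn n)} {f : Cn n → ℂ} (hf : MemLp f 2 μ)
    (g : Lp ℂ 2 μ) : inner ℂ (hf.toLp f) g = ∫ z, conj (f z) * g z ∂μ := by
  rw [← inner_toLp_toLp hf (Lp.memLp g), Lp.toLp_coeFn]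

theorem norm_sq_eq_integral {μ : Measure (Cn n)} (g : Lp ℂ 2 μ) :
    ‖g‖ ^ 2 = ∫ z, ‖g z‖ ^ 2 ∂μ := by
  have h : (inner ℂ g g : ℂ) = ((∫ z, ‖g z‖ ^ 2 ∂μ : ℝ) : ℂ) := by
    rw [L2.inner_def, ← integral_complex_ofReal]
    refine integral_congr_ae (Filter.Eventually.of_forall fun z => ?_)
    beta_reduce
    rw [inner_self_eq_norm_sq_to_K]
    simp
  rw [inner_self_eq_norm_sq_to_K] at h
  exact Complex.ofReal_injective (by push_cast; exact h)

theorem norm_sq_toLp {μ : Measure (Cn n)} {f : Cn n → ℂ} (hf : MemLp f 2 μ) :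
    ‖hf.toLp f‖ ^ 2 = ∫ z, ‖f z‖ ^ 2 ∂μ := by
  rw [norm_sq_eq_integral]
  refine integral_congr_ae ?_
  filter_upwards [hf.coeFn_toLp] with z h1
  rw [h1]

theorem mem_span_orthogonal_iff {H : Type*} [NormedAddCommGroup H] [InnerProductSpace ℂ H]
    {S : Set H} {x : H} : x ∈ (Submodule.span ℂ S)ᗮ ↔ ∀ s ∈ S, inner ℂ s x = 0 := by
  refine ⟨fun h s hs => h s (Submodule.subset_span hs), fun h => ?_⟩
  rw [Submodule.mem_orthogonal]
  intro u hu
  induction hu using Submodule.span_induction with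
  | mem s hs => exact h s hs
  | zero => simp
  | add a b _ _ ha hb => rw [inner_add_left, ha, hb, add_zero]
  | smul c a _ ha => rw [inner_smul_left, ha, mul_zero]

theorem exists_mem_orthogonal_inner_eq {H : Type*} [NormedAddCommGroup H] [InnerProductSpace ℂ H]
    [CompleteSpace H] (S : Submodule ℂ H) (a : H) :
    ∃ γ ∈ Sᗮ, ∀ b ∈ Sᗮ, inner ℂ b γ = inner ℂ b a := by
  refine ⟨Sᗮ.starProjection a, Submodule.starProjection_apply_mem _ _, fun b hb => ?_⟩
  have := Submodule.starProjection_inner_eq_zero (K := Sᗮ) a b hb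
  rw [← inner_conj_symm, starRingEnd_apply, star_eq_zero, inner_sub_right, sub_eq_zero] at this
  exact this.symm

/-- Absorption of the weight `e^{-p/2}`. -/
def weighted (p : Cn n → ℝ) (g : Cn n → ℂ) (z : Cn n) : ℂ := g z * (Real.exp (-p z / 2) : ℂ)

theorem norm_weighted_sq (p : Cn n → ℝ) (g : Cn n → ℂ) (z : Cn n) :
    ‖weighted p g z‖ ^ 2 = ‖g z‖ ^ 2 * Real.exp (-p z) := by
  rw [weighted, norm_mul, mul_pow, Complex.norm_real, Real.norm_of_nonneg (Real.exp_pos _).le,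
    sq (Real.exp _), ← Real.exp_add]
  congr 3
  ring

theorem exp_half_mul_exp_half (x : ℝ) :
    (Real.exp (-x / 2) : ℂ) * (Real.exp (-(-x) / 2) : ℂ) = 1 := by
  rw [← Complex.ofReal_mul, ← Real.exp_add]
  have : -x / 2 + -(-x) / 2 = 0 := by ring
  rw [this]; simp

theorem conj_weighted (p : Cn n → ℝ) (g : Cn n → ℂ) (z : Cn n) :
    conj (weighted p g z) = weighted p (fun z => conj (g z)) z := by
  rw [weighted, weighted, map_mul, Complex.conj_ofReal]

theorem weighted_mul_weighted (p : Cn n → ℝ) (f g : Cn n → ℂ) (z : Cn n) :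
    weighted p f z * weighted (fun z => -p z) g z = f z * g z := by
  have := exp_half_mul_exp_half (p z)
  simp only [weighted]
  linear_combination f z * g z * this

theorem weighted_weighted (p : Cn n → ℝ) (f : Cn n → ℂ) (z : Cn n) :
    weighted p (weighted (fun z => -p z) f) z = f z := by
  have := exp_half_mul_exp_half (p z)
  simp only [weighted]
  linear_combination f z * this

variable {U : Set (Cn n)} {p : Cn n → ℝ}

theorem memLp_weighted (hU : IsOpen U) (hp : ContinuousOn p U) {g : Cn n → ℂ}
    (hg : AEStronglyMeasurable g (volume.restrict U))
    (hi : IntegrableOn (fun z => ‖g z‖ ^ 2 * Real.exp (-p z)) U volume) :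
    MemLp (weighted p g) 2 (volume.restrict U) := by
  have hm : AEStronglyMeasurable (weighted p g) (volume.restrict U) :=
    hg.mul ((continuousOn_ofReal_exp (hp.neg.div_const 2)).aestronglyMeasurable hU.measurableSet)
  rw [memLp_two_iff_integrable_sq_norm hm]
  simpa only [norm_weighted_sq, IntegrableOn] using hi

theorem integrableOn_of_test (hU : IsOpen U) {q : Cn n → ℝ} (hq : ContinuousOn q U) {b : Cn n → ℂ}
    (hb : Continuous b) (hbc : HasCompactSupport b) (hbU : tsupport b ⊆ U) :
    IntegrableOn (fun z => ‖b z‖ ^ 2 * Real.exp (q z)) U volume := by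
  have h1 : Continuous fun z => (Real.exp (q z) : ℂ) * b z :=
    (continuousOn_ofReal_exp hq).continuous_mul hU hb hbU
  have h2 : Integrable fun z => (Real.exp (q z) : ℂ) * b z * conj (b z) :=
    (h1.mul (Complex.continuous_conj.comp hb)).integrable_of_hasCompactSupport
      hbc.mul_left.mul_right
  refine h2.norm.integrableOn.congr_fun (fun z _ => ?_) hU.measurableSet
  simp only [norm_mul, Complex.norm_real, Real.norm_of_nonneg (Real.exp_pos _).le, RCLike.norm_conj]
  ring

theorem memLp_weighted_neg_test (hU : IsOpen U) (hp : ContinuousOn p U) {b : Cn n → ℂ}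
    (hb : Continuous b) (hbc : HasCompactSupport b) (hbU : tsupport b ⊆ U) :
    MemLp (weighted (fun z => -p z) b) 2 (volume.restrict U) := by
  refine memLp_weighted hU hp.neg hb.aestronglyMeasurable ?_
  simpa using integrableOn_of_test hU hp hb hbc hbU

theorem TestC2.contDiff_dbar {ψ : Cn n → ℂ} (h : TestC2 U ψ) (j : Fin n) :
    ContDiff ℝ 1 fun z => dbar ψ z j :=
  ContDiff.dbar (m := 1) (by norm_num; exact h.contDiff) j

theorem TestC2.contDiff_del {ψ : Cn n → ℂ} (h : TestC2 U ψ) (j : Fin n) :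
    ContDiff ℝ 1 fun z => del ψ z j :=
  ContDiff.del (m := 1) (by norm_num; exact h.contDiff) j

theorem TestC2.conj {ψ : Cn n → ℂ} (h : TestC2 U ψ) : TestC2 U fun z => conj (ψ z) :=
  ⟨contDiff_conj h.contDiff, hasCompactSupport_conj h.hasCompactSupport,
    (closure_mono fun z hz => by simpa using hz).trans h.tsupport_subset⟩

theorem TestC2.memLp_weighted_dbar (hU : IsOpen U) (hp : ContinuousOn p U) {ψ : Cn n → ℂ}
    (h : TestC2 U ψ) (j : Fin n) :
    MemLp (weighted (fun z => -p z) fun z => conj (dbar ψ z j)) 2 (volume.restrict U) := by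
  have h1 := hasCompactSupport_conj (hasCompactSupport_dbar h.hasCompactSupport j)
  have hs : tsupport (fun z => (starRingEnd ℂ) (dbar ψ z j)) ⊆ U :=
    ((closure_mono fun z hz => by simpa using hz).trans (tsupport_dbar_subset ψ j)).trans
      h.tsupport_subset
  exact memLp_weighted_neg_test hU hp (Complex.continuous_conj.comp (h.contDiff_dbar j).continuous)
    h1 hs

theorem setIntegral_mul_eq {u v : Cn n → ℂ} (hv : tsupport v ⊆ U) :
    ∫ z in U, u z * v z = ∫ z, u z * v z :=
  setIntegral_eq_integral_of_forall_compl_eq_zero fun z hz => by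
    rw [image_eq_zero_of_notMem_tsupport fun h => hz (hv h), mul_zero]

theorem DbarClosedOn.setIntegral_dbar (hU : IsOpen U) {g : Cn n → Fin n → ℂ}
    (hg : ∀ j, ContDiffOn ℝ 1 (fun z => g z j) U) (hgc : DbarClosedOn U g) {ψ : Cn n → ℂ}
    (h : TestC2 U ψ) (j k : Fin n) :
    ∫ z in U, g z j * dbar ψ z k = ∫ z in U, g z k * dbar ψ z j := by
  have h1 : ContDiff ℝ 1 ψ := h.contDiff.of_le (by norm_num)
  rw [setIntegral_mul_eq ((tsupport_dbar_subset ψ k).trans h.tsupport_subset),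
    setIntegral_mul_eq ((tsupport_dbar_subset ψ j).trans h.tsupport_subset),
    integral_mul_dbar hU (hg j) h1 h.hasCompactSupport h.tsupport_subset,
    integral_mul_dbar hU (hg k) h1 h.hasCompactSupport h.tsupport_subset,
    ← setIntegral_mul_eq h.tsupport_subset, ← setIntegral_mul_eq h.tsupport_subset]
  congr 1
  refine setIntegral_congr_fun hU.measurableSet fun z hz => ?_
  rw [hgc z hz j k]

/-- The Hilbert space of square integrable `(0,1)`-forms on `U`. -/
abbrev FormL2 (U : Set (Cn n)) := PiLp 2 fun _ : Fin n => Lp ℂ 2 (volume.restrict U)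

/-- The vectors whose orthogonal complement consists of the weakly `∂̄`-closed forms. -/
def closedTest (U : Set (Cn n)) (p : Cn n → ℝ) : Set (FormL2 U) :=
  {s | ∃ (ψ : Cn n → ℂ) (j k : Fin n)
    (hj : MemLp (weighted (fun z => -p z) fun z => conj (dbar ψ z j)) 2 (volume.restrict U))
    (hk : MemLp (weighted (fun z => -p z) fun z => conj (dbar ψ z k)) 2 (volume.restrict U)),
    TestC2 U ψ ∧ s = WithLp.toLp 2 (Pi.single j (hk.toLp _) - Pi.single k (hj.toLp _))}

theorem inner_single_sub_single (j k : Fin n) (a b : Lp ℂ 2 (volume.restrict U)) (γ : FormL2 U) :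
    inner ℂ (WithLp.toLp 2 (Pi.single j a - Pi.single k b) : FormL2 U) γ =
      inner ℂ a (γ j) - inner ℂ b (γ k) := by
  have h : ∀ (j : Fin n) (a : Lp ℂ 2 (volume.restrict U)),
      ∑ i, inner ℂ ((Pi.single j a : Fin n → Lp ℂ 2 (volume.restrict U)) i) (γ i) =
        inner ℂ a (γ j) := fun j a => by
    rw [Finset.sum_eq_single j (fun i _ hi => by rw [Pi.single_eq_of_ne hi, inner_zero_left])
      (by simp), Pi.single_eq_same]
  rw [PiLp.inner_apply]
  simp only [Pi.sub_apply, inner_sub_left, Finset.sum_sub_distrib, h]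

theorem mem_closedForms_iff (hU : IsOpen U) (hp : ContinuousOn p U) (γ : FormL2 U) :
    γ ∈ (Submodule.span ℂ (closedTest U p))ᗮ ↔ ∀ ψ, TestC2 U ψ → ∀ j k,
      ∫ z in U, weighted (fun z => -p z) (fun z => dbar ψ z k) z * γ j z =
        ∫ z in U, weighted (fun z => -p z) (fun z => dbar ψ z j) z * γ k z := by
  rw [mem_span_orthogonal_iff]
  constructor
  · intro h ψ hψ j k
    have := h _ ⟨ψ, j, k, hψ.memLp_weighted_dbar hU hp j, hψ.memLp_weighted_dbar hU hp k, hψ, rfl⟩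
    rw [inner_single_sub_single, inner_toLp_left, inner_toLp_left, sub_eq_zero] at this
    simpa only [conj_weighted, Complex.conj_conj] using this
  · rintro h s ⟨ψ, j, k, hj, hk, hψ, rfl⟩
    rw [inner_single_sub_single, inner_toLp_left, inner_toLp_left, sub_eq_zero]
    simpa only [conj_weighted, Complex.conj_conj] using h ψ hψ j k

/-- The class of a `(0,1)`-form in the weighted Hilbert space. -/
def formClass (g : Cn n → Fin n → ℂ)
    (h : ∀ j, MemLp (weighted p fun z => g z j) 2 (volume.restrict U)) : FormL2 U :=
  WithLp.toLp 2 fun j => (h j).toLp _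

theorem formClass_mem_closedForms (hU : IsOpen U) (hp : ContinuousOn p U) {g : Cn n → Fin n → ℂ}
    (h : ∀ j, MemLp (weighted p fun z => g z j) 2 (volume.restrict U))
    (hg : ∀ j, ContDiffOn ℝ 1 (fun z => g z j) U) (hgc : DbarClosedOn U g) :
    formClass g h ∈ (Submodule.span ℂ (closedTest U p))ᗮ := by
  rw [mem_closedForms_iff hU hp]
  intro ψ hψ j k
  have e : ∀ j k, ∫ z in U, weighted (fun z => -p z) (fun z => dbar ψ z k) z * formClass g h j z =
      ∫ z in U, g z j * dbar ψ z k := fun j k => by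
    refine integral_congr_ae ?_
    filter_upwards [(h j).coeFn_toLp] with z hz
    rw [show formClass g h j z = _ from hz, mul_comm, weighted_mul_weighted]
  rw [e, e, hgc.setIntegral_dbar hU hg hψ]

theorem integral_eq_setIntegral_indicator (hU : IsOpen U) (f g : Cn n → ℂ) :
    ∫ z, U.indicator f z * g z = ∫ z in U, f z * g z := by
  rw [← integral_indicator hU.measurableSet]
  refine integral_congr_ae (Filter.Eventually.of_forall fun z => ?_)
  by_cases hz : z ∈ U <;> simp [hz]

/-- The form on `ℂⁿ` represented by an element of the weighted Hilbert space. -/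
def unweight (p : Cn n → ℝ) (γ : FormL2 U) (z : Cn n) (j : Fin n) : ℂ :=
  U.indicator (weighted (fun z => -p z) (γ j)) z

theorem norm_unweight_sq (γ : FormL2 U) (z : Cn n) (j : Fin n) :
    ‖unweight p γ z j‖ ^ 2 * Real.exp (-p z) = U.indicator (fun z => ‖γ j z‖ ^ 2) z := by
  by_cases hz : z ∈ U
  · rw [unweight, Set.indicator_of_mem hz, Set.indicator_of_mem hz, ← norm_weighted_sq,
      weighted_weighted]
  · simp [unweight, hz]

theorem weakClosedDiv_of_mem (hU : IsOpen U) (hp : ContinuousOn p U)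
    {ψ : Cn n → Fin n → ℂ} (hψ : ∀ j, TestC2 U fun z => ψ z j) {γ a : FormL2 U}
    (ha : ∀ j, (a j : Cn n → ℂ) =ᵐ[volume.restrict U] weighted (fun z => -p z) fun z => ψ z j)
    (hγ : γ ∈ (Submodule.span ℂ (closedTest U p))ᗮ)
    (haγ : ∀ b ∈ (Submodule.span ℂ (closedTest U p))ᗮ, inner ℂ b γ = inner ℂ b a) :
    WeakClosedDiv U p (unweight p γ) fun z => ∑ j, del (fun z => ψ z j) z j where
  meas j := by
    unfold unweight
    rw [aestronglyMeasurable_indicator_iff hU.measurableSet]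
    exact (Lp.memLp (γ j)).1.mul
      ((continuousOn_ofReal_exp (hp.neg.neg.div_const 2)).aestronglyMeasurable hU.measurableSet)
  int j := by
    simp only [norm_unweight_sq]
    rw [integrable_indicator_iff hU.measurableSet]
    exact (memLp_two_iff_integrable_sq_norm (Lp.memLp (γ j)).1).1 (Lp.memLp (γ j))
  zero z hz j := by simp [unweight, hz]
  closed χ hχ j k := by
    have h := (mem_closedForms_iff hU hp γ).1 hγ χ hχ j k
    unfold unweight
    rw [integral_eq_setIntegral_indicator hU, integral_eq_setIntegral_indicator hU]
    have e : ∀ f g : Cn n → ℂ, ∫ z in U, weighted (fun z => -p z) f z * g z =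
        ∫ z in U, weighted (fun z => -p z) g z * f z := fun f g =>
      integral_congr_ae (Filter.Eventually.of_forall fun z => by simp only [weighted]; ring)
    rwa [e, e (fun z => dbar χ z j)] at h
  div u hu := by
    have hu1 : ContDiff ℝ 1 u := hu.contDiff.of_le (by norm_num)
    have hb : ∀ j, MemLp (weighted p fun z => dbar (fun z => conj (u z)) z j) 2
        (volume.restrict U) := fun j =>
      memLp_weighted hU hp (hu.conj.contDiff_dbar j).continuous.aestronglyMeasurable
        (integrableOn_of_test hU hp.neg (hu.conj.contDiff_dbar j).continuous
          (hasCompactSupport_dbar hu.conj.hasCompactSupport j)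
          ((tsupport_dbar_subset _ j).trans hu.conj.tsupport_subset))
    have h := haγ _ (formClass_mem_closedForms hU hp hb
      (fun j => (hu.conj.contDiff_dbar j).contDiffOn)
      fun z _ j k => dbar_dbar_comm hu.conj.contDiff.contDiffAt j k)
    rw [PiLp.inner_apply, PiLp.inner_apply] at h
    simp only [formClass, inner_toLp_left, conj_weighted, dbar_conj, Complex.conj_conj] at h
    have e1 : ∀ j, ∫ z, unweight p γ z j * (Real.exp (-p z) : ℂ) * del u z j =
        ∫ z in U, weighted p (fun z => del u z j) z * γ j z := fun j => by
      unfold unweight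
      simp only [mul_assoc]
      rw [integral_eq_setIntegral_indicator hU]
      refine integral_congr_ae (Filter.Eventually.of_forall fun z => ?_)
      have := exp_half_mul_exp_half (p z)
      have h2 : (Real.exp (-p z) : ℂ) = (Real.exp (-p z / 2) : ℂ) * (Real.exp (-p z / 2) : ℂ) := by
        rw [← Complex.ofReal_mul, ← Real.exp_add]; ring_nf
      simp only [weighted, h2]
      linear_combination γ j z * (Real.exp (-p z / 2) : ℂ) * del u z j * this
    have e2 : ∀ j, ∫ z in U, weighted p (fun z => del u z j) z * a j z =
        -∫ z, u z * del (fun z => ψ z j) z j := fun j => by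
      rw [integral_mul_del hU hu1.contDiffOn ((hψ j).contDiff.of_le (by norm_num))
        (hψ j).hasCompactSupport (hψ j).tsupport_subset, neg_neg,
        ← setIntegral_mul_eq (hψ j).tsupport_subset]
      refine integral_congr_ae ?_
      filter_upwards [ha j] with z hz
      rw [hz, weighted_mul_weighted]
    simp only [e1, h, e2]
    rw [Finset.sum_neg_distrib, ← integral_finsetSum]
    · congr 1
      refine integral_congr_ae (Filter.Eventually.of_forall fun z => ?_)
      beta_reduce
      rw [← Finset.mul_sum, mul_comm]
    · exact fun j _ => (hu1.continuous.mul ((hψ j).contDiff_del j).continuous).integrable_of_hasCompactSupport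
        hu.hasCompactSupport.mul_right

/-- Duality form of the three weights estimate. -/
theorem three_weights_duality (hU : IsOpen U) {Φ θ : Cn n → ℝ} (hΦ : ContDiffOn ℝ 2 Φ U)
    (hθ : ContDiffOn ℝ 2 θ U) {c A : ℝ} (hc : 0 ≤ c)
    (hL : ∀ z ∈ U, ∀ w : Cn n, (3 * ∑ j, ‖dbar (fun z => (θ z : ℂ)) z j‖ ^ 2 +
      c * Real.exp (θ z)) * ‖w‖ ^ 2 ≤ LeviForm Φ z w)
    {χ : ℕ → Cn n → ℝ} (hχ : ∀ m, ContDiff ℝ 2 (χ m)) (hχc : ∀ m, HasCompactSupport (χ m))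
    (hχU : ∀ m, tsupport (χ m) ⊆ U) (hχI : ∀ m z, χ m z ∈ Icc (0 : ℝ) 1)
    (hχA : ∀ m, ∀ z ∈ U, ∑ j, ‖dbar (fun z => (χ m z : ℂ)) z j‖ ^ 2 ≤ A * Real.exp (θ z))
    (hχ1 : ∀ z ∈ U, ∀ᶠ m in Filter.atTop, χ m z = 1 ∧ ∀ j, dbar (fun z => (χ m z : ℂ)) z j = 0)
    {g : Cn n → Fin n → ℂ} (hg : ∀ j, ContDiffOn ℝ 1 (fun z => g z j) U) (hgc : DbarClosedOn U g)
    (hgi : ∀ j, IntegrableOn (fun z => ‖g z j‖ ^ 2 * Real.exp (-(Φ z - θ z))) U volume)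
    {ψ : Cn n → Fin n → ℂ} (hψ : ∀ j, TestC2 U fun z => ψ z j) :
    c * ‖∑ j, ∫ z in U, g z j * conj (ψ z j)‖ ^ 2 ≤
      3 * (∫ z, ‖∑ j, del (fun z => ψ z j) z j‖ ^ 2 * Real.exp (Φ z - 2 * θ z)) *
        ∑ j, ∫ z in U, ‖g z j‖ ^ 2 * Real.exp (-(Φ z - θ z)) := by
  set p : Cn n → ℝ := fun z => Φ z - θ z with hpdef
  have hp : ContinuousOn p U := hΦ.continuousOn.sub hθ.continuousOn
  have hψm : ∀ j, MemLp (weighted (fun z => -p z) fun z => ψ z j) 2 (volume.restrict U) :=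
    fun j => memLp_weighted_neg_test hU hp (hψ j).contDiff.continuous (hψ j).hasCompactSupport
      (hψ j).tsupport_subset
  set a : FormL2 U := WithLp.toLp 2 fun j => (hψm j).toLp _ with ha
  obtain ⟨γ, hγN, haγ⟩ := exists_mem_orthogonal_inner_eq (Submodule.span ℂ (closedTest U p)) a
  have hW := weakClosedDiv_of_mem hU hp hψ (fun j => (hψm j).coeFn_toLp) hγN haγ
  set w : Cn n → ℂ := fun z => ∑ j, del (fun z => ψ z j) z j with hw
  have hwc : Continuous w := continuous_finsetSum _ fun j _ => ((hψ j).contDiff_del j).continuous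
  have hwi : Integrable fun z => ‖w z‖ ^ 2 * Real.exp (Φ z - 2 * θ z) := by
    have hs : ∀ z ∉ U, w z = 0 := fun z hz => Finset.sum_eq_zero fun j _ =>
      image_eq_zero_of_notMem_tsupport (f := fun z' => del (fun z => ψ z j) z' j)
        fun h => hz ((hψ j).tsupport_subset (tsupport_del_subset _ j h))
    have hm : ∀ j, MemLp (weighted (fun z => -(Φ z - 2 * θ z))
        fun z' => del (fun z => ψ z j) z' j) 2 (volume.restrict U) := fun j =>
      memLp_weighted_neg_test hU (hΦ.continuousOn.sub (hθ.continuousOn.const_mul 2))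
        ((hψ j).contDiff_del j).continuous (hasCompactSupport_del (hψ j).hasCompactSupport j)
        ((tsupport_del_subset _ j).trans (hψ j).tsupport_subset)
    have hm2 : MemLp (fun z => ∑ j, weighted (fun z => -(Φ z - 2 * θ z))
        (fun z' => del (fun z => ψ z j) z' j) z) 2 (volume.restrict U) :=
      memLp_finsetSum _ fun j _ => hm j
    have h2 := (integrable_indicator_iff hU.measurableSet).2
      ((memLp_two_iff_integrable_sq_norm hm2.1).1 hm2)
    refine h2.congr (Filter.Eventually.of_forall fun z => ?_)
    by_cases hz : z ∈ U
    · rw [Set.indicator_of_mem hz]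
      have e : ∑ j, weighted (fun z => -(Φ z - 2 * θ z)) (fun z' => del (fun z => ψ z j) z' j) z =
          weighted (fun z => -(Φ z - 2 * θ z)) w z := by
        simp only [weighted, hw, Finset.sum_mul]
      rw [e, norm_weighted_sq, neg_neg]
    · beta_reduce
      rw [Set.indicator_of_notMem hz, hs z hz]
      simp
  have hest := hW.estimate hU hΦ hθ hL hwc hwi hχ hχc hχU hχI hχA hχ1
  have hgm : ∀ j, MemLp (weighted p fun z => g z j) 2 (volume.restrict U) := fun j =>
    memLp_weighted hU hp ((hg j).continuousOn.aestronglyMeasurable hU.measurableSet) (hgi j)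
  have hγn : ∫ z, ∑ j, ‖unweight p γ z j‖ ^ 2 * Real.exp (-(Φ z - θ z)) = ‖γ‖ ^ 2 := by
    rw [integral_finsetSum _ fun j _ => hW.int j, PiLp.norm_sq_eq_of_L2]
    refine Finset.sum_congr rfl fun j _ => ?_
    rw [norm_sq_eq_integral, ← integral_indicator hU.measurableSet]
    exact integral_congr_ae (Filter.Eventually.of_forall fun z => norm_unweight_sq γ z j)
  have hgn : ∑ j, ∫ z in U, ‖g z j‖ ^ 2 * Real.exp (-(Φ z - θ z)) = ‖formClass g hgm‖ ^ 2 := by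
    rw [PiLp.norm_sq_eq_of_L2]
    refine Finset.sum_congr rfl fun j _ => ?_
    rw [formClass, norm_sq_toLp]
    simp only [norm_weighted_sq, hpdef]
  have hin : ∑ j, ∫ z in U, g z j * conj (ψ z j) = inner ℂ a (formClass g hgm) := by
    rw [PiLp.inner_apply]
    refine Finset.sum_congr rfl fun j _ => ?_
    rw [formClass, ha, inner_toLp_toLp]
    refine integral_congr_ae (Filter.Eventually.of_forall fun z => ?_)
    beta_reduce
    rw [conj_weighted, mul_comm (weighted _ _ z), weighted_mul_weighted]
  have hin2 : inner ℂ a (formClass g hgm) = inner ℂ γ (formClass g hgm) := by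
    have := haγ _ (formClass_mem_closedForms hU hp hgm hg hgc)
    rw [← inner_conj_symm, ← this, inner_conj_symm]
  rw [hγn] at hest
  rw [hgn, hin, hin2]
  have h1 := norm_inner_le_norm (𝕜 := ℂ) γ (formClass g hgm)
  calc c * ‖inner ℂ γ (formClass g hgm)‖ ^ 2 ≤ c * (‖γ‖ * ‖formClass g hgm‖) ^ 2 := by gcongr
    _ = (c * ‖γ‖ ^ 2) * ‖formClass g hgm‖ ^ 2 := by ring
    _ ≤ _ := by gcongr

end Duality

section Weights

theorem leviForm_add {f g : Cn n → ℝ} {z : Cn n} (hf : ContDiffAt ℝ 2 f z)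
    (hg : ContDiffAt ℝ 2 g z) (w : Cn n) :
    LeviForm (fun z => f z + g z) z w = LeviForm f z w + LeviForm g z w := by
  have h1 : fderiv ℝ (fun z => f z + g z) =ᶠ[nhds z] fun y => fderiv ℝ f y + fderiv ℝ g y := by
    filter_upwards [hf.eventually (by simp), hg.eventually (by simp)] with y h1 h2
    exact fderiv_fun_add (h1.differentiableAt two_ne_zero) (h2.differentiableAt two_ne_zero)
  have h2 : fderiv ℝ (fderiv ℝ fun z => f z + g z) z =
      fderiv ℝ (fderiv ℝ f) z + fderiv ℝ (fderiv ℝ g) z := by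
    rw [h1.fderiv_eq]
    exact fderiv_fun_add ((hf.fderiv_right (m := 1) (by norm_num)).differentiableAt one_ne_zero)
      ((hg.fderiv_right (m := 1) (by norm_num)).differentiableAt one_ne_zero)
  simp only [LeviForm, h2, add_apply]
  ring

theorem leviForm_const_mul {f : Cn n → ℝ} {z : Cn n} (hf : ContDiffAt ℝ 2 f z) (c : ℝ) (w : Cn n) :
    LeviForm (fun z => c * f z) z w = c * LeviForm f z w := by
  have h1 : fderiv ℝ (fun z => c * f z) =ᶠ[nhds z] fun y => c • fderiv ℝ f y := by
    filter_upwards [hf.eventually (by simp)] with y h1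
    exact fderiv_const_mul (h1.differentiableAt two_ne_zero) c
  have h2 : fderiv ℝ (fderiv ℝ fun z => c * f z) z = c • fderiv ℝ (fderiv ℝ f) z := by
    rw [h1.fderiv_eq]
    exact fderiv_fun_const_smul
      ((hf.fderiv_right (m := 1) (by norm_num)).differentiableAt one_ne_zero) c
  simp only [LeviForm, h2, smul_apply, smul_eq_mul]
  ring

theorem le_leviForm_comp {F F' : ℝ → ℝ} {F'' : ℝ} {σ : Cn n → ℝ} {z : Cn n}
    (hσ : ContDiffAt ℝ 2 σ z) (hF : ∀ᶠ t in nhds (σ z), HasDerivAt F (F' t) t)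
    (hF' : HasDerivAt F' F'' (σ z)) (h0 : 0 ≤ F'') (w : Cn n) :
    F' (σ z) * LeviForm σ z w ≤ LeviForm (fun z => F (σ z)) z w := by
  have h1 : fderiv ℝ (fun z => F (σ z)) =ᶠ[nhds z] fun y => F' (σ y) • fderiv ℝ σ y := by
    filter_upwards [hσ.eventually (by simp), hσ.continuousAt.eventually hF] with y h1 h2
    exact (h2.comp_hasFDerivAt y (h1.differentiableAt two_ne_zero).hasFDerivAt).fderiv
  have h2 : ∀ a, fderiv ℝ (fderiv ℝ fun z => F (σ z)) z a a =
      F' (σ z) * fderiv ℝ (fderiv ℝ σ) z a a + F'' * (fderiv ℝ σ z a) ^ 2 := fun a => by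
    have h3 := hF'.comp_hasFDerivAt z (hσ.differentiableAt two_ne_zero).hasFDerivAt
    have h4 := ((hσ.fderiv_right (m := 1) (by norm_num)).differentiableAt one_ne_zero).hasFDerivAt
    rw [h1.fderiv_eq, show fderiv ℝ (fun y => F' (σ y) • fderiv ℝ σ y) z = _ from
      (h3.smul h4).fderiv]
    simp
    ring
  simp only [LeviForm, h2]
  have h5 := mul_nonneg h0 (sq_nonneg (fderiv ℝ σ z w))
  have h6 := mul_nonneg h0 (sq_nonneg (fderiv ℝ σ z (I • w)))
  linarith

theorem leviForm_norm_sub_sq (x z w : Cn n) : LeviForm (fun z => ‖z - x‖ ^ 2) z w = ‖w‖ ^ 2 := by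
  have h1 : fderiv ℝ (fun z : Cn n => ‖z - x‖ ^ 2) = fun z => (2 : ℝ) • innerSL ℝ (z - x) := by
    ext1 y
    exact ((hasFDerivAt_id y).sub_const x).norm_sq.fderiv.trans (by ext; simp)
  have h2 : ∀ a, fderiv ℝ (fun z : Cn n => (2 : ℝ) • innerSL ℝ (z - x)) z a a = 2 * ‖a‖ ^ 2 := by
    intro a
    have := (((innerSL ℝ : Cn n →L[ℝ] _).hasFDerivAt.comp z
      ((hasFDerivAt_id z).sub_const x)).const_smul (2 : ℝ)).fderiv
    rw [show fderiv ℝ (fun z : Cn n => (2 : ℝ) • innerSL ℝ (z - x)) z = _ from this]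
    simp
    exact real_inner_self_eq_norm_sq a
  simp only [LeviForm, h1, h2, norm_smul, Complex.norm_I]
  ring

/-- A strictly plurisubharmonic exhaustion function. -/
theorem Pseudoconvex.exists_exhaustion {Ω : Set (Cn n)} (hΩ : IsOpen Ω) (h : Pseudoconvex Ω) :
    ∃ σ : Cn n → ℝ, ContDiffOn ℝ 2 σ Ω ∧ (∀ c : ℝ, IsCompact {z ∈ Ω | σ z ≤ c}) ∧
      ∀ z ∈ Ω, ∀ w : Cn n, ‖w‖ ^ 2 ≤ LeviForm σ z w := by
  obtain ⟨ρ, hρ, hc, hL⟩ := h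
  have hn : ContDiff ℝ 2 fun z : Cn n => ‖z - 0‖ ^ 2 := (contDiff_id.sub contDiff_const).norm_sq ℝ
  have hσ : ContDiffOn ℝ 2 (fun z => ρ z + ‖z - 0‖ ^ 2) Ω := hρ.add hn.contDiffOn
  refine ⟨fun z => ρ z + ‖z - 0‖ ^ 2, hσ, fun c => ?_, fun z hz w => ?_⟩
  · have h1 := (hσ.continuousOn.mono (sep_subset Ω fun z => ρ z ≤ c)).preimage_isClosed_of_isClosed
      (hc c).isClosed (isClosed_Iic (a := c))
    convert (hc c).of_isClosed_subset h1 inter_subset_left using 1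
    ext z
    simp only [mem_ofPred_eq, mem_inter_iff, mem_preimage, mem_Iic]
    constructor
    · rintro ⟨h1, h2⟩
      exact ⟨⟨h1, by nlinarith [sq_nonneg ‖z - 0‖]⟩, h2⟩
    · rintro ⟨⟨h1, -⟩, h2⟩
      exact ⟨h1, h2⟩
  · rw [leviForm_add (hρ.contDiffAt (hΩ.mem_nhds hz)) hn.contDiffAt, leviForm_norm_sub_sq]
    linarith [hL z hz w]

/-- A smooth cutoff profile. -/
theorem exists_cutoff_profile : ∃ (X : ℝ → ℝ) (B : ℝ), ContDiff ℝ 2 X ∧ (∀ t, X t ∈ Icc (0 : ℝ) 1) ∧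
    (∀ t ≤ 1, X t = 0) ∧ (∀ t, 2 ≤ t → X t = 1) ∧ (∀ t, |deriv X t| ≤ B) ∧
    (∀ t, 2 < t → deriv X t = 0) := by
  have hX : ContDiff ℝ 2 fun t : ℝ => Real.smoothTransition (t - 1) :=
    (Real.smoothTransition.contDiff (n := 2)).comp (contDiff_id.sub contDiff_const)
  have h0 : ∀ t : ℝ, t ≤ 1 → Real.smoothTransition (t - 1) = 0 := fun t ht =>
    Real.smoothTransition.zero_of_nonpos (by linarith)
  have h1 : ∀ t : ℝ, 2 ≤ t → Real.smoothTransition (t - 1) = 1 := fun t ht =>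
    Real.smoothTransition.one_of_one_le (by linarith)
  have d1 : ∀ t : ℝ, 2 < t → deriv (fun t : ℝ => Real.smoothTransition (t - 1)) t = 0 :=
    fun t ht => by
      have : (fun t : ℝ => Real.smoothTransition (t - 1)) =ᶠ[nhds t] fun _ => 1 := by
        filter_upwards [Ioi_mem_nhds ht] with s hs using h1 s (le_of_lt hs)
      rw [this.deriv_eq, deriv_const]
  have d0 : ∀ t : ℝ, t < 1 → deriv (fun t : ℝ => Real.smoothTransition (t - 1)) t = 0 :=
    fun t ht => by
      have : (fun t : ℝ => Real.smoothTransition (t - 1)) =ᶠ[nhds t] fun _ => 0 := by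
        filter_upwards [Iio_mem_nhds ht] with s hs using h0 s (le_of_lt hs)
      rw [this.deriv_eq, deriv_const]
  obtain ⟨B, hB⟩ := (isCompact_Icc (a := (1 : ℝ)) (b := 2)).exists_bound_of_continuousOn
    (hX.continuous_deriv (by norm_num)).continuousOn
  refine ⟨_, max B 0, hX, fun t => ⟨Real.smoothTransition.nonneg _, Real.smoothTransition.le_one _⟩,
    h0, h1, fun t => ?_, d1⟩
  rcases lt_or_ge t 1 with h | h
  · simp [d0 t h]
  · rcases lt_or_ge 2 t with h' | h'
    · simp [d1 t h']
    · exact (hB t ⟨h, h'⟩).trans (le_max_left _ _)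

/-- Cutoff functions exhausting a sublevel set, with controlled gradient. -/
theorem exists_cutoff_sequence {Ω : Set (Cn n)} (hΩ : IsOpen Ω) {σ : Cn n → ℝ}
    (hσ : ContDiffOn ℝ 2 σ Ω) (hc : ∀ c : ℝ, IsCompact {z ∈ Ω | σ z ≤ c}) {c₀ D : ℝ}
    (hD : ∀ z ∈ Ω, σ z < c₀ → ∑ j, ‖dbar (fun z => (σ z : ℂ)) z j‖ ^ 2 ≤ D) :
    ∃ (A : ℝ) (χ : ℕ → Cn n → ℝ), 0 ≤ A ∧ (∀ m, ContDiff ℝ 2 (χ m)) ∧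
      (∀ m, HasCompactSupport (χ m)) ∧ (∀ m, tsupport (χ m) ⊆ {z ∈ Ω | σ z < c₀}) ∧
      (∀ m z, χ m z ∈ Icc (0 : ℝ) 1) ∧
      (∀ m, ∀ z ∈ {z ∈ Ω | σ z < c₀}, ∑ j, ‖dbar (fun z => (χ m z : ℂ)) z j‖ ^ 2 ≤
        A * (1 / (c₀ - σ z)) ^ 2) ∧
      ∀ z ∈ {z ∈ Ω | σ z < c₀}, ∀ᶠ m in Filter.atTop,
        χ m z = 1 ∧ ∀ j, dbar (fun z => (χ m z : ℂ)) z j = 0 := by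
  obtain ⟨X, B, hX, hXI, hX0, hX1, hXB, hXd⟩ := exists_cutoff_profile
  set U : Set (Cn n) := {z ∈ Ω | σ z < c₀} with hUdef
  have hU : IsOpen U := hσ.continuousOn.isOpen_inter_preimage hΩ isOpen_Iio
  set χ : ℕ → Cn n → ℝ := fun m => U.indicator fun z => X ((m + 1 : ℝ) * (c₀ - σ z)) with hχ
  have hsupp : ∀ m, Function.support (χ m) ⊆ {z ∈ Ω | σ z ≤ c₀ - 1 / (m + 1 : ℝ)} := fun m z hz => by
    have hm : (0 : ℝ) < m + 1 := by positivity
    have hzU : z ∈ U := by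
      by_contra h
      exact hz (Set.indicator_of_notMem h _)
    refine ⟨hzU.1, ?_⟩
    by_contra! h
    refine hz ?_
    simp only [hχ, Set.indicator_of_mem hzU]
    refine hX0 _ ?_
    have : c₀ - σ z ≤ 1 / (m + 1) := by linarith
    calc (m + 1 : ℝ) * (c₀ - σ z) ≤ (m + 1) * (1 / (m + 1)) := by gcongr
      _ = 1 := by field_simp
  have hts : ∀ m, tsupport (χ m) ⊆ {z ∈ Ω | σ z ≤ c₀ - 1 / (m + 1 : ℝ)} := fun m =>
    closure_minimal (hsupp m) (hc _).isClosed
  have htU : ∀ m, tsupport (χ m) ⊆ U := fun m z hz => by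
    have h1 := hts m hz
    have hm : (0 : ℝ) < 1 / (m + 1) := by positivity
    exact ⟨h1.1, by linarith [h1.2]⟩
  have hσU : ContDiffOn ℝ 2 σ U := hσ.mono fun z hz => hz.1
  have hdb : ∀ m, ∀ z ∈ U, ∀ j, dbar (fun z => (χ m z : ℂ)) z j =
      ((deriv X ((m + 1 : ℝ) * (c₀ - σ z)) * -(m + 1 : ℝ) : ℝ) : ℂ) *
        dbar (fun z => (σ z : ℂ)) z j := fun m z hz j => by
    have he : (fun z => (χ m z : ℂ)) =ᶠ[nhds z] fun z => (X ((m + 1 : ℝ) * (c₀ - σ z)) : ℂ) := by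
      filter_upwards [hU.mem_nhds hz] with y hy
      simp only [hχ, Set.indicator_of_mem hy]
    rw [dbar_congr he]
    have h1 : HasDerivAt X (deriv X ((m + 1 : ℝ) * (c₀ - σ z))) ((m + 1 : ℝ) * (c₀ - σ z)) :=
      (hX.differentiable two_ne_zero _).hasDerivAt
    have h2 : HasDerivAt (fun t : ℝ => (m + 1 : ℝ) * (c₀ - t)) (-(m + 1 : ℝ)) (σ z) := by
      have := ((hasDerivAt_id (σ z)).const_sub c₀).const_mul (m + 1 : ℝ)
      simpa using this
    exact dbar_real_comp ((hσU.contDiffAt (hU.mem_nhds hz)).differentiableAt two_ne_zero)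
      (h1.comp (σ z) h2)
  refine ⟨4 * B ^ 2 * max D 0, χ, by positivity, fun m => ?_, fun m => ?_, htU, fun m z => ?_,
    fun m z hz => ?_, fun z hz => ?_⟩
  · refine ContDiffOn.contDiff_of_support hU (ContDiffOn.congr (f := fun z =>
      X ((m + 1 : ℝ) * (c₀ - σ z))) ?_ fun z hz => Set.indicator_of_mem hz _) (htU m)
    exact hX.comp_contDiffOn (contDiffOn_const.mul (contDiffOn_const.sub hσU))
  · exact (hc _).of_isClosed_subset (isClosed_tsupport _) (hts m)
  · by_cases hz : z ∈ U
    · simp only [hχ, Set.indicator_of_mem hz]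
      exact hXI _
    · simp [hχ, hz]
  · have hq : 0 < c₀ - σ z := by linarith [hz.2]
    simp only [hdb m z hz, norm_mul, mul_pow, ← Finset.mul_sum]
    rw [Complex.norm_real, Real.norm_eq_abs, sq_abs]
    have h1 : (deriv X ((m + 1 : ℝ) * (c₀ - σ z)) * -(m + 1 : ℝ)) ^ 2 ≤
        4 * B ^ 2 * (1 / (c₀ - σ z)) ^ 2 := by
      rcases lt_or_ge 2 ((m + 1 : ℝ) * (c₀ - σ z)) with h | h
      · rw [hXd _ h]
        rw [zero_mul, zero_pow two_ne_zero]
        positivity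
      · have h2 : (m + 1 : ℝ) ≤ 2 * (1 / (c₀ - σ z)) := by
          rw [mul_one_div, le_div_iff₀ hq]
          exact h
        have h3 : deriv X ((m + 1 : ℝ) * (c₀ - σ z)) ^ 2 ≤ B ^ 2 :=
          sq_le_sq' (by linarith [abs_le.1 (hXB ((m + 1 : ℝ) * (c₀ - σ z)))])
            (abs_le.1 (hXB ((m + 1 : ℝ) * (c₀ - σ z)))).2
        calc _ = deriv X ((m + 1 : ℝ) * (c₀ - σ z)) ^ 2 * (m + 1 : ℝ) ^ 2 := by ring
          _ ≤ B ^ 2 * (2 * (1 / (c₀ - σ z))) ^ 2 := by gcongr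
          _ = _ := by ring
    calc _ ≤ 4 * B ^ 2 * (1 / (c₀ - σ z)) ^ 2 * max D 0 :=
          mul_le_mul h1 ((hD z hz.1 hz.2).trans (le_max_left _ _)) (by positivity) (by positivity)
      _ = _ := by ring
  · have hq : 0 < c₀ - σ z := by linarith [hz.2]
    obtain ⟨m₀, hm₀⟩ := exists_nat_gt (2 / (c₀ - σ z))
    filter_upwards [Filter.eventually_ge_atTop m₀] with m hm
    have h1 : 2 < (m + 1 : ℝ) * (c₀ - σ z) := by
      rw [← div_lt_iff₀ hq]
      have : (m₀ : ℝ) ≤ m := by exact_mod_cast hm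
      linarith
    refine ⟨?_, fun j => ?_⟩
    · simp only [hχ, Set.indicator_of_mem hz]
      exact hX1 _ h1.le
    · rw [hdb m z hz, hXd _ h1]
      simp

end Weights

section SublevelWeights

theorem hasDerivAt_cubeWeight {c₀ t : ℝ} (m : ℕ) (ht : t < c₀) :
    HasDerivAt (fun t => (1 / (c₀ - t)) ^ m) (m * (1 / (c₀ - t)) ^ (m + 1)) t := by
  have h0 : 0 < c₀ - t := by linarith
  have h1 : HasDerivAt (fun t => c₀ - t) (-1) t := (hasDerivAt_id t).const_sub c₀
  have h2 := (h1.fun_inv h0.ne').fun_pow m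
  simp only [one_div]
  refine h2.congr_deriv ?_
  rcases m with _ | m
  · simp
  · simp only [Nat.add_sub_cancel, div_eq_mul_inv, ← inv_pow]
    ring

/-- The derivative of the logarithmic term `2 log (1 + ε / (c₀ - t))` in the weights. -/
theorem hasDerivAt_logWeight {c₀ ε t : ℝ} (hε : 0 < ε) (ht : t < c₀) :
    HasDerivAt (fun t => 2 * Real.log (1 + ε * (1 / (c₀ - t))))
      (2 * (ε * (1 / (c₀ - t)) ^ 2 / (1 + ε * (1 / (c₀ - t))))) t := by
  have h0 : 0 < c₀ - t := by linarith
  have h1 := hasDerivAt_cubeWeight 1 ht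
  simp only [pow_one, Nat.cast_one, one_mul] at h1
  have hp : 0 < 1 + ε * (1 / (c₀ - t)) := by positivity
  exact (((h1.const_mul ε).const_add 1).log hp.ne').const_mul 2

theorem two_log_le {A ε q R : ℝ} (hε : 0 < ε) (hq : 0 < q) (hR : 1 ≤ R * q) (hA : 2 * R ^ 2 ≤ A) :
    2 * Real.log (1 + ε * q) ≤ ε * A * q ^ 3 := by
  have h1 : Real.log (1 + ε * q) ≤ ε * q := by
    have := Real.log_le_sub_one_of_pos (x := 1 + ε * q) (by positivity)
    linarith
  have h2 : 1 ≤ (R * q) ^ 2 := one_le_pow₀ hR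
  have h3 : 2 ≤ A * q ^ 2 := by nlinarith [sq_nonneg q]
  have h4 : ε * q * 2 ≤ ε * q * (A * q ^ 2) := by gcongr
  linarith

theorem weight_inequality {A D c ε q R : ℝ} (hc : 0 ≤ c) (hε : 0 < ε) (hε1 : ε ≤ 1) (hq : 0 < q)
    (hR : 1 ≤ R * q) (hD : 0 ≤ D) (hA : 12 * D + c * (2 * R ^ 3 + R ^ 2) ≤ 3 * A) :
    3 * ((2 * (ε * q ^ 2 / (1 + ε * q))) ^ 2 * D) + c * (1 + ε * q) ^ 2 ≤
      c + ε * A * (3 * q ^ 4) := by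
  have h1 : ε * q ^ 2 / (1 + ε * q) ≤ ε * q ^ 2 :=
    div_le_self (by positivity) (by nlinarith)
  have h2 : (2 * (ε * q ^ 2 / (1 + ε * q))) ^ 2 ≤ 4 * ε * q ^ 4 := by
    calc (2 * (ε * q ^ 2 / (1 + ε * q))) ^ 2 ≤ (2 * (ε * q ^ 2)) ^ 2 := by gcongr
      _ = 4 * ε * q ^ 4 * ε := by ring
      _ ≤ 4 * ε * q ^ 4 * 1 := by gcongr
      _ = _ := by ring
  have h3 : 1 ≤ (R * q) ^ 3 := one_le_pow₀ hR
  have h4 : 1 ≤ (R * q) ^ 2 := one_le_pow₀ hR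
  have h5 : 2 * q + q ^ 2 ≤ (2 * R ^ 3 + R ^ 2) * q ^ 4 := by
    have a1 := mul_le_mul_of_nonneg_left h3 hq.le
    have a2 := mul_le_mul_of_nonneg_left h4 (sq_nonneg q)
    nlinarith
  have h6 : c * (1 + ε * q) ^ 2 ≤ c + ε * (c * (2 * q + q ^ 2)) := by
    have : ε * (ε * q ^ 2) ≤ ε * (1 * q ^ 2) := by gcongr
    nlinarith [mul_le_mul_of_nonneg_left this hc]
  have h7 : 3 * ((2 * (ε * q ^ 2 / (1 + ε * q))) ^ 2 * D) ≤ 3 * (4 * ε * q ^ 4 * D) := by gcongr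
  have h8 : ε * (c * (2 * q + q ^ 2)) ≤ ε * (c * ((2 * R ^ 3 + R ^ 2) * q ^ 4)) := by gcongr
  have h9 : ε * q ^ 4 * (12 * D + c * (2 * R ^ 3 + R ^ 2)) ≤ ε * q ^ 4 * (3 * A) := by gcongr
  linarith

/-- Duality estimate on a sublevel set, with weights depending on a parameter `ε`. -/
theorem sublevel_duality {Ω : Set (Cn n)} (hΩ : IsOpen Ω) {σ Ψ : Cn n → ℝ}
    (hσ : ContDiffOn ℝ 2 σ Ω) (hσc : ∀ c : ℝ, IsCompact {z ∈ Ω | σ z ≤ c})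
    (hσL : ∀ z ∈ Ω, ∀ w : Cn n, ‖w‖ ^ 2 ≤ LeviForm σ z w)
    (hΨ : ContDiffOn ℝ 2 Ψ Ω) {c : ℝ} (hc : 0 ≤ c)
    (hL : ∀ z ∈ Ω, ∀ w : Cn n, c * ‖w‖ ^ 2 ≤ LeviForm Ψ z w) {c₀ D R A ε : ℝ}
    (hD0 : 0 ≤ D) (hD : ∀ z ∈ Ω, σ z < c₀ → ∑ j, ‖dbar (fun z => (σ z : ℂ)) z j‖ ^ 2 ≤ D)
    (hR : ∀ z ∈ Ω, σ z < c₀ → c₀ - σ z ≤ R)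
    (hA : 12 * D + c * (2 * R ^ 3 + R ^ 2) ≤ 3 * A) (hA2 : 2 * R ^ 2 ≤ A) (hε : 0 < ε)
    (hε1 : ε ≤ 1) {g : Cn n → Fin n → ℂ} (hg : ∀ j, ContDiffOn ℝ 1 (fun z => g z j) Ω)
    (hgc : DbarClosedOn Ω g)
    (hgi : ∀ j, IntegrableOn (fun z => ‖g z j‖ ^ 2 * Real.exp (-Ψ z)) Ω volume)
    {ψ : Cn n → Fin n → ℂ} (hψ : ∀ j, TestC2 Ω fun z => ψ z j)
    (hψs : ∀ j, ∀ z ∈ tsupport (fun z => ψ z j), σ z ≤ c₀ - 1) :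
    c * ‖∑ j, ∫ z in Ω, g z j * conj (ψ z j)‖ ^ 2 ≤
      3 * (Real.exp (ε * A) *
        ∫ z, ‖∑ j, del (fun z => ψ z j) z j‖ ^ 2 * Real.exp (Ψ z)) *
        ∑ j, ∫ z in Ω, ‖g z j‖ ^ 2 * Real.exp (-Ψ z) := by
  obtain ⟨B, χ, hB0, hχ, hχc, hχU, hχI, hχB, hχ1⟩ := exists_cutoff_sequence hΩ hσ hσc hD
  set U : Set (Cn n) := {z ∈ Ω | σ z < c₀} with hUdef
  have hU : IsOpen U := hσ.continuousOn.isOpen_inter_preimage hΩ isOpen_Iio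
  have hUΩ : U ⊆ Ω := fun z hz => hz.1
  have hA0 : 0 ≤ A := le_trans (by positivity) hA2
  set q : Cn n → ℝ := fun z => 1 / (c₀ - σ z) with hq
  have hqpos : ∀ z ∈ U, 0 < q z := fun z hz => one_div_pos.2 (sub_pos.2 hz.2)
  have hRq : ∀ z ∈ U, 1 ≤ R * q z := fun z hz => by
    have h0 : 0 < c₀ - σ z := sub_pos.2 hz.2
    rw [hq]; dsimp only
    rw [mul_one_div, one_le_div h0]
    exact hR z hz.1 hz.2
  have hqC : ContDiffOn ℝ 2 q U :=
    contDiffOn_const.div (contDiffOn_const.sub (hσ.mono hUΩ)) fun z hz => (sub_pos.2 hz.2).ne'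
  set θ : Cn n → ℝ := fun z => 2 * Real.log (1 + ε * q z) with hθ
  set Φ : Cn n → ℝ := fun z => Ψ z + ε * A * q z ^ 3 with hΦ
  have hpos : ∀ z ∈ U, 0 < 1 + ε * q z := fun z hz => by have := hqpos z hz; positivity
  have hθC : ContDiffOn ℝ 2 θ U :=
    contDiffOn_const.mul ((contDiffOn_const.add (contDiffOn_const.mul hqC)).log
      fun z hz => (hpos z hz).ne')
  have hΦC : ContDiffOn ℝ 2 Φ U := (hΨ.mono hUΩ).add (contDiffOn_const.mul (hqC.pow 3))
  have hexpθ : ∀ z ∈ U, Real.exp (θ z) = (1 + ε * q z) ^ 2 := fun z hz => by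
    rw [hθ]; dsimp only
    rw [two_mul, Real.exp_add, Real.exp_log (hpos z hz), sq]
  have hσat : ∀ z ∈ U, ContDiffAt ℝ 2 σ z := fun z hz => hσ.contDiffAt (hΩ.mem_nhds hz.1)
  have hdθ : ∀ z ∈ U, ∑ j, ‖dbar (fun z => (θ z : ℂ)) z j‖ ^ 2 ≤
      (2 * (ε * q z ^ 2 / (1 + ε * q z))) ^ 2 * D := fun z hz => by
    have h1 : ∀ j, dbar (fun z => (θ z : ℂ)) z j =
        ((2 * (ε * q z ^ 2 / (1 + ε * q z)) : ℝ) : ℂ) * dbar (fun z => (σ z : ℂ)) z j := fun j =>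
      dbar_real_comp ((hσat z hz).differentiableAt two_ne_zero) (hasDerivAt_logWeight hε hz.2)
    simp only [h1, norm_mul, mul_pow, ← Finset.mul_sum, Complex.norm_real, Real.norm_eq_abs,
      sq_abs]
    gcongr
    · exact hD z hz.1 hz.2
  have hLΦ : ∀ z ∈ U, ∀ w : Cn n,
      (c + ε * A * (3 * q z ^ 4)) * ‖w‖ ^ 2 ≤ LeviForm Φ z w := fun z hz w => by
    have h1 : ContDiffAt ℝ 2 (fun z => q z ^ 3) z := (hqC.pow 3).contDiffAt (hU.mem_nhds hz)
    have h2 : 3 * q z ^ 4 * LeviForm σ z w ≤ LeviForm (fun z => q z ^ 3) z w := by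
      refine le_leviForm_comp (F := fun t => (1 / (c₀ - t)) ^ 3)
        (F' := fun t => 3 * (1 / (c₀ - t)) ^ 4) (F'' := 3 * (4 * q z ^ 5)) (hσat z hz) ?_ ?_ ?_ w
      · filter_upwards [Iio_mem_nhds hz.2] with t ht
        simpa using hasDerivAt_cubeWeight 3 ht
      · exact (hasDerivAt_cubeWeight 4 hz.2).const_mul 3
      · have := hqpos z hz
        positivity
    rw [hΦ, leviForm_add (hΨ.contDiffAt (hΩ.mem_nhds hz.1)) (contDiffAt_const.mul h1),
      leviForm_const_mul h1, add_mul, mul_assoc (ε * A)]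
    gcongr
    · exact hL z hz.1 w
    · refine le_trans ?_ h2
      gcongr
      · exact hσL z hz.1 w
  have hψU : ∀ j, tsupport (fun z => ψ z j) ⊆ U := fun j z hz =>
    ⟨(hψ j).tsupport_subset hz, by linarith [hψs j z hz]⟩
  have hθΦ : ∀ z ∈ U, Real.exp (-(Φ z - θ z)) ≤ Real.exp (-Ψ z) := fun z hz => by
    rw [Real.exp_le_exp, hΦ]
    have := two_log_le hε (hqpos z hz) (hRq z hz) hA2
    simp only [hθ]
    linarith
  have hgi' : ∀ j, IntegrableOn (fun z => ‖g z j‖ ^ 2 * Real.exp (-(Φ z - θ z))) U volume := by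
    refine fun j => ((hgi j).mono_set hUΩ).mono' ?_ ?_
    · exact (((((hg j).continuousOn.mono hUΩ).norm.pow 2).mul
        (Real.continuous_exp.comp_continuousOn
          (hΦC.continuousOn.sub hθC.continuousOn).neg))).aestronglyMeasurable hU.measurableSet
    · refine (ae_restrict_iff' hU.measurableSet).2 (.of_forall fun z hz => ?_)
      rw [Real.norm_of_nonneg (by positivity)]
      exact mul_le_mul_of_nonneg_left (hθΦ z hz) (by positivity)
  have key := three_weights_duality hU hΦC hθC hc (fun z hz w => ?_) hχ hχc hχU hχI
    (A := B / ε ^ 2) (fun m z hz => ?_) hχ1 (fun j => (hg j).mono hUΩ)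
    (fun z hz => hgc z hz.1) hgi' (fun j => ⟨(hψ j).contDiff, (hψ j).hasCompactSupport, hψU j⟩)
  · have e1 : ∀ j, ∫ z in U, g z j * conj (ψ z j) = ∫ z in Ω, g z j * conj (ψ z j) := fun j => by
      have ht : tsupport (fun z => conj (ψ z j)) ⊆ tsupport fun z => ψ z j :=
        closure_mono fun z hz h => hz (by simp [h])
      rw [setIntegral_mul_eq (ht.trans (hψU j)),
        setIntegral_mul_eq (ht.trans (hψ j).tsupport_subset)]
    simp only [e1] at key
    refine key.trans ?_
    refine mul_le_mul (mul_le_mul_of_nonneg_left ?_ (by norm_num)) ?_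
      (Finset.sum_nonneg fun j _ => integral_nonneg fun z => by positivity)
      (mul_nonneg (by norm_num) (mul_nonneg (by positivity)
        (integral_nonneg fun z => by positivity)))
    · rw [← integral_const_mul]
      have hb : Continuous fun z => ∑ j, del (fun z => ψ z j) z j :=
        continuous_finsetSum _ fun j _ => ((hψ j).contDiff_del j).continuous
      have hb0 : ∀ z, ∑ j, del (fun z => ψ z j) z j ≠ 0 → z ∈ Ω ∧ σ z ≤ c₀ - 1 := fun z hz => by
        obtain ⟨j, -, hj⟩ := Finset.exists_ne_zero_of_sum_ne_zero hz
        have := tsupport_del_subset (fun z => ψ z j) j (subset_tsupport _ hj)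
        exact ⟨(hψ j).tsupport_subset this, hψs j z this⟩
      have hcl := (hσc (c₀ - 1)).isClosed
      have hbs : tsupport (fun z => ∑ j, del (fun z => ψ z j) z j) ⊆ {z ∈ Ω | σ z ≤ c₀ - 1} :=
        closure_minimal hb0 hcl
      have hint := integrableOn_of_test hΩ hΨ.continuousOn hb
        ((hσc (c₀ - 1)).of_isClosed_subset (isClosed_tsupport _) hbs) fun z hz => (hbs hz).1
      rw [integrableOn_iff_integrable_of_support_subset fun z hz => (hb0 z fun h => hz (by
        simp [h])).1] at hint
      refine integral_mono_of_nonneg (.of_forall fun z => by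
        simp only [Pi.zero_apply]; positivity) (hint.const_mul _) (.of_forall fun z => ?_)
      beta_reduce
      by_cases hz : ∑ j, del (fun z => ψ z j) z j = 0
      · simp [hz]
      · obtain ⟨hzΩ, hzσ⟩ := hb0 z hz
        have hzU : z ∈ U := ⟨hzΩ, by linarith⟩
        have hq0 := hqpos z hzU
        have hq1 : q z ≤ 1 := by
          rw [hq]; dsimp only
          rw [div_le_one (by linarith)]
          linarith
        have hθ0 : 0 ≤ θ z := mul_nonneg (by norm_num) (Real.log_nonneg (by nlinarith))
        have hq3 : ε * A * q z ^ 3 ≤ ε * A * 1 := by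
          gcongr
          exact pow_le_one₀ hq0.le hq1
        rw [mul_left_comm (Real.exp _), ← Real.exp_add]
        refine mul_le_mul_of_nonneg_left (Real.exp_le_exp.2 ?_) (by positivity)
        simp only [hΦ]
        linarith
    · refine Finset.sum_le_sum fun j _ => ?_
      refine (setIntegral_mono_on (hgi' j) ((hgi j).mono_set hUΩ) hU.measurableSet
        fun z hz => ?_).trans (setIntegral_mono_set (hgi j) (.of_forall fun z => ?_) (.of_forall hUΩ))
      · exact mul_le_mul_of_nonneg_left (hθΦ z hz) (by positivity)
      · simp only [Pi.zero_apply]; positivity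
  · refine le_trans ?_ (hLΦ z hz w)
    refine mul_le_mul_of_nonneg_right ?_ (by positivity)
    refine le_trans ?_ (weight_inequality hc hε hε1 (hqpos z hz) (hRq z hz) hD0 hA)
    rw [hexpθ z hz]
    gcongr
    exact hdθ z hz
  · refine (hχB m z hz).trans ?_
    rw [hexpθ z hz, div_mul_eq_mul_div, le_div_iff₀ (by positivity), mul_assoc]
    have := hqpos z hz
    gcongr
    rw [← mul_pow]
    gcongr
    rw [hq] at this
    dsimp only at this
    linarith

/-- The duality estimate for the `∂̄`-operator on a pseudoconvex set. -/
theorem Pseudoconvex.duality {Ω : Set (Cn n)} (hΩ : IsOpen Ω) (hpsc : Pseudoconvex Ω)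
    {Ψ : Cn n → ℝ} (hΨ : ContDiffOn ℝ 2 Ψ Ω) {c : ℝ} (hc : 0 ≤ c)
    (hL : ∀ z ∈ Ω, ∀ w : Cn n, c * ‖w‖ ^ 2 ≤ LeviForm Ψ z w)
    {g : Cn n → Fin n → ℂ} (hg : ∀ j, ContDiffOn ℝ 1 (fun z => g z j) Ω)
    (hgc : DbarClosedOn Ω g)
    (hgi : ∀ j, IntegrableOn (fun z => ‖g z j‖ ^ 2 * Real.exp (-Ψ z)) Ω volume)
    {ψ : Cn n → Fin n → ℂ} (hψ : ∀ j, TestC2 Ω fun z => ψ z j) :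
    c * ‖∑ j, ∫ z in Ω, g z j * conj (ψ z j)‖ ^ 2 ≤
      3 * (∫ z, ‖∑ j, del (fun z => ψ z j) z j‖ ^ 2 * Real.exp (Ψ z)) *
        ∑ j, ∫ z in Ω, ‖g z j‖ ^ 2 * Real.exp (-Ψ z) := by
  obtain ⟨σ, hσ, hσc, hσL⟩ := hpsc.exists_exhaustion hΩ
  obtain ⟨c₀, hc₀⟩ : ∃ c₀, ∀ j, ∀ z ∈ tsupport (fun z => ψ z j), σ z ≤ c₀ - 1 := by
    have h1 : ∀ j, ∃ b, ∀ z ∈ tsupport (fun z => ψ z j), σ z ≤ b := fun j => by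
      obtain ⟨b, hb⟩ := (hψ j).hasCompactSupport.isCompact.bddAbove_image
        (hσ.continuousOn.mono (hψ j).tsupport_subset)
      exact ⟨b, fun z hz => hb (mem_image_of_mem _ hz)⟩
    choose b hb using h1
    obtain ⟨M, hM⟩ := (Set.finite_range b).bddAbove
    exact ⟨M + 1, fun j z hz => by linarith [hb j z hz, hM (mem_range_self j)]⟩
  have hK := hσc c₀
  have hsub : {z ∈ Ω | σ z ≤ c₀} ⊆ Ω := sep_subset _ _
  obtain ⟨D, hD⟩ := hK.bddAbove_image (f := fun z => ∑ j, ‖dbar (fun z => (σ z : ℂ)) z j‖ ^ 2)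
    (continuousOn_finsetSum _ fun j _ => ((ContDiffOn.dbar (m := 1) hΩ (by
      norm_num
      exact Complex.ofRealCLM.contDiff.comp_contDiffOn hσ) j).continuousOn.norm.pow 2).mono hsub)
  obtain ⟨R, hR⟩ := hK.bddAbove_image (f := fun z => c₀ - σ z)
    (continuousOn_const.sub (hσ.continuousOn.mono hsub))
  set D' := max D 0
  set R' := max R 0
  set A := 4 * D' + c * (2 * R' ^ 3 + R' ^ 2) + 2 * R' ^ 2
  have hD' : 0 ≤ D' := le_max_right _ _
  have hR' : 0 ≤ R' := le_max_right _ _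
  have hcR : 0 ≤ c * (2 * R' ^ 3 + R' ^ 2) := by positivity
  have key : ∀ ε : ℝ, 0 < ε → ε ≤ 1 → c * ‖∑ j, ∫ z in Ω, g z j * conj (ψ z j)‖ ^ 2 ≤
      3 * (Real.exp (ε * A) *
        ∫ z, ‖∑ j, del (fun z => ψ z j) z j‖ ^ 2 * Real.exp (Ψ z)) *
        ∑ j, ∫ z in Ω, ‖g z j‖ ^ 2 * Real.exp (-Ψ z) := fun ε hε hε1 =>
    sublevel_duality hΩ hσ hσc hσL hΨ hc hL hD'
      (fun z hz h => (hD (mem_image_of_mem _ ⟨hz, h.le⟩)).trans (le_max_left _ _))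
      (fun z hz h => (hR (mem_image_of_mem _ ⟨hz, h.le⟩)).trans (le_max_left _ _))
      (by simp only [A]; nlinarith [sq_nonneg R']) (by simp only [A]; nlinarith) hε hε1
      hg hgc hgi hψ hc₀
  have hlim : Filter.Tendsto (fun ε : ℝ => 3 * (Real.exp (ε * A) *
        ∫ z, ‖∑ j, del (fun z => ψ z j) z j‖ ^ 2 * Real.exp (Ψ z)) *
        ∑ j, ∫ z in Ω, ‖g z j‖ ^ 2 * Real.exp (-Ψ z)) (nhdsWithin 0 (Ioi 0))
      (nhds (3 * (Real.exp (0 * A) *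
        ∫ z, ‖∑ j, del (fun z => ψ z j) z j‖ ^ 2 * Real.exp (Ψ z)) *
        ∑ j, ∫ z in Ω, ‖g z j‖ ^ 2 * Real.exp (-Ψ z))) :=
    Filter.Tendsto.mono_left (Continuous.tendsto (by fun_prop) 0) nhdsWithin_le_nhds
  rw [zero_mul, Real.exp_zero, one_mul] at hlim
  refine ge_of_tendsto hlim ?_
  filter_upwards [Ioc_mem_nhdsGT (zero_lt_one' ℝ)] with ε hε
  exact key ε hε.1 hε.2

end SublevelWeights

section Weyl

theorem differentiableAt_complex_of_dbar_eq_zero {v : Cn n → ℂ} {z : Cn n}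
    (hv : DifferentiableAt ℝ v z) (h : ∀ j, dbar v z j = 0) : DifferentiableAt ℂ v z := by
  refine (differentiableAt_iff_restrictScalars ℝ hv).2 ?_
  have hI : ∀ w, fderiv ℝ v z (I • w) = I * fderiv ℝ v z w := fun w => by
    have := fderiv_add_I_fderiv v z w
    simp only [h, mul_zero, Finset.sum_const_zero] at this
    linear_combination (-I) * this + fderiv ℝ v z (I • w) * I_mul_I
  refine ⟨LinearMap.toContinuousLinearMap
    { toFun := fderiv ℝ v z, map_add' := map_add _, map_smul' := fun c w => ?_ }, ?_⟩
  · have hc : c • w = c.re • w + c.im • (I • w) := by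
      conv_lhs => rw [← re_add_im c, add_smul, mul_smul]
      rfl
    rw [hc, map_add, map_smul, map_smul, hI, RingHom.id_apply, smul_eq_mul, Complex.real_smul,
      Complex.real_smul]
    conv_rhs => rw [← re_add_im c]
    ring
  · ext w
    rfl

/-- The mean value property for mollifications of `∂̄`-closed functions. -/
theorem mollify_eq_self {u : Cn n → ℂ} (hu : ContDiff ℝ 1 u) {x : Cn n} {s : ℝ} (hs : 0 < s)
    (hd : ∀ z ∈ closedBall x s, ∀ j, dbar u z j = 0) : mollify s u x = u x := by
  have h := norm_average_sub_le isOpen_univ hu.contDiffOn (x := x) (subset_univ (closedBall x s)) le_rfl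
    (fun z hz => by simp [hd z hz]) (moll_nonneg s) (integrable_moll hs)
    (fun w => norm_le_of_moll_ne_zero hs) (fun c hc w => moll_smul s c hc w)
  rw [mul_zero, zero_mul, norm_le_zero_iff, integral_moll hs, ← mollify_eq_translate, ofReal_one,
    one_mul, sub_eq_zero] at h
  exact h

theorem dbar_mollify_indicator_eq_zero {Ω L : Set (Cn n)} (hΩ : IsOpen Ω) (hLΩ : L ⊆ Ω)
    {u : Cn n → ℂ} (hw : ∀ ψ, IsTestOn Ω ψ → ∀ j, ∫ z in Ω, u z * dbar ψ z j = 0)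
    (hu : LocallyIntegrable (L.indicator u)) {s : ℝ} (hs : 0 < s) {x : Cn n}
    (hx : closedBall x s ⊆ L) (j : Fin n) : dbar (mollify s (L.indicator u)) x j = 0 := by
  rw [dbar_mollify hs hu, neg_eq_zero]
  have hsupp : tsupport (fun t : Cn n => (moll s (x - t) : ℂ)) ⊆ closedBall x s := by
    refine closure_minimal (fun t ht => ?_) isClosed_closedBall
    have := norm_le_of_moll_ne_zero hs (fun h => ht (by simp [h]) : moll s (x - t) ≠ 0)
    rwa [mem_closedBall, dist_comm, dist_eq_norm]
  have htest : IsTestOn Ω fun t : Cn n => (moll s (x - t) : ℂ) :=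
    ⟨(contDiff_moll_complex s).comp (contDiff_const.sub contDiff_id),
      (isCompact_closedBall x s).of_isClosed_subset (isClosed_tsupport _) hsupp,
      hsupp.trans (hx.trans hLΩ)⟩
  rw [← hw _ htest j, ← integral_indicator hΩ.measurableSet]
  refine integral_congr_ae (.of_forall fun t => ?_)
  beta_reduce
  by_cases ht : t ∈ L
  · rw [indicator_of_mem ht, indicator_of_mem (hLΩ ht)]
  · have h0 : dbar (fun t : Cn n => (moll s (x - t) : ℂ)) t j = 0 := by
      by_contra h
      exact ht (hx (hsupp (tsupport_dbar_subset _ j (subset_tsupport _ h))))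
    rw [indicator_of_notMem ht, zero_mul]
    by_cases ht' : t ∈ Ω
    · rw [indicator_of_mem ht', h0, mul_zero]
    · rw [indicator_of_notMem ht']

theorem weyl_local {Ω : Set (Cn n)} (hΩ : IsOpen Ω) {u : Cn n → ℂ}
    (hu : ∀ L ⊆ Ω, IsCompact L → MemLp u 2 (volume.restrict L))
    (hw : ∀ ψ, IsTestOn Ω ψ → ∀ j, ∫ z in Ω, u z * dbar ψ z j = 0) {x : Cn n} (hx : x ∈ Ω) :
    ∃ r > 0, ∃ h : Cn n → ℂ, ContDiff ℝ 1 h ∧ (∀ z ∈ ball x r, ∀ j, dbar h z j = 0) ∧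
      ball x r ⊆ Ω ∧ ∀ᵐ z ∂volume, z ∈ ball x r → u z = h z := by
  obtain ⟨R, hR0, hR⟩ := nhds_basis_closedBall.mem_iff.1 (hΩ.mem_nhds hx)
  set r := R / 3
  have hr : 0 < r := by positivity
  have hR3 : R = 3 * r := by simp only [r]; ring
  set L := closedBall x R
  have hL : IsCompact L := isCompact_closedBall x R
  set F := L.indicator u with hF
  have hF2 : MemLp F 2 volume := (memLp_indicator_iff_restrict hL.measurableSet).2 (hu L hR hL)
  have hFl := locallyIntegrable_of_memLp_two hF2
  have hd : ∀ s, 0 < s → s ≤ r → ∀ z ∈ closedBall x (2 * r), ∀ j, dbar (mollify s F) z j = 0 :=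
    fun s hs hsr z hz j => dbar_mollify_indicator_eq_zero hΩ hR hw hFl hs
      (closedBall_subset_closedBall' (by rw [mem_closedBall] at hz; linarith)) j
  set s : ℕ → ℝ := fun m => r / (m + 1)
  have hs : ∀ m, 0 < s m := fun m => by positivity
  have hsr : ∀ m, s m ≤ r := fun m => div_le_self hr.le (by linarith [Nat.cast_nonneg (α := ℝ) m])
  have hs0 : Filter.Tendsto s Filter.atTop (nhds 0) :=
    tendsto_const_div_atTop_nhds_zero_nat r |>.comp (Filter.tendsto_add_atTop_nat 1) |>.congr
      fun m => by simp [s]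
  have hlim := l2Tendsto_mollify hF2 hL (fun z hz => indicator_of_notMem hz u) hs hs0
  obtain ⟨φ, hφ, hae⟩ := (tendstoInMeasure_of_tendsto_eLpNorm two_ne_zero
    (fun m => (hlim.mem m).1) hF2.1 hlim.lim).exists_seq_tendsto_ae
  refine ⟨r, hr, mollify r F, contDiff_mollify (m := 1) hr hFl, fun z hz => hd r hr le_rfl z
    (closedBall_subset_closedBall (by linarith) (ball_subset_closedBall hz)),
    (ball_subset_closedBall.trans (closedBall_subset_closedBall (by linarith))).trans hR, ?_⟩
  filter_upwards [hae] with z hz hzr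
  have hzL : z ∈ L := closedBall_subset_closedBall (by linarith) (ball_subset_closedBall hzr)
  have hb : MemLp (fun t : Cn n => (moll r (z - t) : ℂ)) 2 volume := by
    have h2 : HasCompactSupport fun t : Cn n => (moll r (z - t) : ℂ) :=
      (hasCompactSupport_moll_complex hr).comp_homeomorph (Homeomorph.subLeft z)
    exact Continuous.memLp_of_hasCompactSupport (((contDiff_moll_complex (m := 0) r).comp
      (contDiff_const.sub contDiff_id)).continuous) h2
  have hconst : L2Tendsto (fun _ => fun t : Cn n => (moll r (z - t) : ℂ))
      fun t : Cn n => (moll r (z - t) : ℂ) := ⟨fun _ => hb, hb, by simp⟩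
  have h1 := hlim.integral_mul_conj hconst
  simp only [Complex.conj_ofReal] at h1
  have h2 : ∀ m, ∫ t, mollify (s m) F t * (moll r (z - t) : ℂ) = mollify (s m) F z := fun m =>
    mollify_eq_self (contDiff_mollify (m := 1) (hs m) hFl) hr fun y hy => hd _ (hs m) (hsr m) y (by
      rw [mem_closedBall] at hy ⊢
      rw [mem_ball] at hzr
      linarith [dist_triangle y z x])
  simp only [h2] at h1
  have h3 := tendsto_nhds_unique hz (h1.comp hφ.tendsto_atTop)
  rw [hF, indicator_of_mem hzL] at h3
  exact h3

/-- **Weyl's lemma** for the `∂̄`-operator. -/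
theorem exists_holomorphic_ae_eq {Ω : Set (Cn n)} (hΩ : IsOpen Ω) {u : Cn n → ℂ}
    (hu : ∀ L ⊆ Ω, IsCompact L → MemLp u 2 (volume.restrict L))
    (hw : ∀ ψ, IsTestOn Ω ψ → ∀ j, ∫ z in Ω, u z * dbar ψ z j = 0) :
    ∃ h : Cn n → ℂ, DifferentiableOn ℂ h Ω ∧ u =ᵐ[volume.restrict Ω] h := by
  choose! r hr H hH hdH hrΩ hae using fun x (hx : x ∈ Ω) => weyl_local hΩ hu hw hx
  have hEq : ∀ x ∈ Ω, ∀ z ∈ ball x (r x), H z z = H x z := fun x hx z hz => by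
    have hzΩ := hrΩ x hx hz
    have hopen : IsOpen (ball x (r x) ∩ ball z (r z)) := isOpen_ball.inter isOpen_ball
    have h1 : H z =ᵐ[volume.restrict (ball x (r x) ∩ ball z (r z))] H x := by
      refine (ae_restrict_iff' hopen.measurableSet).2 ?_
      filter_upwards [hae x hx, hae z hzΩ] with y h1 h2 hy
      rw [← h1 hy.1, h2 hy.2]
    exact Measure.eqOn_open_of_ae_eq h1 hopen (hH z hzΩ).continuous.continuousOn
      (hH x hx).continuous.continuousOn ⟨hz, mem_ball_self (hr z hzΩ)⟩
  refine ⟨fun z => H z z, fun x hx => ?_, ?_⟩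
  · have h1 : (fun z => H z z) =ᶠ[nhds x] H x := by
      filter_upwards [ball_mem_nhds x (hr x hx)] with z hz
      exact hEq x hx z hz
    refine (DifferentiableAt.congr_of_eventuallyEq ?_ h1).differentiableWithinAt
    exact differentiableAt_complex_of_dbar_eq_zero ((hH x hx).differentiable one_ne_zero x)
      (hdH x hx x (mem_ball_self (hr x hx)))
  · refine (ae_restrict_iff' hΩ.measurableSet).2 ?_
    rw [ae_iff]
    refine measure_null_of_locally_null _ fun x hx => ?_
    simp only [Classical.not_imp, mem_ofPred_eq] at hx
    refine ⟨_, inter_mem_nhdsWithin _ (ball_mem_nhds x (hr x hx.1)), measure_mono_null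
      (fun z hz => ?_) (ae_iff.1 (hae x hx.1))⟩
    have hz1 := hz.1
    simp only [Classical.not_imp, mem_ofPred_eq] at hz1 ⊢
    exact ⟨hz.2, fun h => hz1.2 (h.trans (hEq x hx.1 z hz.2).symm)⟩

end Weyl

section MinimalSolutionEstimate

variable {Ω : Set (Cn n)} {Ψ : Cn n → ℝ}

theorem TestC2.differentiable {ψ : Cn n → ℂ} (h : TestC2 Ω ψ) : Differentiable ℝ ψ :=
  h.contDiff.differentiable two_ne_zero

theorem TestC2.add {ψ η : Cn n → ℂ} (h : TestC2 Ω ψ) (h' : TestC2 Ω η) :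
    TestC2 Ω fun z => ψ z + η z :=
  ⟨h.contDiff.add h'.contDiff, h.hasCompactSupport.add h'.hasCompactSupport,
    (tsupport_add ψ η).trans (union_subset h.tsupport_subset h'.tsupport_subset)⟩

theorem TestC2.const_mul {ψ : Cn n → ℂ} (h : TestC2 Ω ψ) (c : ℂ) : TestC2 Ω fun z => c * ψ z :=
  ⟨contDiff_const.mul h.contDiff, h.hasCompactSupport.mul_left,
    (tsupport_mul_subset_right (f := fun _ => c)).trans h.tsupport_subset⟩

theorem TestC2.zero : TestC2 Ω fun _ : Cn n => (0 : ℂ) :=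
  ⟨contDiff_const, HasCompactSupport.zero, by simp [tsupport, Function.support]⟩

/-- The closed range of the formal adjoint of `∂̄`, before completion. -/
def divTest (Ω : Set (Cn n)) (Ψ : Cn n → ℝ) : Submodule ℂ (Lp ℂ 2 (volume.restrict Ω)) where
  carrier := {s | ∃ ψ : Cn n → Fin n → ℂ, (∀ j, TestC2 Ω fun z => ψ z j) ∧
    s =ᵐ[volume.restrict Ω] weighted (fun z => -Ψ z) fun z => ∑ j, del (fun z => ψ z j) z j}
  add_mem' := by
    rintro a b ⟨ψ, hψ, ha⟩ ⟨η, hη, hb⟩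
    refine ⟨fun z j => ψ z j + η z j, fun j => (hψ j).add (hη j), ?_⟩
    filter_upwards [ha, hb, Lp.coeFn_add a b] with z h1 h2 h3
    rw [h3, Pi.add_apply, h1, h2]
    simp only [weighted, del_add ((hψ _).differentiable z) ((hη _).differentiable z),
      Finset.sum_add_distrib, add_mul]
  zero_mem' := by
    refine ⟨fun _ _ => 0, fun j => TestC2.zero, ?_⟩
    filter_upwards [Lp.coeFn_zero ℂ 2 (volume.restrict Ω)] with z h
    rw [h]
    simp [weighted, del]
  smul_mem' := by
    rintro c a ⟨ψ, hψ, ha⟩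
    refine ⟨fun z j => c * ψ z j, fun j => (hψ j).const_mul c, ?_⟩
    filter_upwards [ha, Lp.coeFn_smul c a] with z h1 h2
    rw [h2, Pi.smul_apply, h1]
    simp only [weighted, del_const_mul ((hψ _).differentiable z), ← Finset.mul_sum, smul_eq_mul]
    ring

theorem memLp_weighted_div (hΩ : IsOpen Ω) (hΨ : ContinuousOn Ψ Ω) {ψ : Cn n → Fin n → ℂ}
    (hψ : ∀ j, TestC2 Ω fun z => ψ z j) :
    MemLp (weighted (fun z => -Ψ z) fun z => ∑ j, del (fun z => ψ z j) z j) 2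
      (volume.restrict Ω) := by
  have h1 : MemLp (fun z => ∑ j, weighted (fun z => -Ψ z)
      (fun z' => del (fun z => ψ z j) z' j) z) 2 (volume.restrict Ω) :=
    memLp_finsetSum _ fun j _ => memLp_weighted_neg_test hΩ hΨ
      ((hψ j).contDiff_del j).continuous (hasCompactSupport_del (hψ j).hasCompactSupport j)
      ((tsupport_del_subset _ j).trans (hψ j).tsupport_subset)
  refine h1.congr_norm (h1.1.congr (.of_forall fun z => ?_)) (.of_forall fun z => ?_) <;>
  simp only [weighted, Finset.sum_mul]

theorem exists_holomorphic_of_mem_orthogonal (hΩ : IsOpen Ω) (hΨ : ContinuousOn Ψ Ω)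
    {x : Lp ℂ 2 (volume.restrict Ω)} (hx : x ∈ (divTest Ω Ψ)ᗮ) :
    ∃ h : Cn n → ℂ, DifferentiableOn ℂ h Ω ∧ MemL2 Ω Ψ h ∧
      x =ᵐ[volume.restrict Ω] weighted Ψ h := by
  have hloc : ∀ L ⊆ Ω, IsCompact L →
      MemLp (weighted (fun z => -Ψ z) x) 2 (volume.restrict L) := fun L hL hLc => by
    obtain ⟨c, hc⟩ := hLc.exists_bound_of_continuousOn
      (continuousOn_ofReal_exp ((hΨ.mono hL).neg.neg.div_const 2))
    have hb : MemLp (fun z => (Real.exp (-(-Ψ z) / 2) : ℂ)) ⊤ (volume.restrict L) :=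
      memLp_top_of_bound ((continuousOn_ofReal_exp
        ((hΨ.mono hL).neg.neg.div_const 2)).aestronglyMeasurable hLc.measurableSet) c
        ((ae_restrict_iff' hLc.measurableSet).2 (.of_forall hc))
    exact hb.mul ((Lp.memLp x).mono_measure (Measure.restrict_mono hL le_rfl))
  have hw : ∀ ψ, IsTestOn Ω ψ → ∀ j,
      ∫ z in Ω, weighted (fun z => -Ψ z) x z * dbar ψ z j = 0 := fun ψ hψ j => by
    set ψ' : Cn n → Fin n → ℂ := fun z i => if i = j then conj (ψ z) else 0
    have hψ2 : TestC2 Ω ψ := ⟨contDiff_infty.1 hψ.1 2, hψ.2.1, hψ.2.2⟩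
    have hψ' : ∀ i, TestC2 Ω fun z => ψ' z i := fun i => by
      by_cases hi : i = j
      · simpa only [ψ', hi, if_true] using hψ2.conj
      · simpa only [ψ', hi, if_false] using TestC2.zero
    have hm := memLp_weighted_div hΩ hΨ hψ'
    have h0 := hx (hm.toLp _) ⟨ψ', hψ', hm.coeFn_toLp⟩
    rw [inner_toLp_left] at h0
    rw [← h0]
    refine integral_congr_ae (.of_forall fun z => ?_)
    beta_reduce
    have hs : ∑ i, del (fun z => ψ' z i) z i = conj (dbar ψ z j) := by
      rw [Finset.sum_eq_single j]
      · simp only [ψ', if_true]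
        exact del_conj ψ z j
      · intro i _ hi
        simp [ψ', hi, del]
      · simp
    rw [conj_weighted, weighted, weighted, hs, Complex.conj_conj]
    ring
  obtain ⟨h, hh, hae⟩ := exists_holomorphic_ae_eq hΩ hloc hw
  have hx' : x =ᵐ[volume.restrict Ω] weighted Ψ h := by
    filter_upwards [hae] with z hz
    rw [weighted, ← hz, ← weighted, weighted_weighted]
  refine ⟨h, hh, ⟨hh.continuousOn.aestronglyMeasurable hΩ.measurableSet, ?_⟩, hx'⟩
  refine ((memLp_two_iff_integrable_sq_norm (Lp.memLp x).1).1 (Lp.memLp x)).congr ?_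
  filter_upwards [hx'] with z hz
  rw [hz, norm_weighted_sq]

theorem setIntegral_conj_div_mul (hΩ : IsOpen Ω) {V : Cn n → ℂ} (hV : ContDiffOn ℝ 1 V Ω)
    {ψ : Cn n → Fin n → ℂ} (hψ : ∀ j, TestC2 Ω fun z => ψ z j) :
    ∫ z in Ω, conj (∑ j, del (fun z => ψ z j) z j) * V z =
      -∑ j, ∫ z in Ω, dbar V z j * conj (ψ z j) := by
  have h1 : ∀ j, ContDiff ℝ 1 fun z => conj (ψ z j) := fun j =>
    (hψ j).conj.contDiff.of_le (by norm_num)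
  have h2 := fun j => integral_mul_dbar hΩ hV (h1 j) (hψ j).conj.hasCompactSupport
    (hψ j).conj.tsupport_subset j
  have hs := fun j => (tsupport_dbar_subset (fun z => conj (ψ z j)) j).trans
    (hψ j).conj.tsupport_subset
  have h3 : ∀ j, Integrable (fun z => V z * dbar (fun z => conj (ψ z j)) z j)
      (volume.restrict Ω) := fun j =>
    ((ContinuousOn.continuous_mul hΩ hV.continuousOn ((hψ j).conj.contDiff_dbar j).continuous
      (hs j)).integrable_of_hasCompactSupport
      (hasCompactSupport_dbar (hψ j).conj.hasCompactSupport j).mul_left).integrableOn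
  rw [← Finset.sum_neg_distrib]
  calc ∫ z in Ω, conj (∑ j, del (fun z => ψ z j) z j) * V z
      = ∫ z in Ω, ∑ j, V z * dbar (fun z => conj (ψ z j)) z j := by
        refine integral_congr_ae (.of_forall fun z => ?_)
        beta_reduce
        simp only [dbar_conj, map_sum, ← Finset.mul_sum, mul_comm]
    _ = ∑ j, ∫ z in Ω, V z * dbar (fun z => conj (ψ z j)) z j := integral_finsetSum _ fun j _ => h3 j
    _ = _ := by
        refine Finset.sum_congr rfl fun j _ => ?_
        rw [setIntegral_mul_eq (hs j), h2 j, setIntegral_mul_eq (hψ j).conj.tsupport_subset]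

/-- **Hörmander's estimate** for functions orthogonal to the weighted Bergman space. -/
theorem Pseudoconvex.le_of_orthToHolo (hΩ : IsOpen Ω) (hpsc : Pseudoconvex Ω)
    (hΨ : ContDiffOn ℝ 2 Ψ Ω) {c : ℝ} (hc : 0 ≤ c)
    (hL : ∀ z ∈ Ω, ∀ w : Cn n, c * ‖w‖ ^ 2 ≤ LeviForm Ψ z w) {V : Cn n → ℂ}
    (hV : ContDiffOn ℝ 2 V Ω) (hVi : MemL2 Ω Ψ V) (hVo : OrthToHolo Ω Ψ V)
    (hgi : ∀ j, IntegrableOn (fun z => ‖dbar V z j‖ ^ 2 * Real.exp (-Ψ z)) Ω volume) :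
    c * ∫ z in Ω, ‖V z‖ ^ 2 * Real.exp (-Ψ z) ≤
      3 * ∑ j, ∫ z in Ω, ‖dbar V z j‖ ^ 2 * Real.exp (-Ψ z) := by
  have hm := memLp_weighted hΩ hΨ.continuousOn hVi.1 hVi.2
  have hV1 : ContDiffOn ℝ 1 V Ω := hV.of_le (by norm_num)
  set G := ∑ j, ∫ z in Ω, ‖dbar V z j‖ ^ 2 * Real.exp (-Ψ z) with hG
  have hG0 : 0 ≤ G := Finset.sum_nonneg fun j _ => integral_nonneg fun z => by positivity
  set v := hm.toLp _ with hv
  have hnorm : ∫ z in Ω, ‖V z‖ ^ 2 * Real.exp (-Ψ z) = ‖v‖ ^ 2 := by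
    rw [norm_sq_toLp]
    simp only [norm_weighted_sq]
  have hmem : v ∈ (divTest Ω Ψ).topologicalClosure := by
    rw [← Submodule.orthogonal_orthogonal_eq_closure]
    intro x hx
    obtain ⟨h, hh, hhi, hxe⟩ := exists_holomorphic_of_mem_orthogonal hΩ hΨ.continuousOn hx
    rw [L2.inner_def, ← hVo h hh hhi]
    refine integral_congr_ae ?_
    filter_upwards [hxe, hm.coeFn_toLp] with z h1 h2
    rw [h1, h2, RCLike.inner_apply, conj_weighted, weighted, weighted]
    have : (Real.exp (-Ψ z) : ℂ) = Real.exp (-Ψ z / 2) * Real.exp (-Ψ z / 2) := by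
      rw [← Complex.ofReal_mul, ← Real.exp_add]
      congr 2
      ring
    rw [this]
    ring
  have hbound : ∀ s ∈ (divTest Ω Ψ).topologicalClosure,
      c * ‖inner ℂ s v‖ ^ 2 ≤ 3 * ‖s‖ ^ 2 * G := by
    have hcl : IsClosed {s : Lp ℂ 2 (volume.restrict Ω) |
        c * ‖inner ℂ s v‖ ^ 2 ≤ 3 * ‖s‖ ^ 2 * G} :=
      isClosed_le (by fun_prop) (by fun_prop)
    refine fun s hs => closure_minimal ?_ hcl hs
    rintro s ⟨ψ, hψ, hse⟩
    have hms := memLp_weighted_div hΩ hΨ.continuousOn hψ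
    have hs' : s = hms.toLp _ := Lp.ext (hse.trans hms.coeFn_toLp.symm)
    have hin : inner ℂ s v = -∑ j, ∫ z in Ω, dbar V z j * conj (ψ z j) := by
      rw [← setIntegral_conj_div_mul hΩ hV1 hψ, hs', inner_toLp_toLp]
      refine integral_congr_ae (.of_forall fun z => ?_)
      beta_reduce
      rw [conj_weighted, mul_comm, weighted_mul_weighted, mul_comm]
    have hns : ‖s‖ ^ 2 = ∫ z, ‖∑ j, del (fun z => ψ z j) z j‖ ^ 2 * Real.exp (Ψ z) := by
      rw [hs', norm_sq_toLp]
      simp only [norm_weighted_sq, neg_neg]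
      refine setIntegral_eq_integral_of_forall_compl_eq_zero fun z hz => ?_
      rw [Finset.sum_eq_zero fun j _ =>
        image_eq_zero_of_notMem_tsupport (f := fun z' => del (fun z => ψ z j) z' j)
          fun h => hz ((hψ j).tsupport_subset (tsupport_del_subset _ j h))]
      simp
    rw [mem_ofPred_eq, hin, norm_neg, hns]
    exact hpsc.duality hΩ hΨ hc hL (g := dbar V)
      (fun j => ContDiffOn.dbar (m := 1) hΩ (by norm_num; exact hV) j)
      (fun z hz j k => dbar_dbar_comm (hV.contDiffAt (hΩ.mem_nhds hz)) j k) hgi hψ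
  have h1 := hbound v hmem
  rw [inner_self_eq_norm_sq_to_K] at h1
  rw [hnorm]
  rcases eq_or_ne v 0 with h0 | h0
  · rw [h0, norm_zero]
    simpa using hG0
  · have h2 : 0 < ‖v‖ ^ 2 := by positivity
    rw [norm_pow, RCLike.norm_ofReal, abs_norm] at h1
    refine le_of_mul_le_mul_right ?_ h2
    nlinarith

end MinimalSolutionEstimate

theorem DbarEqOn.dbar_eq {Ω : Set (Cn n)} (hΩ : IsOpen Ω) {v : Cn n → ℂ} {f : Cn n → Fin n → ℂ}
    (h : DbarEqOn Ω v f) (hv : ContDiffOn ℝ 1 v Ω) (hf : ∀ j, ContinuousOn (fun z => f z j) Ω)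
    (j : Fin n) : EqOn (fun z => dbar v z j) (fun z => f z j) Ω := by
  have hdv : ContinuousOn (fun z => dbar v z j) Ω :=
    (ContDiffOn.dbar (m := 0) hΩ (by norm_num; exact hv) j).continuousOn
  refine Measure.eqOn_open_of_ae_eq (μ := volume) ?_ hΩ hdv (hf j)
  refine (ae_restrict_iff' hΩ.measurableSet).2 ?_
  have h0 := hΩ.ae_eq_zero_of_integral_contDiff_smul_eq_zero (μ := volume)
    (f := fun z => dbar v z j - f z j)
    ((hdv.sub (hf j)).locallyIntegrableOn hΩ.measurableSet) fun g hg hgc hgs => ?_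
  · filter_upwards [h0] with z hz hzΩ using sub_eq_zero.1 (hz hzΩ)
  · have hg' : ContDiff ℝ (⊤ : ℕ∞) fun z => (g z : ℂ) := Complex.ofRealCLM.contDiff.comp hg
    have hs' : tsupport (fun z => (g z : ℂ)) ⊆ tsupport g :=
      closure_mono fun z hz => by
        simp only [Function.mem_support] at hz ⊢
        exact fun h => hz (by simp [h])
    have hc' : HasCompactSupport fun z => (g z : ℂ) :=
      hgc.of_isClosed_subset (isClosed_tsupport _) hs'
    have hgs' := hs'.trans hgs
    have h1 := h _ ⟨hg', hc', hgs'⟩ j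
    have h2 := integral_mul_dbar hΩ hv (contDiff_infty.1 hg' 1) hc' hgs' j
    rw [setIntegral_mul_eq ((tsupport_dbar_subset _ j).trans hgs'), setIntegral_mul_eq hgs', h2,
      neg_inj] at h1
    have h3 : ∀ u : Cn n → ℂ, ContinuousOn u Ω → Integrable fun z => u z * (g z : ℂ) := fun u hu =>
      (ContinuousOn.continuous_mul hΩ hu hg'.continuous
        hgs').integrable_of_hasCompactSupport hc'.mul_left
    calc ∫ z, g z • (dbar v z j - f z j)
        = ∫ z, (dbar v z j * g z - f z j * g z) := by
          refine integral_congr_ae (.of_forall fun z => ?_)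
          beta_reduce
          rw [Complex.real_smul]; ring
      _ = 0 := by
          rw [integral_sub (h3 _ hdv) (h3 _ (hf j)), h1, sub_self]

theorem dbar_norm_sub_sq (x z : Cn n) (j : Fin n) :
    dbar (fun z => ((‖z - x‖ ^ 2 : ℝ) : ℂ)) z j = z j - x j := by
  have h1 : HasFDerivAt (fun z : Cn n => ‖z - x‖ ^ 2) ((2 : ℝ) • innerSL ℝ (z - x)) z :=
    ((hasFDerivAt_id z).sub_const x).norm_sq.congr_fderiv (by ext; simp)
  have h2 : ∀ c : ℂ, (inner ℝ (z - x) (c • e n j) : ℝ) = (conj (z j - x j) * c).re := fun c => by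
    rw [PiLp.inner_apply, Finset.sum_eq_single j]
    · simp [e, Complex.inner]
      ring
    · intro i _ hi
      simp [e, hi]
    · simp
  have h3 := h2 1
  rw [one_smul] at h3
  rw [dbar, fderiv_ofReal_apply h1.differentiableAt, fderiv_ofReal_apply h1.differentiableAt,
    h1.fderiv]
  simp only [smul_apply, innerSL_apply_apply, h2, h3]
  apply Complex.ext <;> simp <;> ring

/-- The logarithmic weight `-(n + 1) log (1 + β |z - x|²)`. -/
def logWeight (β : ℝ) (x z : Cn n) : ℝ := -((n + 1 : ℕ) * Real.log (1 + β * ‖z - x‖ ^ 2))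

theorem contDiff_logWeight {β : ℝ} (hβ : 0 ≤ β) (x : Cn n) : ContDiff ℝ 2 (logWeight β x) := by
  have h : ContDiff ℝ 2 fun z : Cn n => ‖z - x‖ ^ 2 := (contDiff_id.sub contDiff_const).norm_sq ℝ
  exact (contDiff_const.mul ((contDiff_const.add (contDiff_const.mul h)).log
    fun z => by positivity)).neg

theorem exp_logWeight {β : ℝ} (hβ : 0 ≤ β) (x z : Cn n) :
    Real.exp (logWeight β x z) = ((1 + β * ‖z - x‖ ^ 2) ^ (n + 1))⁻¹ := by
  rw [logWeight, Real.exp_neg, Real.exp_nat_mul, Real.exp_log (by positivity)]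

theorem hasDerivAt_logWeight_aux {β t : ℝ} (ht : 0 < 1 + β * t) (a : ℝ) :
    HasDerivAt (fun t => -(a * Real.log (1 + β * t))) (-(a * (β / (1 + β * t)))) t := by
  have h : HasDerivAt (fun t => 1 + β * t) β t :=
    (((hasDerivAt_id t).const_mul β).const_add 1).congr_deriv (by simp)
  exact ((h.log ht.ne').const_mul a).neg

theorem le_leviForm_logWeight {β : ℝ} (hβ : 0 ≤ β) (x z w : Cn n) :
    -((n + 1 : ℕ) * β) * ‖w‖ ^ 2 ≤ LeviForm (logWeight β x) z w := by
  have hσ : ContDiff ℝ 2 fun z : Cn n => ‖z - x‖ ^ 2 := (contDiff_id.sub contDiff_const).norm_sq ℝ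
  have ht : 0 < 1 + β * ‖z - x‖ ^ 2 := by positivity
  have hd : HasDerivAt (fun t => -(((n + 1 : ℕ) : ℝ) * (β / (1 + β * t))))
      (((n + 1 : ℕ) : ℝ) * (β * β / (1 + β * ‖z - x‖ ^ 2) ^ 2)) (‖z - x‖ ^ 2) := by
    have h : HasDerivAt (fun t => 1 + β * t) β (‖z - x‖ ^ 2) :=
      (((hasDerivAt_id _).const_mul β).const_add 1).congr_deriv (by simp)
    have := (((h.fun_inv ht.ne').const_mul β).const_mul (((n + 1 : ℕ) : ℝ))).fun_neg
    simp only [← div_eq_mul_inv] at this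
    exact this.congr_deriv (by ring)
  have h := le_leviForm_comp (F := fun t => -(((n + 1 : ℕ) : ℝ) * Real.log (1 + β * t)))
    hσ.contDiffAt (by
      filter_upwards [(by fun_prop : Continuous fun t : ℝ => 1 + β * t).continuousAt.eventually_mem
        (isOpen_Ioi.mem_nhds ht)] with t ht
      exact hasDerivAt_logWeight_aux ht _) hd (by positivity) w
  rw [leviForm_norm_sub_sq] at h
  refine le_trans ?_ h
  refine mul_le_mul_of_nonneg_right ?_ (by positivity)
  refine neg_le_neg (mul_le_mul_of_nonneg_left ?_ (by positivity))
  exact div_le_self hβ (by nlinarith [mul_nonneg hβ (sq_nonneg ‖z - x‖)])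

theorem sum_norm_dbar_logWeight_sq_le {β : ℝ} (hβ : 0 ≤ β) (x z : Cn n) :
    ∑ j, ‖dbar (fun z => (logWeight β x z : ℂ)) z j‖ ^ 2 ≤ ((n : ℝ) + 1) ^ 2 * β / 4 := by
  have hσ : ContDiff ℝ 2 fun z : Cn n => ‖z - x‖ ^ 2 := (contDiff_id.sub contDiff_const).norm_sq ℝ
  have ht : 0 < 1 + β * ‖z - x‖ ^ 2 := by positivity
  have h1 : ∀ j, ‖dbar (fun z => (logWeight β x z : ℂ)) z j‖ ^ 2 =
      (((n : ℝ) + 1) * (β / (1 + β * ‖z - x‖ ^ 2))) ^ 2 * ‖(z - x) j‖ ^ 2 := fun j => by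
    have := dbar_real_comp (j := j) (hσ.differentiable two_ne_zero z)
      (hasDerivAt_logWeight_aux ht (n + 1 : ℕ))
    rw [show (fun z => (logWeight β x z : ℂ)) = fun z => ((-(((n + 1 : ℕ) : ℝ) *
      Real.log (1 + β * ‖z - x‖ ^ 2)) : ℝ) : ℂ) from rfl, this, dbar_norm_sub_sq, norm_mul, mul_pow,
      Complex.norm_real, norm_neg, Real.norm_eq_abs, sq_abs]
    simp
  simp only [h1, ← Finset.mul_sum]
  rw [← EuclideanSpace.norm_sq_eq, mul_div_assoc', div_pow, div_mul_eq_mul_div,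
    div_le_div_iff₀ (by positivity) (by norm_num)]
  have := sq_nonneg (1 - β * ‖z - x‖ ^ 2)
  have h2 : 0 ≤ ((n : ℝ) + 1) ^ 2 * β := by positivity
  nlinarith [mul_nonneg h2 this]

section GlobalEstimate

theorem integrable_inv_one_add_norm_sq_pow :
    Integrable fun w : Cn n => ((1 + ‖w‖ ^ 2) ^ (n + 1))⁻¹ := by
  have hd : ((Module.finrank ℝ (Cn n) : ℕ) : ℝ) < 2 * (n + 1) := by
    rw [finrank_real_of_complex, finrank_euclideanSpace, Fintype.card_fin]
    push_cast
    linarith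
  refine (integrable_rpow_neg_one_add_norm_sq (μ := volume) hd).congr (.of_forall fun w => ?_)
  beta_reduce
  rw [show -(2 * ((n : ℝ) + 1)) / 2 = -((n + 1 : ℕ) : ℝ) by push_cast; ring,
    Real.rpow_neg (by positivity), Real.rpow_natCast]

theorem exp_logWeight_eq {β : ℝ} (hβ : 0 ≤ β) (x z : Cn n) :
    Real.exp (logWeight β x z) = ((1 + ‖Real.sqrt β • (z - x)‖ ^ 2) ^ (n + 1))⁻¹ := by
  rw [exp_logWeight hβ, norm_smul, mul_pow, Real.norm_eq_abs, sq_abs, Real.sq_sqrt hβ]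

theorem integrable_exp_logWeight {β : ℝ} (hβ : 0 < β) (x : Cn n) :
    Integrable fun z => Real.exp (logWeight β x z) := by
  simp only [exp_logWeight_eq hβ.le]
  exact ((integrable_comp_smul_iff volume (fun w : Cn n => ((1 + ‖w‖ ^ 2) ^ (n + 1))⁻¹)
    (Real.sqrt_pos.2 hβ).ne').2 integrable_inv_one_add_norm_sq_pow).comp_sub_right x

theorem integral_exp_logWeight {β : ℝ} (hβ : 0 < β) (x : Cn n) :
    ∫ z, Real.exp (logWeight β x z) = (Real.sqrt β ^ Module.finrank ℝ (Cn n))⁻¹ *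
      ∫ w : Cn n, ((1 + ‖w‖ ^ 2) ^ (n + 1))⁻¹ := by
  simp only [exp_logWeight_eq hβ.le]
  rw [integral_sub_right_eq_self (μ := volume)
    (fun z : Cn n => ((1 + ‖Real.sqrt β • z‖ ^ 2) ^ (n + 1))⁻¹) x,
    Measure.integral_comp_smul volume (fun z : Cn n => ((1 + ‖z‖ ^ 2) ^ (n + 1))⁻¹),
    smul_eq_mul, abs_of_nonneg (by positivity)]

variable {Ω : Set (Cn n)} {Φ : Cn n → ℝ}

theorem norm_dbar_mul_exp_sq_le {v : Cn n → ℂ} {η : Cn n → ℝ} {z : Cn n}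
    (hv : DifferentiableAt ℝ v z) (hη : DifferentiableAt ℝ η z) (j : Fin n) :
    ‖dbar (fun z => v z * (Real.exp (η z) : ℂ)) z j‖ ^ 2 * Real.exp (-(Φ z + η z)) ≤
      2 * (‖dbar v z j‖ ^ 2 * Real.exp (-Φ z) * Real.exp (η z)) +
      2 * ‖dbar (fun z => (η z : ℂ)) z j‖ ^ 2 *
        (‖v z‖ ^ 2 * Real.exp (-Φ z) * Real.exp (η z)) := by
  have hd : DifferentiableAt ℝ (fun z => (Real.exp (η z) : ℂ)) z :=
    Complex.ofRealCLM.differentiableAt.comp z hη.exp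
  rw [dbar_mul hv hd, dbar_real_comp hη (Real.hasDerivAt_exp _)]
  set a := dbar v z j
  set b := dbar (fun z => (η z : ℂ)) z j
  have h1 : a * (Real.exp (η z) : ℂ) + v z * (Real.exp (η z) * b) =
      (Real.exp (η z) : ℂ) * (a + v z * b) := by ring
  have h2 : Real.exp (-(Φ z + η z)) = Real.exp (-Φ z) * (Real.exp (η z))⁻¹ := by
    rw [neg_add, Real.exp_add, Real.exp_neg (η z)]
  have h3 : ‖a + v z * b‖ ^ 2 ≤ 2 * ‖a‖ ^ 2 + 2 * (‖v z‖ ^ 2 * ‖b‖ ^ 2) := by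
    have h4 := norm_add_le a (v z * b)
    rw [norm_mul] at h4
    have h5 := pow_le_pow_left₀ (norm_nonneg _) h4 2
    nlinarith [sq_nonneg (‖a‖ - ‖v z‖ * ‖b‖)]
  rw [h1, h2, norm_mul, mul_pow, Complex.norm_real, Real.norm_eq_abs, sq_abs]
  have h0 : Real.exp (η z) ≠ 0 := (Real.exp_pos _).ne'
  calc _ = (Real.exp (η z) * Real.exp (-Φ z)) * ‖a + v z * b‖ ^ 2 := by field_simp
    _ ≤ (Real.exp (η z) * Real.exp (-Φ z)) * (2 * ‖a‖ ^ 2 + 2 * (‖v z‖ ^ 2 * ‖b‖ ^ 2)) :=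
        mul_le_mul_of_nonneg_left h3 (by positivity)
    _ = _ := by ring

theorem Pseudoconvex.setIntegral_logWeight_le (hΩ : IsOpen Ω) (hpsc : Pseudoconvex Ω)
    (hΦ : ContDiffOn ℝ 2 Φ Ω) {κ : ℝ} (hκ : 0 < κ)
    (hL : ∀ z ∈ Ω, ∀ w : Cn n, κ * ‖w‖ ^ 2 ≤ LeviForm Φ z w) {v : Cn n → ℂ}
    (hv : ContDiffOn ℝ 2 v Ω) (hvi : MemL2 Ω Φ v) (hvo : OrthToHolo Ω Φ v) {M : ℝ} (hM0 : 0 ≤ M)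
    (hM : ∀ z ∈ Ω, ∑ j, ‖dbar v z j‖ ^ 2 * Real.exp (-Φ z) ≤ M) {β : ℝ}
    (hβ : 6 * ((n : ℝ) + 1) ^ 2 * β = κ) (x : Cn n) :
    κ * ∫ z in Ω, ‖v z‖ ^ 2 * Real.exp (-Φ z) * Real.exp (logWeight β x z) ≤
      24 * M * ∫ z, Real.exp (logWeight β x z) := by
  have hn : (1 : ℝ) ≤ (n : ℝ) + 1 := by linarith [(Nat.cast_nonneg n : (0 : ℝ) ≤ n)]
  have hβ0 : 0 < β := by
    by_contra h
    have : 6 * ((n : ℝ) + 1) ^ 2 * β ≤ 0 := mul_nonpos_of_nonneg_of_nonpos (by positivity)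
      (not_lt.1 h)
    linarith
  set η := logWeight β x with hη
  have hη2 : ContDiff ℝ 2 η := contDiff_logWeight hβ0.le x
  have hη0 : ∀ z, η z ≤ 0 := fun z => by
    rw [hη, logWeight, neg_nonpos]
    exact mul_nonneg (by positivity) (Real.log_nonneg (by
      nlinarith [mul_nonneg hβ0.le (sq_nonneg ‖z - x‖)]))
  have hη1 : ∀ z, Real.exp (η z) ≤ 1 := fun z => Real.exp_le_one_iff.2 (hη0 z)
  have hei : Integrable fun z => Real.exp (η z) := integrable_exp_logWeight hβ0 x
  have hec : Continuous fun z => Real.exp (η z) := Real.continuous_exp.comp hη2.continuous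
  have hnorm : ∀ z, ‖v z * (Real.exp (η z) : ℂ)‖ ^ 2 * Real.exp (-(Φ z + η z)) =
      ‖v z‖ ^ 2 * Real.exp (-Φ z) * Real.exp (η z) := fun z => by
    rw [neg_add, Real.exp_add, Real.exp_neg (η z), norm_mul, mul_pow, Complex.norm_real,
      Real.norm_eq_abs, sq_abs]
    have h0 : Real.exp (η z) ≠ 0 := (Real.exp_pos _).ne'
    field_simp
  have hvη : IntegrableOn (fun z => ‖v z‖ ^ 2 * Real.exp (-Φ z) * Real.exp (η z)) Ω volume :=
    hvi.2.mul_bdd (c := 1) hec.aestronglyMeasurable (.of_forall fun z => by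
      rw [Real.norm_eq_abs, abs_of_pos (Real.exp_pos _)]; exact hη1 z)
  have hΨ : ContDiffOn ℝ 2 (fun z => Φ z + η z) Ω := hΦ.add hη2.contDiffOn
  have hE : ContDiff ℝ 2 fun z => (Real.exp (η z) : ℂ) := Complex.ofRealCLM.contDiff.comp hη2.exp
  have hV : ContDiffOn ℝ 2 (fun z => v z * (Real.exp (η z) : ℂ)) Ω := hv.mul hE.contDiffOn
  have hLΨ : ∀ z ∈ Ω, ∀ w : Cn n, κ / 2 * ‖w‖ ^ 2 ≤ LeviForm (fun z => Φ z + η z) z w := by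
    intro z hz w
    rw [leviForm_add (hΦ.contDiffAt (hΩ.mem_nhds hz)) hη2.contDiffAt]
    have h1 := hL z hz w
    have h2 := le_leviForm_logWeight hβ0.le x z w
    have h3 : ((n + 1 : ℕ) : ℝ) * β ≤ κ / 2 := by
      rw [← hβ]; push_cast
      nlinarith [mul_nonneg (sub_nonneg.2 hn) (mul_nonneg (zero_le_one.trans hn) hβ0.le)]
    have h4 := mul_le_mul_of_nonneg_right h3 (sq_nonneg ‖w‖)
    rw [← hη] at h2
    linarith
  have hVi : MemL2 Ω (fun z => Φ z + η z) fun z => v z * (Real.exp (η z) : ℂ) :=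
    ⟨hV.continuousOn.aestronglyMeasurable hΩ.measurableSet, by simpa only [hnorm] using hvη⟩
  have hVo : OrthToHolo Ω (fun z => Φ z + η z) fun z => v z * (Real.exp (η z) : ℂ) := by
    intro h hh hhi
    have hhi' : MemL2 Ω Φ h := ⟨hhi.1, by
      refine (hhi.2.mul_bdd (c := 1) (g := fun z => Real.exp (η z)) hec.aestronglyMeasurable
        (.of_forall fun z => by
          rw [Real.norm_eq_abs, abs_of_pos (Real.exp_pos _)]; exact hη1 z)).congr
          (.of_forall fun z => ?_)
      beta_reduce
      rw [mul_assoc, ← Real.exp_add, neg_add_rev, neg_add_cancel_comm]⟩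
    rw [← hvo h hh hhi']
    refine integral_congr_ae (.of_forall fun z => ?_)
    beta_reduce
    rw [neg_add, Real.exp_add, Real.exp_neg (η z)]
    have h0 : (Real.exp (η z) : ℂ) ≠ 0 := by exact_mod_cast (Real.exp_pos _).ne'
    push_cast [-Complex.ofReal_exp]
    field_simp
  set A := ((n : ℝ) + 1) ^ 2 * β / 4 with hA
  set B : Cn n → ℝ := fun z => 2 * M * Real.exp (η z) +
    2 * A * (‖v z‖ ^ 2 * Real.exp (-Φ z) * Real.exp (η z)) with hB
  have hBi : IntegrableOn B Ω volume :=
    (hei.integrableOn.const_mul (2 * M)).add (hvη.const_mul (2 * A))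
  have hsum : ∀ z ∈ Ω, ∑ j, ‖dbar (fun z => v z * (Real.exp (η z) : ℂ)) z j‖ ^ 2 *
      Real.exp (-(Φ z + η z)) ≤ B z := by
    intro z hz
    have hvd := (hv.differentiableOn two_ne_zero).differentiableAt (hΩ.mem_nhds hz)
    have hηd := hη2.differentiable two_ne_zero z
    refine (Finset.sum_le_sum fun j _ => norm_dbar_mul_exp_sq_le hvd hηd j).trans ?_
    rw [Finset.sum_add_distrib, ← Finset.mul_sum, ← Finset.sum_mul, ← Finset.sum_mul,
      ← Finset.sum_mul, ← Finset.mul_sum]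
    have hMz := hM z hz
    rw [← Finset.sum_mul] at hMz
    have h1 := sum_norm_dbar_logWeight_sq_le hβ0.le x z
    have h2 := mul_le_mul_of_nonneg_right hMz (Real.exp_pos (η z)).le
    have h3 := mul_le_mul_of_nonneg_right h1
      (by positivity : 0 ≤ ‖v z‖ ^ 2 * Real.exp (-Φ z) * Real.exp (η z))
    rw [← hη, ← hA] at h3
    simp only [hB]
    linarith
  have hgc : ∀ j, ContinuousOn (fun z => ‖dbar (fun z => v z * (Real.exp (η z) : ℂ)) z j‖ ^ 2 *
      Real.exp (-(Φ z + η z))) Ω := fun j =>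
    ((ContDiffOn.dbar (m := 1) hΩ (hV.of_le (by norm_num)) j).continuousOn.norm.pow 2).mul
      (Real.continuous_exp.comp_continuousOn hΨ.continuousOn.neg)
  have hgi : ∀ j, IntegrableOn (fun z => ‖dbar (fun z => v z * (Real.exp (η z) : ℂ)) z j‖ ^ 2 *
      Real.exp (-(Φ z + η z))) Ω volume := fun j => by
    refine hBi.mono' ((hgc j).aestronglyMeasurable hΩ.measurableSet)
      ((ae_restrict_iff' hΩ.measurableSet).2 (.of_forall fun z hz => ?_))
    rw [Real.norm_eq_abs, abs_of_nonneg (by positivity)]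
    exact (Finset.single_le_sum (f := fun j => ‖dbar (fun z => v z * (Real.exp (η z) : ℂ)) z j‖ ^ 2 *
      Real.exp (-(Φ z + η z))) (fun i _ => by positivity) (Finset.mem_univ j)).trans (hsum z hz)
  have hmain := hpsc.le_of_orthToHolo hΩ hΨ (by positivity : 0 ≤ κ / 2) hLΨ hV hVi hVo hgi
  rw [← integral_finsetSum _ fun j _ => hgi j] at hmain
  have h1 : ∫ z in Ω, ∑ j, ‖dbar (fun z => v z * (Real.exp (η z) : ℂ)) z j‖ ^ 2 *
      Real.exp (-(Φ z + η z)) ≤ ∫ z in Ω, B z :=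
    setIntegral_mono_on (integrable_finsetSum _ fun j _ => hgi j) hBi hΩ.measurableSet hsum
  have h2 : ∫ z in Ω, B z = 2 * M * (∫ z in Ω, Real.exp (η z)) +
      2 * A * ∫ z in Ω, ‖v z‖ ^ 2 * Real.exp (-Φ z) * Real.exp (η z) := by
    rw [hB, integral_add (hei.integrableOn.const_mul (2 * M)) (hvη.const_mul (2 * A)),
      integral_const_mul, integral_const_mul]
  have h3 : ∫ z in Ω, Real.exp (η z) ≤ ∫ z, Real.exp (η z) :=
    setIntegral_le_integral hei (.of_forall fun z => (Real.exp_pos _).le)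
  simp only [hnorm] at hmain
  have h4 : 6 * A = κ / 4 := by rw [← hβ, hA]; ring
  have h5 := mul_le_mul_of_nonneg_left h3 hM0
  set I := ∫ z in Ω, ‖v z‖ ^ 2 * Real.exp (-Φ z) * Real.exp (η z)
  have h6 : 6 * A * I = κ / 4 * I := by rw [h4]
  linarith

end GlobalEstimate

theorem exists_taylor_bound {E : Type*} [NormedAddCommGroup E] [NormedSpace ℝ E] [ProperSpace E]
    {Ω K : Set E} (hΩ : IsOpen Ω) (hK : IsCompact K) (hKΩ : K ⊆ Ω) {φ : E → ℝ}
    (hφ : ContDiffOn ℝ 2 φ Ω) :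
    ∃ r > 0, ∃ A ≥ 0, ∀ x ∈ K, closedBall x r ⊆ Ω ∧ ∀ z ∈ closedBall x r,
      |φ z - φ x - fderiv ℝ φ x (z - x)| ≤ A * ‖z - x‖ ^ 2 := by
  obtain ⟨r, hr, hrΩ⟩ := hK.exists_cthickening_subset_open hΩ hKΩ
  have hd1 : ContDiffOn ℝ 1 (fderiv ℝ φ) Ω := hφ.fderiv_of_isOpen hΩ (by norm_num)
  have hd2 : ContDiffOn ℝ 0 (fderiv ℝ (fderiv ℝ φ)) Ω := hd1.fderiv_of_isOpen hΩ (by norm_num)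
  obtain ⟨A, hA⟩ := (hK.cthickening (r := r)).exists_bound_of_continuousOn
    (f := fderiv ℝ (fderiv ℝ φ)) (hd2.continuousOn.mono hrΩ)
  refine ⟨r, hr, max A 0, le_max_right _ _, fun x hx => ?_⟩
  have hb : closedBall x r ⊆ cthickening r K := closedBall_subset_cthickening hx r
  refine ⟨hb.trans hrΩ, fun z hz => ?_⟩
  have hs : closedBall x ‖z - x‖ ⊆ closedBall x r := closedBall_subset_closedBall (by
    rwa [← dist_eq_norm])
  have hxs : x ∈ closedBall x ‖z - x‖ := mem_closedBall_self (norm_nonneg _)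
  have hzs : z ∈ closedBall x ‖z - x‖ := by rw [mem_closedBall, dist_eq_norm]
  have h1 : ∀ y ∈ closedBall x ‖z - x‖, ‖fderiv ℝ φ y - fderiv ℝ φ x‖ ≤ max A 0 * ‖z - x‖ := by
    intro y hy
    refine ((convex_closedBall x ‖z - x‖).norm_image_sub_le_of_norm_fderiv_le (𝕜 := ℝ)
      (C := max A 0) (fun w hw => ?_) (fun w hw => ?_) hxs hy).trans ?_
    · exact (hd1.differentiableOn one_ne_zero).differentiableAt
        (hΩ.mem_nhds (hrΩ (hb (hs hw))))
    · exact (hA w (hb (hs hw))).trans (le_max_left _ _)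
    · rw [← dist_eq_norm y]
      exact mul_le_mul_of_nonneg_left hy (le_max_right _ _)
  have h2 := (convex_closedBall x ‖z - x‖).norm_image_sub_le_of_norm_fderiv_le' (𝕜 := ℝ)
    (fun w hw => (hφ.differentiableOn two_ne_zero).differentiableAt
      (hΩ.mem_nhds (hrΩ (hb (hs hw))))) h1 hxs hzs
  rw [Real.norm_eq_abs] at h2
  exact h2.trans_eq (by ring)

theorem DifferentiableAt.dbar_eq_zero {g : Cn n → ℂ} {z : Cn n} (hg : DifferentiableAt ℂ g z)
    (j : Fin n) : dbar g z j = 0 := by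
  have h : fderiv ℝ g z = (fderiv ℂ g z).restrictScalars ℝ :=
    (hg.hasFDerivAt.restrictScalars ℝ).fderiv
  rw [dbar, h]
  simp only [ContinuousLinearMap.coe_restrictScalars', map_smul, smul_eq_mul]
  linear_combination (1 / 2 * (fderiv ℂ g z) (e n j)) * I_sq

theorem exists_clm_re_eq (D : Cn n →L[ℝ] ℝ) : ∃ L : Cn n →L[ℂ] ℂ, ∀ w, (L w).re = D w :=
  ⟨StrongDual.extendRCLike D, fun w => by
    simpa only [RCLike.re_eq_complex_re] using StrongDual.re_extendRCLike_apply (𝕜 := ℂ) D w⟩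

theorem sq_integral_norm_le {α : Type*} [MeasurableSpace α] {μ : Measure α} [IsFiniteMeasure μ]
    {u : α → ℝ} (hu : Integrable u μ) (hu2 : Integrable (fun z => u z ^ 2) μ) :
    (∫ z, u z ∂μ) ^ 2 ≤ μ.real univ * ∫ z, u z ^ 2 ∂μ := by
  set V := μ.real univ
  set m := ∫ z, u z ∂μ
  have h : 0 ≤ ∫ z, (V * u z - m) ^ 2 ∂μ := integral_nonneg fun z => sq_nonneg _
  have h1 : ∫ z, (V * u z - m) ^ 2 ∂μ = V * (V * ∫ z, u z ^ 2 ∂μ) - V * m ^ 2 := by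
    have e1 : ∀ z, (V * u z - m) ^ 2 = V ^ 2 * u z ^ 2 - 2 * V * m * u z + m ^ 2 := fun z => by ring
    simp only [e1]
    have i1 : Integrable (fun z => V ^ 2 * u z ^ 2 - 2 * V * m * u z) μ :=
      (hu2.const_mul _).sub (hu.const_mul _)
    rw [integral_add i1 (integrable_const _), integral_sub (hu2.const_mul _) (hu.const_mul _), integral_const_mul, integral_const_mul,
      integral_const, smul_eq_mul]
    ring
  rw [h1, ← mul_sub] at h
  rcases (measureReal_nonneg : 0 ≤ V).eq_or_lt with h0 | h0
  · have hμ : μ = 0 := by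
      have := h0.symm
      rwa [measureReal_eq_zero_iff, Measure.measure_univ_eq_zero] at this
    simp [m, hμ]
  · linarith [nonneg_of_mul_nonneg_right h h0]

/-- A mean value estimate on a small ball on which the weight is almost pluriharmonic. -/
theorem norm_sq_mul_exp_le_average {Ω : Set (Cn n)} (hΩ : IsOpen Ω) {v : Cn n → ℂ}
    (hv : ContDiffOn ℝ 1 v Ω) {Φ : Cn n → ℝ} (hΦ : ContinuousOn Φ Ω) {x : Cn n} {s : ℝ}
    (hs : 0 < s) (hsΩ : closedBall x s ⊆ Ω) {D : Cn n →L[ℝ] ℝ} {E : ℝ}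
    (hD : ∀ z ∈ closedBall x s, |Φ z - Φ x - D (z - x)| ≤ E) {M : ℝ} (hM0 : 0 ≤ M)
    (hM : ∀ z ∈ closedBall x s, ∑ j, ‖dbar v z j‖ ^ 2 * Real.exp (-Φ z) ≤ M) :
    ‖v x‖ ^ 2 * Real.exp (-Φ x) ≤ Real.exp E * (8 * s ^ 2 * M +
      2 / volume.real (closedBall (0 : Cn n) s) *
        ∫ z in closedBall x s, ‖v z‖ ^ 2 * Real.exp (-Φ z)) := by
  obtain ⟨L, hL⟩ := exists_clm_re_eq D
  set g : Cn n → ℂ := fun z => Complex.exp (-(L (z - x)) / 2) with hg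
  have hgd : ∀ z, DifferentiableAt ℂ g z := fun z => by
    have : DifferentiableAt ℂ (fun z => L (z - x)) z :=
      L.differentiableAt.comp z (differentiableAt_id.sub_const x)
    simp only [hg, div_eq_mul_inv]
    exact (this.fun_neg.mul_const _).cexp
  have hgc : ContDiff ℝ 1 g := by
    have h1 : ContDiff ℝ 1 fun z => (L.restrictScalars ℝ) (z - x) :=
      (L.restrictScalars ℝ).contDiff.comp (contDiff_id.sub contDiff_const)
    exact (h1.neg.div_const 2).cexp
  have hgn : ∀ z, ‖g z‖ ^ 2 = Real.exp (-D (z - x)) := fun z => by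
    rw [hg, Complex.norm_exp, ← Real.exp_nat_mul, ← hL]
    congr 1
    simp
    ring
  have hge : ∀ z ∈ closedBall x s, ‖g z‖ ^ 2 ≤ Real.exp E * Real.exp (Φ x) * Real.exp (-Φ z) := by
    intro z hz
    rw [hgn, ← Real.exp_add, ← Real.exp_add, Real.exp_le_exp]
    linarith [(abs_le.1 (hD z hz)).2]
  have hgx : g x = 1 := by simp [hg]
  have hu : ContDiffOn ℝ 1 (fun z => v z * g z) Ω := hv.mul hgc.contDiffOn
  have hdu : ∀ z ∈ closedBall x s, ∀ j, dbar (fun z => v z * g z) z j = dbar v z j * g z := by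
    intro z hz j
    rw [dbar_mul ((hv.differentiableOn one_ne_zero).differentiableAt (hΩ.mem_nhds (hsΩ hz)))
      ((hgd z).restrictScalars ℝ), (hgd z).dbar_eq_zero, mul_zero, add_zero]
  set B := Real.sqrt (Real.exp E * Real.exp (Φ x) * M) with hB
  have hB2 : B ^ 2 = Real.exp E * Real.exp (Φ x) * M := Real.sq_sqrt (by positivity)
  have hd : ∀ z ∈ closedBall x s, ∑ j, ‖dbar (fun z => v z * g z) z j‖ ^ 2 ≤ B ^ 2 := by
    intro z hz
    simp only [hdu z hz, norm_mul, mul_pow, ← Finset.sum_mul]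
    have h1 := hM z hz
    rw [← Finset.sum_mul] at h1
    calc (∑ j, ‖dbar v z j‖ ^ 2) * ‖g z‖ ^ 2
        ≤ (∑ j, ‖dbar v z j‖ ^ 2) * (Real.exp E * Real.exp (Φ x) * Real.exp (-Φ z)) :=
          mul_le_mul_of_nonneg_left (hge z hz) (by positivity)
      _ = Real.exp E * Real.exp (Φ x) * ((∑ j, ‖dbar v z j‖ ^ 2) * Real.exp (-Φ z)) := by ring
      _ ≤ _ := by
          rw [hB2]
          exact mul_le_mul_of_nonneg_left h1 (by positivity)
  have hm0 : MeasurableSet (closedBall (0 : Cn n) s) := isClosed_closedBall.measurableSet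
  have hm : MeasurableSet (closedBall x s) := isClosed_closedBall.measurableSet
  have hc := isCompact_closedBall x s
  have hfin0 : volume (closedBall (0 : Cn n) s) ≠ ⊤ := (isCompact_closedBall 0 s).measure_ne_top
  have hav := norm_average_sub_le hΩ hu hsΩ (Real.sqrt_nonneg _) hd
    (ρ := (closedBall (0 : Cn n) s).indicator 1)
    (fun w => indicator_nonneg (fun _ _ => zero_le_one) w)
    ((integrableOn_const (C := (1 : ℝ)) hfin0).integrable_indicator hm0)
    (fun w hw => by simpa using mem_of_indicator_ne_zero hw)
    (fun c hc w => by simp only [indicator, mem_closedBall_zero_iff, norm_smul, hc, one_mul,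
      Pi.one_apply])
  set V := volume.real (closedBall (0 : Cn n) s) with hV
  have hV0 : 0 < V := ENNReal.toReal_pos (measure_closedBall_pos _ _ hs).ne' hfin0
  have hρ : ∫ w, (closedBall (0 : Cn n) s).indicator (1 : Cn n → ℝ) w = V :=
    integral_indicator_one hm0
  have hmean : ∫ w, (((closedBall (0 : Cn n) s).indicator (1 : Cn n → ℝ) w : ℝ) : ℂ) *
      (v (x + w) * g (x + w)) = ∫ z in closedBall x s, v z * g z := by
    rw [← integral_indicator hm,
      ← integral_add_left_eq_self ((closedBall x s).indicator fun z => v z * g z) x]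
    refine integral_congr_ae (.of_forall fun w => ?_)
    by_cases hw : w ∈ closedBall (0 : Cn n) s
    · have hw' : x + w ∈ closedBall x s := by simpa using hw
      simp [indicator_of_mem hw, indicator_of_mem hw']
    · have hw' : x + w ∉ closedBall x s := by simpa using hw
      simp [indicator_of_notMem hw, indicator_of_notMem hw']
  rw [hρ, hmean] at hav
  have huc : ContinuousOn (fun z => v z * g z) (closedBall x s) := hu.continuousOn.mono hsΩ
  set m := ∫ z in closedBall x s, ‖v z * g z‖ with hmdef
  have h1 : V * ‖v x‖ ≤ 2 * s * B * V + m := by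
    have h2 := norm_integral_le_integral_norm (μ := volume.restrict (closedBall x s))
      fun z => v z * g z
    have h3 : ‖(V : ℂ) * (v x * g x)‖ = V * ‖v x‖ := by
      rw [hgx, mul_one, norm_mul, Complex.norm_real, Real.norm_eq_abs, abs_of_pos hV0]
    have h4 := norm_sub_norm_le ((V : ℂ) * (v x * g x)) (∫ z in closedBall x s, v z * g z)
    rw [norm_sub_rev, h3] at h4
    linarith
  have : IsFiniteMeasure (volume.restrict (closedBall x s)) :=
    ⟨by rw [Measure.restrict_apply_univ]; exact hc.measure_lt_top⟩
  have h2 : m ^ 2 ≤ V * ∫ z in closedBall x s, ‖v z * g z‖ ^ 2 := by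
    have := sq_integral_norm_le (μ := volume.restrict (closedBall x s))
      (u := fun z => ‖v z * g z‖) (huc.norm.integrableOn_compact hc)
      ((huc.norm.pow 2).integrableOn_compact hc)
    rwa [measureReal_restrict_apply_univ, Measure.addHaar_real_closedBall_center] at this
  have h3 : ∫ z in closedBall x s, ‖v z * g z‖ ^ 2 ≤
      Real.exp E * Real.exp (Φ x) * ∫ z in closedBall x s, ‖v z‖ ^ 2 * Real.exp (-Φ z) := by
    rw [← integral_const_mul]
    have hvc := hv.continuousOn.mono hsΩ
    have hec := Real.continuous_exp.comp_continuousOn (hΦ.mono hsΩ).neg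
    refine setIntegral_mono_on ((huc.norm.pow 2).integrableOn_compact hc)
      ((((hvc.norm.pow 2).mul hec).integrableOn_compact hc).const_mul _) hm fun z hz => ?_
    rw [norm_mul, mul_pow]
    calc ‖v z‖ ^ 2 * ‖g z‖ ^ 2
        ≤ ‖v z‖ ^ 2 * (Real.exp E * Real.exp (Φ x) * Real.exp (-Φ z)) :=
          mul_le_mul_of_nonneg_left (hge z hz) (by positivity)
      _ = _ := by ring
  set J := ∫ z in closedBall x s, ‖v z‖ ^ 2 * Real.exp (-Φ z)
  have h4 : V ^ 2 * ‖v x‖ ^ 2 ≤ V ^ 2 * (Real.exp E * Real.exp (Φ x) *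
      (8 * s ^ 2 * M + 2 / V * J)) := by
    have h5 := pow_le_pow_left₀ (by positivity) h1 2
    have h6 := h2.trans (mul_le_mul_of_nonneg_left h3 hV0.le)
    have h7 : V ^ 2 * (Real.exp E * Real.exp (Φ x) * (8 * s ^ 2 * M + 2 / V * J)) =
        8 * s ^ 2 * V ^ 2 * B ^ 2 + 2 * (V * (Real.exp E * Real.exp (Φ x) * J)) := by
      rw [hB2]; field_simp
    rw [h7]
    nlinarith [sq_nonneg (2 * s * B * V - m)]
  have h5 := mul_le_mul_of_nonneg_right (le_of_mul_le_mul_left h4 (by positivity))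
    (Real.exp_pos (-Φ x)).le
  refine h5.trans_eq ?_
  rw [mul_right_comm, mul_assoc (Real.exp E), ← Real.exp_add, add_neg_cancel, Real.exp_zero,
    mul_one]

theorem setIntegral_closedBall_le {Ω : Set (Cn n)} {x : Cn n} {s β : ℝ} (hβ : 0 ≤ β)
    (hsΩ : closedBall x s ⊆ Ω) {F : Cn n → ℝ} (hF0 : ∀ z, 0 ≤ F z)
    (hF : IntegrableOn F Ω volume) :
    ∫ z in closedBall x s, F z ≤
      (1 + β * s ^ 2) ^ (n + 1) * ∫ z in Ω, F z * Real.exp (logWeight β x z) := by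
  have hi : IntegrableOn (fun z => F z * Real.exp (logWeight β x z)) Ω volume :=
    hF.mul_bdd (c := 1) (Real.continuous_exp.comp
      (contDiff_logWeight hβ x).continuous).aestronglyMeasurable (.of_forall fun z => by
      rw [Real.norm_eq_abs, abs_of_pos (Real.exp_pos _), exp_logWeight hβ]
      exact inv_le_one_of_one_le₀ (one_le_pow₀ (by
        nlinarith [mul_nonneg hβ (sq_nonneg ‖z - x‖)])))
  calc ∫ z in closedBall x s, F z
      ≤ ∫ z in closedBall x s,
          (1 + β * s ^ 2) ^ (n + 1) * (F z * Real.exp (logWeight β x z)) := by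
        refine setIntegral_mono_on (hF.mono_set hsΩ) ((hi.mono_set hsΩ).const_mul _)
          isClosed_closedBall.measurableSet fun z hz => ?_
        rw [mem_closedBall, dist_eq_norm] at hz
        have h1 : 1 + β * ‖z - x‖ ^ 2 ≤ 1 + β * s ^ 2 := by gcongr
        have h2 : (1 + β * ‖z - x‖ ^ 2) ^ (n + 1) ≤ (1 + β * s ^ 2) ^ (n + 1) := by gcongr
        have h3 : (0 : ℝ) < (1 + β * ‖z - x‖ ^ 2) ^ (n + 1) := by positivity
        rw [exp_logWeight hβ, mul_left_comm, ← div_eq_mul_inv]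
        exact le_mul_of_one_le_right (hF0 z) ((one_le_div h3).2 h2)
    _ ≤ ∫ z in Ω, (1 + β * s ^ 2) ^ (n + 1) * (F z * Real.exp (logWeight β x z)) :=
        setIntegral_mono_set (hi.const_mul _) (.of_forall fun z =>
          mul_nonneg (by positivity) (mul_nonneg (hF0 z) (Real.exp_pos _).le))
          hsΩ.eventuallyLE
    _ = _ := integral_const_mul _ _

/-- **Theorem 1.3.** If `i∂∂̄φ ≥ δβ` on the pseudoconvex set `Ω` and `K ⊆ Ω` is compact,
there is a constant `C` such that for every `k ≥ 1` the smooth `L²(Ω, e^{-kφ})`-minimal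
solution `v` of `∂̄v = f` satisfies `sup_K |v|² e^{-kφ} ≤ (C/k) sup_Ω |f|² e^{-kφ}`.
(The supremum bound is expressed by quantifying over all upper bounds `M` of
`|f|² e^{-kφ}` on `Ω`.) -/
theorem uniform_estimate_minimal_solution
    (Ω : Set (Cn n)) (hΩ : IsOpen Ω) (hpsc : Pseudoconvex Ω)
    (φ : Cn n → ℝ) (hφC2 : ContDiffOn ℝ 2 φ Ω)
    (hpsh : ∀ z ∈ Ω, ∀ w : Cn n, 0 ≤ LeviForm φ z w)
    (δ : ℝ) (hδ : 0 < δ)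
    (hLevi : ∀ z ∈ Ω, ∀ w : Cn n, δ * ‖w‖ ^ 2 ≤ LeviForm φ z w)
    (K : Set (Cn n)) (hK : IsCompact K) (hKΩ : K ⊆ Ω) :
    ∃ C > 0, ∀ k : ℝ, 1 ≤ k →
      ∀ f : Cn n → Fin n → ℂ, SmoothFormOn Ω f → DbarClosedOn Ω f →
        IntegrableOn (fun z => formNormSq f z * Real.exp (-(k * φ z))) Ω volume →
      ∀ v : Cn n → ℂ, ContDiffOn ℝ (⊤ : ℕ∞) v Ω →
        MinimalSolution Ω (fun z => k * φ z) f v →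
      ∀ M : ℝ, (∀ z ∈ Ω, formNormSq f z * Real.exp (-(k * φ z)) ≤ M) →
      ∀ z ∈ K, ‖v z‖ ^ 2 * Real.exp (-(k * φ z)) ≤ (C / k) * M := by
  obtain ⟨r, hr, A, hA, hT⟩ := exists_taylor_bound hΩ hK hKΩ hφC2
  set b : ℝ := δ / (6 * ((n : ℝ) + 1) ^ 2) with hb
  have hb0 : 0 < b := by positivity
  set d := Module.finrank ℝ (Cn n)
  set ω := volume.real (closedBall (0 : Cn n) 1)
  have hω : 0 < ω := ENNReal.toReal_pos (measure_closedBall_pos _ _ one_pos).ne'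
    (isCompact_closedBall 0 1).measure_ne_top
  set J := ∫ w : Cn n, ((1 + ‖w‖ ^ 2) ^ (n + 1))⁻¹ with hJ
  have hJ0 : 0 ≤ J := integral_nonneg fun w => by positivity
  set R := (r * Real.sqrt b) ^ d
  have hR : 0 < R := by positivity
  refine ⟨Real.exp (A * r ^ 2) * (8 * r ^ 2 + 2 / (R * ω) * ((1 + b * r ^ 2) ^ (n + 1) *
    (24 * J / δ))), by positivity, ?_⟩
  intro k hk f hf _ _ v hv ⟨hvi, hve, hvo⟩ M hM x hx
  have hk0 : 0 < k := one_pos.trans_le hk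
  have hM0 : 0 ≤ M := le_trans (mul_nonneg (Finset.sum_nonneg fun j _ => sq_nonneg _)
    (Real.exp_pos _).le) (hM x (hKΩ hx))
  have hv2 : ContDiffOn ℝ 2 v Ω := contDiffOn_infty.1 hv 2
  have hv1 : ContDiffOn ℝ 1 v Ω := contDiffOn_infty.1 hv 1
  have hdv := fun j => hve.dbar_eq hΩ hv1 (fun j => (hf j).continuousOn) j
  have hM' : ∀ z ∈ Ω, ∑ j, ‖dbar v z j‖ ^ 2 * Real.exp (-(k * φ z)) ≤ M := fun z hz => by
    rw [← Finset.sum_mul, Finset.sum_congr rfl fun j _ => by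
      rw [show dbar v z j = f z j from hdv j hz]]
    exact hM z hz
  have hΦ : ContDiffOn ℝ 2 (fun z => k * φ z) Ω := contDiffOn_const.mul hφC2
  have hLΦ : ∀ z ∈ Ω, ∀ w : Cn n, k * δ * ‖w‖ ^ 2 ≤ LeviForm (fun z => k * φ z) z w :=
    fun z hz w => by
      rw [leviForm_const_mul (hφC2.contDiffAt (hΩ.mem_nhds hz)), mul_assoc]
      exact mul_le_mul_of_nonneg_left (hLevi z hz w) hk0.le
  have hβ : 6 * ((n : ℝ) + 1) ^ 2 * (k * b) = k * δ := by
    rw [hb]; field_simp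
  have hβ0 : 0 < k * b := by positivity
  have hglob := hpsc.setIntegral_logWeight_le hΩ hΦ (by positivity) hLΦ hv2 hvi hvo hM0 hM' hβ x
  rw [integral_exp_logWeight hβ0] at hglob
  set s := r / Real.sqrt k with hs
  have hsq : Real.sqrt k ^ 2 = k := Real.sq_sqrt hk0.le
  have hs0 : 0 < s := by positivity
  have hs2 : s ^ 2 = r ^ 2 / k := by rw [hs, div_pow, hsq]
  have hsr : s ≤ r := div_le_self hr.le (Real.one_le_sqrt.2 hk)
  obtain ⟨hrΩ, hTx⟩ := hT x hx
  have hsb : closedBall x s ⊆ closedBall x r := closedBall_subset_closedBall hsr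
  have hsΩ := hsb.trans hrΩ
  have hD : ∀ z ∈ closedBall x s,
      |k * φ z - k * φ x - (k • fderiv ℝ φ x) (z - x)| ≤ A * r ^ 2 := by
    intro z hz
    have h1 := hTx z (hsb hz)
    have h2 : k * φ z - k * φ x - (k • fderiv ℝ φ x) (z - x) =
        k * (φ z - φ x - fderiv ℝ φ x (z - x)) := by
      simp only [smul_apply, smul_eq_mul]; ring
    rw [mem_closedBall, dist_eq_norm] at hz
    rw [h2, abs_mul, abs_of_pos hk0]
    calc k * |φ z - φ x - fderiv ℝ φ x (z - x)| ≤ k * (A * s ^ 2) := by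
          refine mul_le_mul_of_nonneg_left (h1.trans ?_) hk0.le
          gcongr
      _ = A * r ^ 2 := by rw [hs2]; field_simp
  have hloc := norm_sq_mul_exp_le_average hΩ hv1 hΦ.continuousOn hs0 hsΩ hD hM0
    fun z hz => hM' z (hsΩ hz)
  have hball := setIntegral_closedBall_le hβ0.le hsΩ
    (F := fun z => ‖v z‖ ^ 2 * Real.exp (-(k * φ z))) (fun z => by positivity) hvi.2
  set I := ∫ z in Ω, ‖v z‖ ^ 2 * Real.exp (-(k * φ z)) * Real.exp (logWeight (k * b) x z)
  set I' := ∫ z in closedBall x s, ‖v z‖ ^ 2 * Real.exp (-(k * φ z))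
  have hbs : k * b * s ^ 2 = b * r ^ 2 := by rw [hs2]; field_simp
  rw [hbs] at hball
  have hsd : s ^ d * Real.sqrt (k * b) ^ d = R := by
    rw [← mul_pow, Real.sqrt_mul hk0.le, hs]
    congr 1
    have : Real.sqrt k ≠ 0 := (Real.sqrt_pos.2 hk0).ne'
    field_simp
  rw [Measure.addHaar_real_closedBall' _ _ hs0.le] at hloc
  have hI : I ≤ 24 * M * ((Real.sqrt (k * b) ^ d)⁻¹ * J) / (k * δ) := by
    rw [le_div_iff₀ (by positivity), mul_comm]
    exact hglob
  have hsd0 : 0 < s ^ d := by positivity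
  have hβd : 0 < Real.sqrt (k * b) ^ d := by positivity
  have hI' : 2 / (s ^ d * ω) * I' ≤ 2 / (s ^ d * ω) * ((1 + b * r ^ 2) ^ (n + 1) *
      (24 * M * ((Real.sqrt (k * b) ^ d)⁻¹ * J) / (k * δ))) := by
    refine mul_le_mul_of_nonneg_left (hball.trans ?_) (by positivity)
    exact mul_le_mul_of_nonneg_left hI (by positivity)
  refine hloc.trans ((mul_le_mul_of_nonneg_left (add_le_add_right hI' _)
    (Real.exp_pos _).le).trans_eq ?_)
  rw [hs2, ← hsd]
  field_simp
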